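/- Let d ≥ 4 and let P be a prime centrally symmetric simplicial d-polytope with g_2(P) = C(d,2) − d. Then for every vertex u of P, the link lk(u) is prime: lk(u) has no missing face of cardinality d−1. -/

import Mathlib

open Finset
open scoped Classical

noncomputable section

/-- A finite graph: a finite vertex set together with a finite set of edges,
where each edge is (intended to be) a 2-element subset of the vertex set. -/
structure FinGraph (ι : Type) where
  verts : Finset ι
  edges : Finset (Finset ι)

/-- Every edge is a 2-element subset of the vertex set. -/
def FinGraph.Good {ι : Type} (G : FinGraph ι) : Prop :=
  ∀ e ∈ G.edges, e ⊆ G.verts ∧ e.card = 2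

/-- The standard inner (dot) product on `ℝ^d`. -/
def dotR {d : ℕ} (x y : Fin d → ℝ) : ℝ := ∑ i, x i * y i

/-- An infinitesimal motion of the framework `(G, p)`. -/
def IsMotion {ι : Type} {d : ℕ} (G : FinGraph ι) (p m : ι → Fin d → ℝ) : Prop :=
  ∀ e ∈ G.edges, ∀ u ∈ e, ∀ v ∈ e, dotR (p u - p v) (m u - m v) = 0

/-- The framework `(G, p)` is infinitesimally rigid in `ℝ^d`: every infinitesimal
motion is the restriction of a motion `x ↦ A x + b` of `ℝ^d` with `A` skew-symmetric. -/
def IsInfRigid {ι : Type} (d : ℕ) (G : FinGraph ι) (p : ι → Fin d → ℝ) : Prop :=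
  ∀ m : ι → Fin d → ℝ, IsMotion G p m →
    ∃ (A : Matrix (Fin d) (Fin d) ℝ) (b : Fin d → ℝ),
      A.transpose = -A ∧ ∀ v ∈ G.verts, m v = A.mulVec (p v) + b

/-- A stress on the framework `(G, p)`. -/
def IsStress {ι : Type} {d : ℕ} (G : FinGraph ι) (p : ι → Fin d → ℝ)
    (ω : Finset ι → ℝ) : Prop :=
  ∀ v ∈ G.verts,
    (∑ e ∈ G.edges.filter (fun e => v ∈ e), ∑ u ∈ e.erase v, ω e • (p v - p u)) = 0

/-- A centrally symmetric framework with free involution `ν` satisfying `p (ν v) = -(p v)`. -/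
def IsCSFramework {ι : Type} {d : ℕ} (G : FinGraph ι) (p : ι → Fin d → ℝ) (ν : ι → ι) : Prop :=
  (∀ v ∈ G.verts, ν (ν v) = v) ∧
  (∀ v ∈ G.verts, ν v ∈ G.verts) ∧
  (∀ v ∈ G.verts, ν v ≠ v) ∧
  (∀ e ∈ G.edges, e.image ν ∈ G.edges) ∧
  (∀ e ∈ G.edges, e.image ν ≠ e) ∧
  (∀ v ∈ G.verts, p (ν v) = -(p v))

/-- The convex body spanned by a finite point set. -/
def polyBody {d : ℕ} (V : Finset (Fin d → ℝ)) : Set (Fin d → ℝ) :=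
  convexHull ℝ (V : Set (Fin d → ℝ))

/-- `(f, c)` is a supporting functional for `conv V` exposing the face `F`. -/
def IsSupport {d : ℕ} (V : Finset (Fin d → ℝ)) (f : (Fin d → ℝ) →ₗ[ℝ] ℝ) (c : ℝ)
    (F : Set (Fin d → ℝ)) : Prop :=
  (∀ y ∈ polyBody V, f y ≤ c) ∧ F = {y ∈ polyBody V | f y = c}

/-- A proper face of the polytope `conv V`. -/
def IsProperFace {d : ℕ} (V : Finset (Fin d → ℝ)) (F : Set (Fin d → ℝ)) : Prop :=
  (∃ f c, IsSupport V f c F) ∧ F ≠ polyBody V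

/-- A simplicial `d`-polytope in `ℝ^d`, recorded by its vertex set `V`: the polytope is
`conv V`, it is `d`-dimensional, every element of `V` is a vertex, and every proper face
is a simplex (the convex hull of its affinely independent vertex set). -/
structure SPolytope (d : ℕ) where
  V : Finset (Fin d → ℝ)
  span_top : affineSpan ℝ (V : Set (Fin d → ℝ)) = ⊤
  extreme : ∀ v ∈ V, v ∉ convexHull ℝ ((V.erase v : Finset (Fin d → ℝ)) : Set (Fin d → ℝ))
  simplicial : ∀ F : Set (Fin d → ℝ), IsProperFace V F →
    AffineIndependent ℝ
      (fun x : {y : Fin d → ℝ // y ∈ (V : Set (Fin d → ℝ)) ∩ F} => (x : Fin d → ℝ)) ∧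
    F = convexHull ℝ ((V : Set (Fin d → ℝ)) ∩ F)

/-- `s` is a face of the boundary complex `∂P`. -/
def BFace {d : ℕ} (P : SPolytope d) (s : Finset (Fin d → ℝ)) : Prop :=
  s ⊆ P.V ∧ ∃ F : Set (Fin d → ℝ), IsProperFace P.V F ∧ (s : Set (Fin d → ℝ)) ⊆ F

/-- The number of vertices of `∂P`. -/
def f0 {d : ℕ} (P : SPolytope d) : ℕ := P.V.card

/-- The edges of `∂P`. -/
def edgeFinset {d : ℕ} (P : SPolytope d) : Finset (Finset (Fin d → ℝ)) :=
  P.V.powerset.filter fun e => e.card = 2 ∧ BFace P e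

/-- The number of edges of `∂P`. -/
def f1 {d : ℕ} (P : SPolytope d) : ℕ := (edgeFinset P).card

/-- `g₂(P) = f₁ - d f₀ + C(d+1, 2)`. -/
def g2 {d : ℕ} (P : SPolytope d) : ℤ :=
  (f1 P : ℤ) - (d : ℤ) * (f0 P : ℤ) + ((d + 1).choose 2 : ℤ)

/-- `P` is centrally symmetric. -/
def IsCS {d : ℕ} (P : SPolytope d) : Prop := ∀ v ∈ P.V, -v ∈ P.V

/-- A missing face of `∂P`. -/
def IsMissingFace {d : ℕ} (P : SPolytope d) (σ : Finset (Fin d → ℝ)) : Prop :=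
  σ ⊆ P.V ∧ ¬ BFace P σ ∧ ∀ τ ⊂ σ, BFace P τ

/-- `P` is prime: `∂P` has no missing facet, i.e. no missing face of cardinality `d`. -/
def IsPrimePoly {d : ℕ} (P : SPolytope d) : Prop :=
  ¬ ∃ σ : Finset (Fin d → ℝ), IsMissingFace P σ ∧ σ.card = d

/-- The graph (1-skeleton) of `∂P` as a framework graph. -/
def fullGraph {d : ℕ} (P : SPolytope d) : FinGraph (Fin d → ℝ) :=
  ⟨P.V, edgeFinset P⟩

/-- The graph (1-skeleton) of the star of the face `τ` in `∂P`. -/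
def starGraph {d : ℕ} (P : SPolytope d) (τ : Finset (Fin d → ℝ)) : FinGraph (Fin d → ℝ) :=
  ⟨P.V.filter fun v => BFace P (insert v τ),
   P.V.powerset.filter fun e => e.card = 2 ∧ BFace P (e ∪ τ)⟩

/-- Adjacency in the graph of `∂P`. -/
def Adj {d : ℕ} (P : SPolytope d) (u v : Fin d → ℝ) : Prop :=
  u ≠ v ∧ BFace P {u, v}

/-- `σ` is a face of the link of the face `τ` in `∂P`. -/
def LinkFace {d : ℕ} (P : SPolytope d) (τ σ : Finset (Fin d → ℝ)) : Prop :=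
  Disjoint σ τ ∧ BFace P (σ ∪ τ)

/-- `P` is a `d`-dimensional cross-polytope: its vertex set is `{±b₁, …, ±b_d}`
for some basis `b₁, …, b_d` of `ℝ^d`. -/
def IsCrossPolytope {d : ℕ} (P : SPolytope d) : Prop :=
  ∃ b : Fin d → (Fin d → ℝ), LinearIndependent ℝ b ∧
    (P.V : Set (Fin d → ℝ)) = Set.range b ∪ Set.range (fun i => -(b i))

/-- A facet of `P`: a proper face with `d` vertices. -/
def IsFacet {d : ℕ} (P : SPolytope d) (F : Set (Fin d → ℝ)) : Prop :=
  IsProperFace P.V F ∧ ((P.V : Set (Fin d → ℝ)) ∩ F).ncard = d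

/-- `x` lies beyond exactly one facet of `P`: it is strictly separated from `P` by the
affine hull of one facet `F`, and not separated from `P` by the affine hull of any
other facet. -/
def BeyondExactlyOne {d : ℕ} (P : SPolytope d) (x : Fin d → ℝ) : Prop :=
  ∃ F : Set (Fin d → ℝ), IsFacet P F ∧
    (∀ f c, IsSupport P.V f c F → c < f x) ∧
    (∀ F' : Set (Fin d → ℝ), IsFacet P F' → F' ≠ F →
      ∀ f c, IsSupport P.V f c F' → f x < c)

/-- `P` is obtained from a `d`-dimensional cross-polytope by symmetric stacking: there is
a sequence of cs simplicial `d`-polytopes starting at a cross-polytope and ending at `P`,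
each obtained from the previous one as `conv (P_k ∪ {v, -v})` for a point `v` lying
beyond exactly one facet of `P_k`. -/
def SymmetricStackingFrom {d : ℕ} (P : SPolytope d) : Prop :=
  ∃ (m : ℕ) (Q : Fin (m + 1) → SPolytope d),
    (∀ k, IsCS (Q k)) ∧
    IsCrossPolytope (Q 0) ∧
    Q (Fin.last m) = P ∧
    ∀ k : Fin m, ∃ v : Fin d → ℝ,
      BeyondExactlyOne (Q (Fin.castSucc k)) v ∧
      polyBody (Q (Fin.succ k)).V =
        convexHull ℝ (polyBody (Q (Fin.castSucc k)).V ∪ {v, -v})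

/-- `P` is a stacked `d`-polytope: obtained from a `d`-simplex by repeatedly adding a
point beyond exactly one facet. -/
def IsStacked {d : ℕ} (P : SPolytope d) : Prop :=
  ∃ (m : ℕ) (R : Fin (m + 1) → SPolytope d),
    (R 0).V.card = d + 1 ∧
    R (Fin.last m) = P ∧
    ∀ k : Fin m, ∃ v : Fin d → ℝ,
      BeyondExactlyOne (R (Fin.castSucc k)) v ∧
      polyBody (R (Fin.succ k)).V =
        convexHull ℝ (polyBody (R (Fin.castSucc k)).V ∪ {v})

/-- Every `d` vertices of `P`, no two of which are antipodal, are affinely independent. -/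
def GenPos {d : ℕ} (P : SPolytope d) : Prop :=
  ∀ S : Finset (Fin d → ℝ), S ⊆ P.V → S.card = d →
    (∀ x ∈ S, ∀ y ∈ S, x ≠ -y) →
    AffineIndependent ℝ (fun s : {x : Fin d → ℝ // x ∈ S} => (s : Fin d → ℝ))

/-- The graph of the cone `v₀ * S` over a simplicial complex `S` (a set of finsets):
the vertices of `S` together with `v₀`, and the edges of `S` together with all edges
from `v₀` to vertices of `S`. -/
def coneGraph {d : ℕ} (P : SPolytope d) (v0 : Fin d → ℝ)
    (S : Set (Finset (Fin d → ℝ))) : FinGraph (Fin d → ℝ) :=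
  ⟨insert v0 (P.V.filter fun u => ({u} : Finset (Fin d → ℝ)) ∈ S),
   (P.V.powerset.filter fun e => e.card = 2 ∧ e ∈ S) ∪
     (P.V.filter fun u => ({u} : Finset (Fin d → ℝ)) ∈ S).image
       fun u => ({v0, u} : Finset (Fin d → ℝ))⟩

open Finset
open scoped Classical
noncomputable section

/-! ### Three-dimensional fans and their mixed-volume type forms -/

/-- The determinant of three vectors of `ℝ³`. -/
def det3 (a b c : Fin 3 → ℝ) : ℝ :=
  a 0 * (b 1 * c 2 - b 2 * c 1) - a 1 * (b 0 * c 2 - b 2 * c 0) + a 2 * (b 0 * c 1 - b 1 * c 0)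

theorem det3_cramer (a b c x : Fin 3 → ℝ) :
    det3 a b c • x = det3 x b c • a + det3 a x c • b + det3 a b x • c := by
  ext t; fin_cases t <;> simp [det3] <;> ring

theorem det3_sum_right {κ : Type*} (s : Finset κ) (a b : Fin 3 → ℝ) (f : κ → Fin 3 → ℝ) :
    det3 a b (∑ k ∈ s, f k) = ∑ k ∈ s, det3 a b (f k) := by
  simp only [det3, Finset.sum_apply, Finset.mul_sum, ← Finset.sum_sub_distrib, ← Finset.sum_add_distrib]

theorem det3_smul_right (a b c : Fin 3 → ℝ) (t : ℝ) :
    det3 a b (t • c) = t * det3 a b c := by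
  simp [det3]; ring

theorem det3_add_right (a b c c' : Fin 3 → ℝ) :
    det3 a b (c + c') = det3 a b c + det3 a b c' := by
  simp [det3]; ring

theorem det3_swap12 (a b c : Fin 3 → ℝ) : det3 b a c = - det3 a b c := by
  simp [det3]; ring
theorem det3_swap23 (a b c : Fin 3 → ℝ) : det3 a c b = - det3 a b c := by
  simp [det3]; ring
theorem det3_self12 (a c : Fin 3 → ℝ) : det3 a a c = 0 := by
  simp [det3]; ring
theorem det3_self23 (a c : Fin 3 → ℝ) : det3 a c c = 0 := by
  simp [det3]; ring
theorem det3_self13 (a c : Fin 3 → ℝ) : det3 a c a = 0 := by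
  simp [det3]; ring

/-- `det3` as a linear functional in the last variable. -/
def det3L (a b : Fin 3 → ℝ) : (Fin 3 → ℝ) →ₗ[ℝ] ℝ where
  toFun c := det3 a b c
  map_add' x y := det3_add_right a b x y
  map_smul' t x := by simp [det3_smul_right]

@[simp] theorem det3L_apply (a b c : Fin 3 → ℝ) : det3L a b c = det3 a b c := rfl

/-- Interpolation by a linear functional. -/
theorem det3_interp (a b c : Fin 3 → ℝ) (h : det3 a b c ≠ 0) (x y z : ℝ) :
    ∃ L : (Fin 3 → ℝ) →ₗ[ℝ] ℝ, L a = x ∧ L b = y ∧ L c = z := by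
  refine ⟨(x / det3 a b c) • det3L b c + (y / det3 a b c) • det3L c a + (z / det3 a b c) • det3L a b,
    ?_, ?_, ?_⟩
  all_goals
    simp only [LinearMap.add_apply, LinearMap.smul_apply, det3L_apply, smul_eq_mul, det3_self23, det3_self13]
  · have : det3 b c a = det3 a b c := by simp [det3]; ring
    rw [this]; field_simp; ring
  · have : det3 c a b = det3 a b c := by simp [det3]; ring
    rw [this]; field_simp; ring
  · field_simp; ring

/-- A coplanarity certificate. -/
theorem det3_span (a b c x : Fin 3 → ℝ) (h : det3 a b c ≠ 0) (h0 : det3 a b x = 0) :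
    ∃ s t : ℝ, x = s • a + t • b := by
  refine ⟨det3 x b c / det3 a b c, det3 a x c / det3 a b c, ?_⟩
  have := det3_cramer a b c x
  rw [h0, zero_smul, add_zero] at this
  rw [div_eq_inv_mul, div_eq_inv_mul, mul_smul, mul_smul, ← smul_add, ← this, smul_smul,
    inv_mul_cancel₀ h, one_smul]

theorem det3_collinear (a x : Fin 3 → ℝ) (ha : a ≠ 0) (h0 : ∀ z, det3 z a x = 0) :
    ∃ s : ℝ, x = s • a := by
  obtain ⟨t, ht⟩ := Function.ne_iff.mp ha
  have e0 := h0 ![1,0,0]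
  have e1 := h0 ![0,1,0]
  have e2 := h0 ![0,0,1]
  simp [det3] at e0 e1 e2 ht
  refine ⟨x t / a t, ?_⟩
  ext j
  simp only [Pi.smul_apply, smul_eq_mul]
  rw [div_mul_eq_mul_div, eq_div_iff ht]
  fin_cases t <;> fin_cases j <;> simp <;> linarith

/-- A complete simplicial fan in `ℝ³` with a strictly convex support function `φ`. -/
structure Fan3 (ι : Type*) [Fintype ι] where
  p : ι → Fin 3 → ℝ
  T : ι → ι → ι → Prop
  φ : ι → ℝ
  T_swap : ∀ i j k, T i j k → T j i k
  T_rot : ∀ i j k, T i j k → T j k i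
  D_ne : ∀ i j k, T i j k → det3 (p i) (p j) (p k) ≠ 0
  φ_pos : ∀ i, 0 < φ i
  supp : ∀ i j k, T i j k → ∃ β : (Fin 3 → ℝ) →ₗ[ℝ] ℝ, β (p i) = φ i ∧ β (p j) = φ j ∧
    β (p k) = φ k ∧ ∀ l, l ≠ i → l ≠ j → l ≠ k → β (p l) < φ l
  ridge : ∀ i j k, T i j k → ∃ k', k' ≠ k ∧ T i j k'
  cover : ∀ i, ∃ j k, T i j k

namespace Fan3
variable {ι : Type*} [Fintype ι] (Φ : Fan3 ι)

theorem T_swap23 {i j k : ι} (h : Φ.T i j k) : Φ.T i k j :=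
  Φ.T_swap _ _ _ (Φ.T_rot _ _ _ (Φ.T_rot _ _ _ h))

/-- determinants -/
def D (i j k : ι) : ℝ := det3 (Φ.p i) (Φ.p j) (Φ.p k)

/-- weights -/
def w (i j k : ι) : ℝ := if Φ.T i j k then 1 / |Φ.D i j k| else 0

theorem D_ne' {i j k : ι} (h : Φ.T i j k) : Φ.D i j k ≠ 0 := Φ.D_ne _ _ _ h

theorem ne12 {i j k : ι} (h : Φ.T i j k) : i ≠ j := by
  rintro rfl; exact Φ.D_ne' h (det3_self12 _ _)
theorem ne23 {i j k : ι} (h : Φ.T i j k) : j ≠ k := by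
  rintro rfl; exact Φ.D_ne' h (det3_self23 _ _)
theorem ne13 {i j k : ι} (h : Φ.T i j k) : i ≠ k := by
  rintro rfl; exact Φ.D_ne' h (det3_self13 _ _)

theorem w_swap12 (i j k : ι) : Φ.w i j k = Φ.w j i k := by
  unfold w
  have : Φ.T i j k ↔ Φ.T j i k := ⟨Φ.T_swap _ _ _, Φ.T_swap _ _ _⟩
  simp only [this, D]
  rw [det3_swap12, abs_neg]

theorem w_swap23 (i j k : ι) : Φ.w i j k = Φ.w i k j := by
  unfold w
  have : Φ.T i j k ↔ Φ.T i k j := ⟨Φ.T_swap23, Φ.T_swap23⟩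
  simp only [this, D]
  rw [det3_swap23, abs_neg]

theorem w_nonneg (i j k : ι) : 0 ≤ Φ.w i j k := by
  unfold w; split_ifs <;> positivity

theorem w_pos {i j k : ι} (h : Φ.T i j k) : 0 < Φ.w i j k := by
  unfold w; rw [if_pos h]; have := Φ.D_ne' h; positivity

theorem w_zero {i j k : ι} (h : ¬ Φ.T i j k) : Φ.w i j k = 0 := by
  unfold w; rw [if_neg h]

theorem T_of_w {i j k : ι} (h : Φ.w i j k ≠ 0) : Φ.T i j k := by
  by_contra h'; exact h (Φ.w_zero h')

/-- A function `ψ = φ - β∘p`, nonnegative, vanishing exactly on the facet. -/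
theorem exists_psi {i j k : ι} (h : Φ.T i j k) : ∃ (β : (Fin 3 → ℝ) →ₗ[ℝ] ℝ),
    Φ.φ i - β (Φ.p i) = 0 ∧ Φ.φ j - β (Φ.p j) = 0 ∧ Φ.φ k - β (Φ.p k) = 0 ∧
    (∀ l, 0 ≤ Φ.φ l - β (Φ.p l)) ∧ ∀ l, Φ.φ l - β (Φ.p l) = 0 → l = i ∨ l = j ∨ l = k := by
  obtain ⟨β, hi, hj, hk, hl⟩ := Φ.supp i j k h
  refine ⟨β, by linarith, by linarith, by linarith, ?_, ?_⟩
  · intro l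
    by_cases h1 : l = i
    · subst h1; linarith
    by_cases h2 : l = j
    · subst h2; linarith
    by_cases h3 : l = k
    · subst h3; linarith
    linarith [hl l h1 h2 h3]
  · intro l h0
    by_contra hh
    push Not at hh
    linarith [hl l hh.1 hh.2.1 hh.2.2]

theorem opp {i j k k' : ι} (h : Φ.T i j k) (h' : Φ.T i j k') (hne : k' ≠ k) :
    Φ.D i j k * Φ.D i j k' < 0 := by
  obtain ⟨β, b1, b2, b3, b4, b5⟩ := Φ.exists_psi h
  obtain ⟨γ, c1, c2, c3, c4, c5⟩ := Φ.exists_psi h'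
  -- psi at k' positive, psi' at k positive
  have e1 : 0 < Φ.φ k' - β (Φ.p k') := lt_of_le_of_ne (b4 _) (fun h0 => by
    rcases b5 k' h0.symm with h1 | h1 | h1
    · exact Φ.ne13 h' h1.symm
    · exact Φ.ne23 h' h1.symm
    · exact hne h1)
  have e2 : 0 < Φ.φ k - γ (Φ.p k) := lt_of_le_of_ne (c4 _) (fun h0 => by
    rcases c5 k h0.symm with h1 | h1 | h1
    · exact Φ.ne13 h h1.symm
    · exact Φ.ne23 h h1.symm
    · exact hne h1.symm)
  have cr := congrArg (fun x => β x - γ x) (det3_cramer (Φ.p i) (Φ.p j) (Φ.p k) (Φ.p k'))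
  simp only [map_add, map_smul, smul_eq_mul] at cr
  change Φ.D i j k * _ - Φ.D i j k * _ = _ + Φ.D i j k' * _ - (_ + Φ.D i j k' * _) at cr
  have k1 : Φ.D i j k * (β (Φ.p k') - γ (Φ.p k')) = Φ.D i j k' * (β (Φ.p k) - γ (Φ.p k)) := by
    have q1 : β (Φ.p i) = γ (Φ.p i) := by linarith
    have q2 : β (Φ.p j) = γ (Φ.p j) := by linarith
    rw [q1, q2] at cr; linarith
  have hD := Φ.D_ne' h
  have hD' := Φ.D_ne' h'
  set A := Φ.D i j k
  set B := Φ.D i j k'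
  have k2 : A * A * (β (Φ.p k') - γ (Φ.p k')) = A * B * (β (Φ.p k) - γ (Φ.p k)) := by
    rw [mul_assoc, k1]; ring
  have : 0 < A * A := mul_self_pos.mpr hD
  by_contra hcon
  push Not at hcon
  have u1 : β (Φ.p k') - γ (Φ.p k') < 0 := by linarith
  have u2 : 0 < β (Φ.p k) - γ (Φ.p k) := by linarith
  nlinarith [mul_nonneg hcon u2.le, mul_neg_of_pos_of_neg this u1]

theorem at_most_two {i j k k' l : ι} (h : Φ.T i j k) (h' : Φ.T i j k') (hne : k' ≠ k)
    (hl : Φ.T i j l) : l = k ∨ l = k' := by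
  by_contra hh
  push Not at hh
  have a := Φ.opp h h' hne
  have b := Φ.opp h hl hh.1
  have c := Φ.opp h' hl hh.2
  have := mul_pos_of_neg_of_neg a b
  nlinarith [sq_nonneg (Φ.D i j k), mul_nonneg (sq_nonneg (Φ.D i j k)) (neg_nonneg.mpr c.le)]

theorem balance (i j : ι) : ∑ k, Φ.w i j k * Φ.D i j k = 0 := by
  by_cases h : ∃ k, Φ.T i j k
  · obtain ⟨k, hk⟩ := h
    obtain ⟨k', hne, hk'⟩ := Φ.ridge i j k hk
    rw [← Finset.sum_subset (Finset.subset_univ {k, k'})]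
    · rw [Finset.sum_pair hne.symm]
      have := Φ.opp hk hk' hne
      unfold w
      rw [if_pos hk, if_pos hk']
      rcases lt_or_gt_of_ne (Φ.D_ne' hk) with h1 | h1
      · have h2 : 0 < Φ.D i j k' := by nlinarith
        have := h1.ne
        rw [abs_of_neg h1, abs_of_pos h2]; field_simp; norm_num
      · have h2 : Φ.D i j k' < 0 := by nlinarith
        have := h2.ne
        rw [abs_of_pos h1, abs_of_neg h2]; field_simp; norm_num
    · intro l _ hl
      rw [Φ.w_zero, zero_mul]
      intro hT
      apply hl
      rcases Φ.at_most_two hk hk' hne hT with h | h <;> simp [h]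
  · push Not at h
    exact Finset.sum_eq_zero fun k _ => by rw [Φ.w_zero (h k), zero_mul]

theorem exists_a : ∃ a : ι → ι → ℝ, (∀ i j, (∀ k, ¬ Φ.T i j k) → a i j = 0) ∧
    ∀ i j, ∑ k, Φ.w i j k • Φ.p k = a i j • Φ.p j + a j i • Φ.p i := by
  have key : ∀ i j, ∃ α β : ℝ, ((∀ k, ¬ Φ.T i j k) → α = 0 ∧ β = 0) ∧
      ∑ k, Φ.w i j k • Φ.p k = α • Φ.p j + β • Φ.p i := by
    intro i j
    by_cases h : ∃ k, Φ.T i j k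
    · obtain ⟨k, hk⟩ := h
      obtain ⟨s, t, hst⟩ := det3_span (Φ.p i) (Φ.p j) (Φ.p k) (∑ k, Φ.w i j k • Φ.p k) (Φ.D_ne' hk)
        (by rw [det3_sum_right]; simp only [det3_smul_right]; exact Φ.balance i j)
      exact ⟨t, s, fun h => absurd hk (h k), by rw [hst, add_comm]⟩
    · push Not at h
      refine ⟨0, 0, fun _ => ⟨rfl, rfl⟩, ?_⟩
      simp [Φ.w_zero (h _)]
  choose α β h1 h2 using key
  have hT : ∀ i j, (∀ k, ¬ Φ.T i j k) → ∀ k, ¬ Φ.T j i k := fun i j h k hk =>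
    h k (Φ.T_swap _ _ _ hk)
  refine ⟨fun i j => (α i j + β j i) / 2, ?_, ?_⟩
  · intro i j h
    simp [(h1 i j h).1, (h1 j i (hT i j h)).2]
  · intro i j
    have e1 := h2 i j
    have e2 := h2 j i
    simp only [Φ.w_swap12 j i] at e2
    have : ∑ k, Φ.w i j k • Φ.p k = (1/2 : ℝ) • (∑ k, Φ.w i j k • Φ.p k) + (1/2 : ℝ) • (∑ k, Φ.w i j k • Φ.p k) := by
      rw [← add_smul]; norm_num
    rw [this]
    nth_rewrite 1 [e1]
    rw [e2]
    module

/-- the coefficients `a` -/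
def a : ι → ι → ℝ := Classical.choose Φ.exists_a
theorem a_zero {i j : ι} (h : ∀ k, ¬ Φ.T i j k) : Φ.a i j = 0 :=
  (Classical.choose_spec Φ.exists_a).1 i j h
theorem a_spec (i j : ι) : ∑ k, Φ.w i j k • Φ.p k = Φ.a i j • Φ.p j + Φ.a j i • Φ.p i :=
  (Classical.choose_spec Φ.exists_a).2 i j

theorem a_lin (L : (Fin 3 → ℝ) →ₗ[ℝ] ℝ) (i j : ι) :
    ∑ k, Φ.w i j k * L (Φ.p k) = Φ.a i j * L (Φ.p j) + Φ.a j i * L (Φ.p i) := by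
  have := congrArg L (Φ.a_spec i j)
  simpa only [map_sum, map_add, map_smul, smul_eq_mul] using this

theorem p_ne (i : ι) : Φ.p i ≠ 0 := by
  obtain ⟨j, k, h⟩ := Φ.cover i
  intro h0
  apply Φ.D_ne' h
  simp [D, h0, det3]

theorem exists_e (i : ι) : ∃ e : ℝ, ∑ j, Φ.a j i • Φ.p j = e • Φ.p i := by
  apply det3_collinear _ _ (Φ.p_ne i)
  intro z
  rw [det3_sum_right]
  simp only [det3_smul_right]
  have h1 : ∀ j, Φ.a j i * det3 z (Φ.p i) (Φ.p j) = ∑ k, Φ.w i j k * det3 z (Φ.p k) (Φ.p j) := by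
    intro j
    have h := Φ.a_lin (det3L z (Φ.p j)) i j
    simp only [det3L_apply, det3_self23, mul_zero, zero_add] at h
    rw [det3_swap23]
    simp_rw [det3_swap23 z (Φ.p j)]
    simp only [mul_neg, Finset.sum_neg_distrib, h]
  simp_rw [h1]
  have h2 : ∑ j, ∑ k, Φ.w i j k * det3 z (Φ.p k) (Φ.p j)
      = - ∑ j, ∑ k, Φ.w i j k * det3 z (Φ.p k) (Φ.p j) := by
    conv_lhs => rw [Finset.sum_comm]
    simp only [← Finset.sum_neg_distrib]
    refine Finset.sum_congr rfl fun j _ => Finset.sum_congr rfl fun k _ => ?_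
    rw [Φ.w_swap23 i k j, det3_swap23 z (Φ.p k) (Φ.p j)]
    ring
  linarith

/-- the coefficients `e` -/
def e (i : ι) : ℝ := Classical.choose (Φ.exists_e i)
theorem e_lin (L : (Fin 3 → ℝ) →ₗ[ℝ] ℝ) (i : ι) :
    ∑ j, Φ.a j i * L (Φ.p j) = Φ.e i * L (Φ.p i) := by
  have := congrArg L (Classical.choose_spec (Φ.exists_e i))
  simp only [map_sum, map_smul, smul_eq_mul] at this
  exact this

/-- the off-diagonal stress -/
def om (x : ι → ℝ) (i j : ι) : ℝ := ∑ k, Φ.w i j k * x k - Φ.a i j * x j - Φ.a j i * x i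

/-- the diagonal stress -/
def omd (x : ι → ℝ) (i : ι) : ℝ := Φ.e i * x i - ∑ k, Φ.a k i * x k

/-- the local form -/
def Vf (i : ι) (x y : ι → ℝ) : ℝ := ∑ j, Φ.om x i j * y j + Φ.omd x i * y i

theorem Vf_eq (i : ι) (x y : ι → ℝ) : Φ.Vf i x y = ∑ j, ∑ k, Φ.w i j k * (x k * y j)
    - ∑ j, Φ.a i j * (x j * y j) - x i * ∑ j, Φ.a j i * y j - y i * ∑ j, Φ.a j i * x j
    + Φ.e i * (x i * y i) := by
  unfold Vf om omd
  simp only [sub_mul, Finset.sum_sub_distrib, Finset.sum_mul, Finset.mul_sum]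
  have e1 : ∑ j, Φ.a j i * x i * y j = ∑ j, x i * (Φ.a j i * y j) :=
    Finset.sum_congr rfl fun j _ => by ring
  have e2 : ∑ j, Φ.a j i * x j * y i = ∑ j, y i * (Φ.a j i * x j) :=
    Finset.sum_congr rfl fun j _ => by ring
  have e3 : ∑ j, ∑ k, Φ.w i j k * x k * y j = ∑ j, ∑ k, Φ.w i j k * (x k * y j) :=
    Finset.sum_congr rfl fun j _ => Finset.sum_congr rfl fun k _ => by ring
  have e4 : ∑ j, Φ.a i j * x j * y j = ∑ j, Φ.a i j * (x j * y j) :=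
    Finset.sum_congr rfl fun j _ => by ring
  rw [e1, e2, e3, e4]; ring

theorem Vf_symm (i : ι) (x y : ι → ℝ) : Φ.Vf i x y = Φ.Vf i y x := by
  rw [Vf_eq, Vf_eq]
  have e1 : ∑ j, ∑ k, Φ.w i j k * (x k * y j) = ∑ j, ∑ k, Φ.w i j k * (y k * x j) := by
    rw [Finset.sum_comm]
    refine Finset.sum_congr rfl fun j _ => Finset.sum_congr rfl fun k _ => ?_
    rw [Φ.w_swap23]; ring
  have e2 : ∑ j, Φ.a i j * (x j * y j) = ∑ j, Φ.a i j * (y j * x j) :=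
    Finset.sum_congr rfl fun j _ => by ring
  rw [e1, e2]; ring

theorem tri_symm (x y z : ι → ℝ) : ∑ i, z i * Φ.Vf i x y = ∑ i, x i * Φ.Vf i z y := by
  simp only [Vf_eq, mul_add, mul_sub, Finset.sum_add_distrib, Finset.sum_sub_distrib, Finset.mul_sum]
  have e1 : ∑ i, ∑ j, ∑ k, z i * (Φ.w i j k * (x k * y j)) =
      ∑ i, ∑ j, ∑ k, x i * (Φ.w i j k * (z k * y j)) := by
    rw [Finset.sum_comm]
    conv_rhs => rw [Finset.sum_comm]
    refine Finset.sum_congr rfl fun j _ => ?_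
    rw [Finset.sum_comm]
    refine Finset.sum_congr rfl fun k _ => Finset.sum_congr rfl fun i _ => ?_
    rw [Φ.w_swap12 i j k, Φ.w_swap23 j i k, Φ.w_swap12 j k i]; ring
  have e2 : ∑ i, ∑ j, z i * (Φ.a i j * (x j * y j)) = ∑ i, ∑ j, x i * (y i * (Φ.a j i * z j)) := by
    rw [Finset.sum_comm]
    refine Finset.sum_congr rfl fun j _ => Finset.sum_congr rfl fun i _ => by ring
  have e3 : ∑ i, ∑ j, x i * (Φ.a i j * (z j * y j)) = ∑ i, ∑ j, z i * (y i * (Φ.a j i * x j)) := by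
    rw [Finset.sum_comm]
    refine Finset.sum_congr rfl fun j _ => Finset.sum_congr rfl fun i _ => by ring
  have e4 : ∑ i, ∑ j, z i * (x i * (Φ.a j i * y j)) = ∑ i, ∑ j, x i * (z i * (Φ.a j i * y j)) :=
    Finset.sum_congr rfl fun i _ => Finset.sum_congr rfl fun j _ => by ring
  have e5 : ∑ i, z i * (Φ.e i * (x i * y i)) = ∑ i, x i * (Φ.e i * (z i * y i)) :=
    Finset.sum_congr rfl fun i _ => by ring
  rw [e1, e2, e3, e4, e5]; ring

theorem om_lin (L : (Fin 3 → ℝ) →ₗ[ℝ] ℝ) (i j : ι) : Φ.om (fun l => L (Φ.p l)) i j = 0 := by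
  unfold om; rw [Φ.a_lin]; ring

theorem omd_lin (L : (Fin 3 → ℝ) →ₗ[ℝ] ℝ) (i : ι) : Φ.omd (fun l => L (Φ.p l)) i = 0 := by
  unfold omd; rw [Φ.e_lin]; ring

theorem om_add (x y : ι → ℝ) (i j : ι) : Φ.om (fun l => x l + y l) i j = Φ.om x i j + Φ.om y i j := by
  unfold om; simp only [mul_add, Finset.sum_add_distrib]; ring
theorem om_smul (t : ℝ) (x : ι → ℝ) (i j : ι) : Φ.om (fun l => t * x l) i j = t * Φ.om x i j := by
  unfold om
  have : ∑ k, Φ.w i j k * (t * x k) = t * ∑ k, Φ.w i j k * x k := by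
    rw [Finset.mul_sum]; exact Finset.sum_congr rfl fun k _ => by ring
  rw [this]; ring
theorem omd_add (x y : ι → ℝ) (i : ι) : Φ.omd (fun l => x l + y l) i = Φ.omd x i + Φ.omd y i := by
  unfold omd; simp only [mul_add, Finset.sum_add_distrib]; ring
theorem omd_smul (t : ℝ) (x : ι → ℝ) (i : ι) : Φ.omd (fun l => t * x l) i = t * Φ.omd x i := by
  unfold omd
  have : ∑ k, Φ.a k i * (t * x k) = t * ∑ k, Φ.a k i * x k := by
    rw [Finset.mul_sum]; exact Finset.sum_congr rfl fun k _ => by ring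
  rw [this]; ring

theorem Vf_add (i : ι) (x y z : ι → ℝ) : Φ.Vf i (fun l => x l + y l) z = Φ.Vf i x z + Φ.Vf i y z := by
  unfold Vf; simp only [om_add, omd_add, add_mul, Finset.sum_add_distrib]; ring
theorem Vf_smul (i : ι) (t : ℝ) (x z : ι → ℝ) : Φ.Vf i (fun l => t * x l) z = t * Φ.Vf i x z := by
  unfold Vf; simp only [om_smul, omd_smul, mul_add, Finset.mul_sum, mul_assoc]
theorem Vf_lin (L : (Fin 3 → ℝ) →ₗ[ℝ] ℝ) (i : ι) (z : ι → ℝ) : Φ.Vf i (fun l => L (Φ.p l)) z = 0 := by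
  unfold Vf; simp only [om_lin, omd_lin]; simp
theorem Vf_lin' (L : (Fin 3 → ℝ) →ₗ[ℝ] ℝ) (i : ι) (z : ι → ℝ) : Φ.Vf i z (fun l => L (Φ.p l)) = 0 := by
  rw [Vf_symm, Vf_lin]

/-- subtracting a linear function and a multiple of another -/
theorem Vf_comb (i : ι) (x y z : ι → ℝ) (c : ℝ) (L : (Fin 3 → ℝ) →ₗ[ℝ] ℝ) :
    Φ.Vf i (fun l => x l - L (Φ.p l) - c * y l) z = Φ.Vf i x z - c * Φ.Vf i y z := by
  have : (fun l => x l - L (Φ.p l) - c * y l) =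
      fun l => (x l + (-1) * L (Φ.p l)) + (-c) * y l := by ext l; ring
  rw [this, Vf_add, Vf_smul, Vf_add, Vf_smul, Vf_lin]; ring

theorem om_comb (i j : ι) (x y : ι → ℝ) (c : ℝ) (L : (Fin 3 → ℝ) →ₗ[ℝ] ℝ) :
    Φ.om (fun l => x l - L (Φ.p l) - c * y l) i j = Φ.om x i j - c * Φ.om y i j := by
  have : (fun l => x l - L (Φ.p l) - c * y l) =
      fun l => (x l + (-1) * L (Φ.p l)) + (-c) * y l := by ext l; ring
  rw [this, om_add, om_smul, om_add, om_smul, om_lin]; ring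

theorem om_symm (x : ι → ℝ) (i j : ι) : Φ.om x i j = Φ.om x j i := by
  unfold om; simp only [Φ.w_swap12 i j]; ring

theorem om_zero (x : ι → ℝ) {i j : ι} (h : ∀ k, ¬ Φ.T i j k) : Φ.om x i j = 0 := by
  unfold om
  rw [Φ.a_zero h, Φ.a_zero (i := j) (j := i) (fun k hk => h k (Φ.T_swap _ _ _ hk))]
  simp [Φ.w_zero (h _)]

/-- the symmetric matrix entries `c` are positive on edges -/
theorem c_pos {i j k : ι} (h : Φ.T i j k) : 0 < Φ.om Φ.φ i j := by
  obtain ⟨β, b1, b2, b3, b4, b5⟩ := Φ.exists_psi h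
  have h1 := Φ.om_comb i j Φ.φ (fun _ => 0) 0 β
  simp only [mul_zero, sub_zero, zero_mul] at h1
  rw [← h1]
  unfold om
  simp only [b1, b2, mul_zero, sub_zero]
  obtain ⟨k', hne, hk'⟩ := Φ.ridge i j k h
  refine Finset.sum_pos' (fun l _ => mul_nonneg (Φ.w_nonneg _ _ _) (b4 l)) ⟨k', Finset.mem_univ _, ?_⟩
  refine mul_pos (Φ.w_pos hk') (lt_of_le_of_ne (b4 _) fun h0 => ?_)
  rcases b5 k' h0.symm with h2 | h2 | h2
  · exact Φ.ne13 hk' h2.symm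
  · exact Φ.ne23 hk' h2.symm
  · exact hne h2

theorem c_nonneg (i j : ι) : 0 ≤ Φ.om Φ.φ i j := by
  by_cases h : ∃ k, Φ.T i j k
  · obtain ⟨k, hk⟩ := h
    exact (Φ.c_pos hk).le
  · push Not at h
    rw [Φ.om_zero _ h]

theorem kappa_pos (i : ι) : 0 < Φ.Vf i Φ.φ Φ.φ := by
  obtain ⟨j, k, h⟩ := Φ.cover i
  obtain ⟨β, b1, b2, b3, b4, b5⟩ := Φ.exists_psi h
  have h1 := Φ.Vf_comb i Φ.φ (fun _ => 0) Φ.φ 0 β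
  simp only [mul_zero, sub_zero, zero_mul] at h1
  rw [← h1, Vf_symm]
  unfold Vf
  simp only [b1, mul_zero, add_zero]
  obtain ⟨k', hne, hk'⟩ := Φ.ridge i j k h
  refine Finset.sum_pos' (fun l _ => mul_nonneg (Φ.c_nonneg _ _) (b4 l)) ⟨k', Finset.mem_univ _, ?_⟩
  refine mul_pos (Φ.c_pos (Φ.T_swap23 hk')) (lt_of_le_of_ne (b4 _) fun h0 => ?_)
  rcases b5 k' h0.symm with h2 | h2 | h2
  · exact Φ.ne13 hk' h2.symm
  · exact Φ.ne23 hk' h2.symm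
  · exact hne h2

end Fan3
end

open Finset
open scoped Classical
noncomputable section
namespace Fan3
variable {ι : Type*} [Fintype ι] (Φ : Fan3 ι)

theorem interp {i j k : ι} (h : Φ.T i j k) (x : ι → ℝ) : ∃ L : (Fin 3 → ℝ) →ₗ[ℝ] ℝ,
    L (Φ.p i) = x i ∧ L (Φ.p j) = x j ∧ L (Φ.p k) = x k :=
  det3_interp _ _ _ (Φ.D_ne _ _ _ h) _ _ _

theorem mul_interp {i j k : ι} {x : ι → ℝ} {L β : (Fin 3 → ℝ) →ₗ[ℝ] ℝ}
    (h1 : L (Φ.p i) = x i) (h2 : L (Φ.p j) = x j) (h3 : L (Φ.p k) = x k)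
    (b5 : ∀ l, Φ.φ l - β (Φ.p l) = 0 → l = i ∨ l = j ∨ l = k)
    {α : ℝ} {l : ι} (h0 : α * (Φ.φ l - β (Φ.p l)) = 0) : α * x l = α * L (Φ.p l) := by
  rcases mul_eq_zero.mp h0 with h | h
  · simp [h]
  · rcases b5 l h with h | h | h <;> subst h
    · rw [h1]
    · rw [h2]
    · rw [h3]

theorem witness_uniq {i k l k' l' : ι} (hT : Φ.T i k l) (hT' : Φ.T i k' l') {α β α' β' γ : ℝ}
    (hα : 0 ≤ α) (hβ : 0 ≤ β) (hα' : 0 ≤ α') (hβ' : 0 ≤ β')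
    (h : α • Φ.p k + β • Φ.p l = α' • Φ.p k' + β' • Φ.p l' + γ • Φ.p i)
    (x : ι → ℝ) (hx : x i = 0) : α * x k + β * x l = α' * x k' + β' * x l' := by
  obtain ⟨B, b1, b2, b3, b4, b5⟩ := Φ.exists_psi hT
  obtain ⟨C, c1, c2, c3, c4, c5⟩ := Φ.exists_psi hT'
  obtain ⟨L, l1, l2, l3⟩ := Φ.interp hT x
  have hB := congrArg B h
  have hC := congrArg C h
  have hL := congrArg L h
  simp only [map_add, map_smul, smul_eq_mul] at hB hC hL
  have key : α * (Φ.φ k - C (Φ.p k)) + β * (Φ.φ l - C (Φ.p l)) =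
      -(α' * (Φ.φ k' - B (Φ.p k')) + β' * (Φ.φ l' - B (Φ.p l'))) := by
    linear_combination hB - hC + α * b2 + β * b3 + γ * (c1 - b1) + α' * c2 + β' * c3
  have n1 := mul_nonneg hα (c4 k)
  have n2 := mul_nonneg hβ (c4 l)
  have n3 := mul_nonneg hα' (b4 k')
  have n4 := mul_nonneg hβ' (b4 l')
  have z3 : α' * (Φ.φ k' - B (Φ.p k')) = 0 := by linarith
  have z4 : β' * (Φ.φ l' - B (Φ.p l')) = 0 := by linarith
  rw [Φ.mul_interp l1 l2 l3 b5 z3, Φ.mul_interp l1 l2 l3 b5 z4, ← l2, ← l3]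
  rw [l1, hx] at hL
  linarith

theorem local_c {i r m : ι} (hT : Φ.T i r m) (x : ι → ℝ) :
    ∃ (c : ℝ) (L : (Fin 3 → ℝ) →ₗ[ℝ] ℝ), (x i - L (Φ.p i) - c * Φ.φ i = 0) ∧
      (x r - L (Φ.p r) - c * Φ.φ r = 0) ∧
      ∀ k l α β, Φ.T i k l → 0 ≤ α → 0 ≤ β →
        det3 (Φ.p i) (Φ.p r) (α • Φ.p k + β • Φ.p l) = 0 →
        α * (x k - L (Φ.p k) - c * Φ.φ k) + β * (x l - L (Φ.p l) - c * Φ.φ l) = 0 := by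
  obtain ⟨B, b1, b2, b3, b4, b5⟩ := Φ.exists_psi hT
  obtain ⟨L0, l1, l2, l3⟩ := Φ.interp hT x
  -- choose c
  obtain ⟨c, hc⟩ : ∃ c : ℝ, ∀ k l α β γ, Φ.T i k l → 0 ≤ α → 0 ≤ β →
      α • Φ.p k + β • Φ.p l = (-1 : ℝ) • Φ.p r + γ • Φ.p i →
      α * (x k - (L0 - c • B) (Φ.p k) - c * Φ.φ k) + β * (x l - (L0 - c • B) (Φ.p l) - c * Φ.φ l) = 0 := by
    by_cases hw : ∃ (k l : ι) (α β γ : ℝ), Φ.T i k l ∧ 0 ≤ α ∧ 0 ≤ β ∧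
      α • Φ.p k + β • Φ.p l = (-1 : ℝ) • Φ.p r + γ • Φ.p i
    · obtain ⟨k, l, α, β, γ, hk, hα, hβ, he⟩ := hw
      obtain ⟨C, c1, c2, c3, c4, c5⟩ := Φ.exists_psi hk
      have hB := congrArg B he
      have hC := congrArg C he
      simp only [map_add, map_smul, smul_eq_mul] at hB hC
      have key : α * (Φ.φ k - B (Φ.p k)) + β * (Φ.φ l - B (Φ.p l)) = Φ.φ r - C (Φ.p r) := by
        linear_combination hC - hB + α * c2 + β * c3 - γ * (c1 - b1) - b2
      have hpos : Φ.φ r - C (Φ.p r) ≠ 0 := by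
        intro h0
        have hdet : ∀ z, det3 (Φ.p i) z (α • Φ.p k + β • Φ.p l) =
            det3 (Φ.p i) z ((-1 : ℝ) • Φ.p r + γ • Φ.p i) := fun z => by rw [he]
        simp only [det3_add_right, det3_smul_right, det3_self13] at hdet
        have hD := Φ.D_ne' hk
        unfold D at hD
        rcases c5 r h0 with h | h | h
        · exact Φ.ne12 hT h.symm
        · subst h
          have := hdet (Φ.p l)
          rw [det3_self23, det3_swap23] at this
          have : (α + 1) * det3 (Φ.p i) (Φ.p r) (Φ.p l) = 0 := by linarith
          rcases mul_eq_zero.mp this with h | h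
          · linarith
          · exact hD h
        · subst h
          have := hdet (Φ.p k)
          rw [det3_self23] at this
          have : (β + 1) * det3 (Φ.p i) (Φ.p k) (Φ.p r) = 0 := by linarith
          rcases mul_eq_zero.mp this with h | h
          · linarith
          · exact hD h
      refine ⟨(α * (x k - L0 (Φ.p k)) + β * (x l - L0 (Φ.p l))) / (Φ.φ r - C (Φ.p r)), ?_⟩
      set c := (α * (x k - L0 (Φ.p k)) + β * (x l - L0 (Φ.p l))) / (Φ.φ r - C (Φ.p r)) with hcdef
      have hc' : c * (Φ.φ r - C (Φ.p r)) = α * (x k - L0 (Φ.p k)) + β * (x l - L0 (Φ.p l)) := by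
        rw [hcdef]; field_simp
      intro k' l' α' β' γ' hk' hα' hβ' he'
      have := Φ.witness_uniq hk hk' hα hβ hα' hβ' (γ := γ - γ')
        (by rw [he, he']; module)
        (fun j => x j - (L0 - c • B) (Φ.p j) - c * Φ.φ j)
        (by simp only [LinearMap.sub_apply, LinearMap.smul_apply, smul_eq_mul]
            linear_combination (-1 : ℝ) * l1 - c * b1)
      rw [← this]
      simp only [LinearMap.sub_apply, LinearMap.smul_apply, smul_eq_mul]
      linear_combination (-1 : ℝ) * hc' - c * key
    · refine ⟨0, fun k l α β γ h1 h2 h3 h4 => absurd ⟨k, l, α, β, γ, h1, h2, h3, h4⟩ hw⟩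
  have z1 : x i - (L0 - c • B) (Φ.p i) - c * Φ.φ i = 0 := by
    simp only [LinearMap.sub_apply, LinearMap.smul_apply, smul_eq_mul]
    linear_combination (-1 : ℝ) * l1 - c * b1
  have z2 : x r - (L0 - c • B) (Φ.p r) - c * Φ.φ r = 0 := by
    simp only [LinearMap.sub_apply, LinearMap.smul_apply, smul_eq_mul]
    linear_combination (-1 : ℝ) * l2 - c * b2
  have z3 : x m - (L0 - c • B) (Φ.p m) - c * Φ.φ m = 0 := by
    simp only [LinearMap.sub_apply, LinearMap.smul_apply, smul_eq_mul]
    linear_combination (-1 : ℝ) * l3 - c * b3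
  refine ⟨c, L0 - c • B, z1, z2, ?_⟩
  intro k l α β hk hα hβ hdet
  obtain ⟨γ, s, hs⟩ := det3_span _ _ (Φ.p m) _ (Φ.D_ne' hT) hdet
  by_cases hs0 : s < 0
  · have := hc k l (α / (-s)) (β / (-s)) (γ / (-s)) hk (div_nonneg hα (by linarith))
      (div_nonneg hβ (by linarith)) (by
        have e : (α / (-s)) • Φ.p k + (β / (-s)) • Φ.p l = (1 / (-s)) • (α • Φ.p k + β • Φ.p l) := by
          module
        have hsn : s ≠ 0 := hs0.ne
        have e' : 1 / (-s) * s = -1 := by field_simp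
        rw [e, hs, smul_add, smul_smul, smul_smul, e']
        rw [add_comm]; congr 2; ring)
    have hne : s ≠ 0 := hs0.ne
    field_simp at this
    linarith
  · push Not at hs0
    obtain ⟨C, c1, c2, c3, c4, c5⟩ := Φ.exists_psi hk
    have hB := congrArg B hs
    have hC := congrArg C hs
    simp only [map_add, map_smul, smul_eq_mul] at hB hC
    have key : α * (Φ.φ k - B (Φ.p k)) + β * (Φ.φ l - B (Φ.p l)) = - (s * (Φ.φ r - C (Φ.p r))) := by
      linear_combination hC - hB + α * c2 + β * c3 - γ * (c1 - b1) + s * b2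
    have n1 := mul_nonneg hα (b4 k)
    have n2 := mul_nonneg hβ (b4 l)
    have n3 := mul_nonneg hs0 (c4 r)
    have y1 : α * (Φ.φ k - B (Φ.p k)) = 0 := by linarith
    have y2 : β * (Φ.φ l - B (Φ.p l)) = 0 := by linarith
    have m1 := Φ.mul_interp l1 l2 l3 b5 y1
    have m2 := Φ.mul_interp l1 l2 l3 b5 y2
    simp only [LinearMap.sub_apply, LinearMap.smul_apply, smul_eq_mul]
    linear_combination m1 + m2 - c * y1 - c * y2

/-- The local inequality, with the equality case. -/
theorem local_main {i r m : ι} (hT : Φ.T i r m) (x : ι → ℝ) :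
    ∃ c : ℝ, Φ.Vf i x x - 2 * c * Φ.Vf i x Φ.φ + c ^ 2 * Φ.Vf i Φ.φ Φ.φ ≤ 0 ∧
      (Φ.Vf i x x - 2 * c * Φ.Vf i x Φ.φ + c ^ 2 * Φ.Vf i Φ.φ Φ.φ = 0 →
        Φ.om x i m = c * Φ.om Φ.φ i m) := by
  obtain ⟨c, L, h1, h2, h3⟩ := Φ.local_c hT x
  refine ⟨c, ?_⟩
  set x' : ι → ℝ := fun l => x l - L (Φ.p l) - c * Φ.φ l with hx'
  have hV : Φ.Vf i x x - 2 * c * Φ.Vf i x Φ.φ + c ^ 2 * Φ.Vf i Φ.φ Φ.φ = Φ.Vf i x' x' := by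
    have q1 : ∀ z, Φ.Vf i x' z = Φ.Vf i x z - c * Φ.Vf i Φ.φ z := fun z => Φ.Vf_comb i x Φ.φ z c L
    rw [q1, Φ.Vf_symm i x x', Φ.Vf_symm i Φ.φ x', q1, q1, Φ.Vf_symm i Φ.φ x]
    ring
  have hom : Φ.om x i m - c * Φ.om Φ.φ i m = Φ.om x' i m := by
    rw [hx', Φ.om_comb]
  have hxi : x' i = 0 := h1
  set y : ι → ℝ := fun j => det3 (Φ.p i) (Φ.p r) (Φ.p j) with hy
  set g : ι → ℝ := fun j => x' j / y j with hg
  have hgy : ∀ j k, Φ.T i j k → x' j = g j * y j := by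
    intro j k hjk
    by_cases h0 : y j = 0
    · have := h3 j k 1 0 hjk zero_le_one le_rfl (by simpa using h0)
      simp only [one_mul, zero_mul, add_zero] at this
      rw [h0, mul_zero]; exact this
    · simp only [hg]; field_simp
  have hcross : ∀ j k, Φ.T i j k → y j * y k < 0 → g j = g k := by
    have aux : ∀ j k, Φ.T i j k → 0 < y j → y k < 0 → g j = g k := by
      intro j k hjk p1 p2
      have := h3 j k (-(y k)) (y j) hjk (by linarith) p1.le (by
        rw [det3_add_right, det3_smul_right, det3_smul_right]
        change -(y k) * y j + y j * y k = 0
        ring)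
      change -(y k) * x' j + y j * x' k = 0 at this
      have q1 := p1.ne'
      have q2 := p2.ne
      simp only [hg]
      rw [div_eq_div_iff q1 q2]
      linarith
    intro j k hjk hn
    rcases lt_trichotomy (y j) 0 with h | h | h
    · exact (aux k j (Φ.T_swap23 hjk) (by nlinarith) h).symm
    · rw [h] at hn; simp at hn
    · exact aux j k hjk h (by nlinarith)
  have ha : ∀ j, ∑ k, Φ.w i j k * y k = Φ.a i j * y j := by
    intro j
    have := Φ.a_lin (det3L (Φ.p i) (Φ.p r)) i j
    simpa [hy, det3_self13] using this
  have hterm : ∀ j k, 0 ≤ Φ.w i j k * (y j * y k * (g j - g k) ^ 2) := by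
    intro j k
    by_cases hw : Φ.T i j k
    · refine mul_nonneg (Φ.w_nonneg _ _ _) ?_
      by_cases hn : y j * y k < 0
      · rw [hcross j k hw hn]; simp
      · push Not at hn; positivity
    · rw [Φ.w_zero hw]; simp
  have hwxx : ∀ j k, Φ.w i j k * (x' k * x' j) = Φ.w i j k * (g k * y k * (g j * y j)) := by
    intro j k
    by_cases hw : Φ.T i j k
    · rw [← hgy j k hw, ← hgy k j (Φ.T_swap23 hw)]
    · rw [Φ.w_zero hw]; simp
  have haxx : ∀ j, Φ.a i j * (x' j * x' j) = ∑ k, Φ.w i j k * (y k * y j * (g j) ^ 2) := by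
    intro j
    have e : ∑ k, Φ.w i j k * (y k * y j * (g j) ^ 2) = (∑ k, Φ.w i j k * y k) * (y j * g j ^ 2) := by
      rw [Finset.sum_mul]; exact Finset.sum_congr rfl fun k _ => by ring
    rw [e, ha]
    by_cases hw : ∃ k, Φ.T i j k
    · obtain ⟨k, hk⟩ := hw
      rw [hgy j k hk]; ring
    · push Not at hw
      rw [Φ.a_zero hw]; ring
  have hsum : Φ.Vf i x' x' = -(1/2) * ∑ j, ∑ k, Φ.w i j k * (y j * y k * (g j - g k) ^ 2) := by
    rw [Vf_eq, hxi]
    simp only [hwxx, haxx, zero_mul, mul_zero, sub_zero, add_zero]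
    rw [← Finset.sum_sub_distrib]
    simp only [← Finset.sum_sub_distrib]
    have s1 : ∑ j, ∑ k, (Φ.w i j k * (g k * y k * (g j * y j)) - Φ.w i j k * (y k * y j * g j ^ 2)) =
        ∑ j, ∑ k, (Φ.w i j k * (g k * y k * (g j * y j)) - Φ.w i j k * (y k * y j * g k ^ 2)) := by
      conv_lhs => rw [Finset.sum_comm]
      refine Finset.sum_congr rfl fun j _ => Finset.sum_congr rfl fun k _ => ?_
      rw [Φ.w_swap23 i k j]; ring
    have s2 : ∀ A B C : ℝ, A = B → A + B = C → A = (1/2) * C := by intros; linarith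
    rw [show -(1/2 : ℝ) * ∑ j, ∑ k, Φ.w i j k * (y j * y k * (g j - g k) ^ 2) =
      (1/2) * (-∑ j, ∑ k, Φ.w i j k * (y j * y k * (g j - g k) ^ 2)) by ring]
    refine s2 _ _ _ s1 ?_
    rw [← Finset.sum_add_distrib]
    simp only [← Finset.sum_add_distrib, ← Finset.sum_neg_distrib]
    refine Finset.sum_congr rfl fun j _ => Finset.sum_congr rfl fun k _ => ?_
    ring
  rw [hV]
  refine ⟨?_, ?_⟩
  · rw [hsum]
    have := Finset.sum_nonneg fun j (_ : j ∈ Finset.univ) => Finset.sum_nonneg fun k (_ : k ∈ Finset.univ) => hterm j k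
    linarith
  · intro h0
    rw [hsum] at h0
    have h0' : ∑ j, ∑ k, Φ.w i j k * (y j * y k * (g j - g k) ^ 2) = 0 := by linarith
    rw [Finset.sum_eq_zero_iff_of_nonneg (fun j _ => Finset.sum_nonneg fun k _ => hterm j k)] at h0'
    have h1' := h0' m (Finset.mem_univ _)
    rw [Finset.sum_eq_zero_iff_of_nonneg (fun k _ => hterm m k)] at h1'
    have hgoal : Φ.om x' i m = 0 := by
      unfold om
      rw [hxi, mul_zero, sub_zero, hgy m r (Φ.T_swap23 hT)]
      have : Φ.a i m * (g m * y m) = ∑ k, Φ.w i m k * (y k * g m) := by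
        rw [show Φ.a i m * (g m * y m) = (Φ.a i m * y m) * g m by ring, ← ha, Finset.sum_mul]
        exact Finset.sum_congr rfl fun k _ => by ring
      rw [this, ← Finset.sum_sub_distrib]
      refine Finset.sum_eq_zero fun k _ => ?_
      by_cases hw : Φ.T i m k
      · rw [hgy k m (Φ.T_swap23 hw)]
        have q := h1' k (Finset.mem_univ _)
        have hym : y m ≠ 0 := Φ.D_ne' hT
        have hwp := (Φ.w_pos hw).ne'
        by_cases hyk : y k = 0
        · rw [hyk]; ring
        · have : (g m - g k) ^ 2 = 0 := by
            rcases mul_eq_zero.mp q with h | h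
            · exact absurd h hwp
            · rcases mul_eq_zero.mp h with h | h
              · exact absurd h (mul_ne_zero hym hyk)
              · exact h
          have : g m = g k := by
            have := pow_eq_zero_iff (two_ne_zero) |>.mp this
            linarith
          rw [this]; ring
      · rw [Φ.w_zero hw]; ring
    linarith

theorem local_ineq (i : ι) (x : ι → ℝ) :
    Φ.Vf i x x * Φ.Vf i Φ.φ Φ.φ ≤ Φ.Vf i x Φ.φ ^ 2 := by
  obtain ⟨j, k, h⟩ := Φ.cover i
  obtain ⟨c, h1, -⟩ := Φ.local_main h x
  have hk := Φ.kappa_pos i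
  nlinarith [sq_nonneg (Φ.Vf i x Φ.φ - c * Φ.Vf i Φ.φ Φ.φ)]

theorem local_eq {i m : ι} (x : ι → ℝ) (h1 : Φ.Vf i x Φ.φ = 0) (h2 : Φ.Vf i x x = 0) :
    Φ.om x i m = 0 := by
  by_cases h : ∃ k, Φ.T i m k
  · obtain ⟨k, hk⟩ := h
    obtain ⟨c, e1, e2⟩ := Φ.local_main (Φ.T_swap23 hk) x
    have hkp := Φ.kappa_pos i
    rw [h1, h2] at e1 e2
    have hc : c = 0 := by
      by_contra hc
      have : 0 < c ^ 2 := by positivity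
      nlinarith
    subst hc
    rw [e2 (by ring)]; ring
  · push Not at h
    exact Φ.om_zero _ h

/-- The motion identity. -/
theorem motion_id (h : ι → ℝ) (μ : ι → (Fin 3 → ℝ) →ₗ[ℝ] ℝ)
    (hμ : ∀ i, μ i (Φ.p i) + h i * Φ.φ i = 0) (r : ι → ι → ℝ)
    (hr : ∀ i j, r i j = μ i (Φ.p j) + h i * Φ.φ j + (μ j (Φ.p i) + h j * Φ.φ i)) (i : ι) :
    Φ.Vf i h Φ.φ = (1/2) * ∑ j, ∑ k, Φ.w i j k * r j k - ∑ j, Φ.a j i * r i j := by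
  have e0 : (1/2) * ∑ j, ∑ k, Φ.w i j k * r j k = ∑ j, ∑ k, Φ.w i j k * (μ j (Φ.p k) + h j * Φ.φ k) := by
    have : ∑ j, ∑ k, Φ.w i j k * r j k = ∑ j, ∑ k, Φ.w i j k * (μ j (Φ.p k) + h j * Φ.φ k) +
        ∑ j, ∑ k, Φ.w i j k * (μ k (Φ.p j) + h k * Φ.φ j) := by
      rw [← Finset.sum_add_distrib]; simp only [← Finset.sum_add_distrib, hr, mul_add]
    rw [this]
    have : ∑ j, ∑ k, Φ.w i j k * (μ k (Φ.p j) + h k * Φ.φ j) =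
        ∑ j, ∑ k, Φ.w i j k * (μ j (Φ.p k) + h j * Φ.φ k) := by
      rw [Finset.sum_comm]
      refine Finset.sum_congr rfl fun j _ => Finset.sum_congr rfl fun k _ => ?_
      rw [Φ.w_swap23]
    rw [this]; ring
  have e1 : ∀ j, ∑ k, Φ.w i j k * (μ j (Φ.p k) + h j * Φ.φ k) =
      -(Φ.a i j * (h j * Φ.φ j)) + Φ.a j i * μ j (Φ.p i) + ∑ k, Φ.w i j k * (Φ.φ k * h j) := by
    intro j
    simp only [mul_add, Finset.sum_add_distrib, Φ.a_lin]
    have : ∑ k, Φ.w i j k * (h j * Φ.φ k) = ∑ k, Φ.w i j k * (Φ.φ k * h j) :=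
      Finset.sum_congr rfl fun k _ => by ring
    rw [this]
    linear_combination Φ.a i j * hμ j
  have e2 : ∑ j, Φ.a j i * r i j = -(Φ.e i * (h i * Φ.φ i)) + h i * ∑ j, Φ.a j i * Φ.φ j +
      ∑ j, Φ.a j i * μ j (Φ.p i) + Φ.φ i * ∑ j, Φ.a j i * h j := by
    have : ∑ j, Φ.a j i * r i j = ∑ j, Φ.a j i * μ i (Φ.p j) + h i * ∑ j, Φ.a j i * Φ.φ j +
      ∑ j, Φ.a j i * μ j (Φ.p i) + Φ.φ i * ∑ j, Φ.a j i * h j := by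
      simp only [Finset.mul_sum, ← Finset.sum_add_distrib, hr]
      exact Finset.sum_congr rfl fun k _ => by ring
    rw [this, Φ.e_lin]
    linear_combination Φ.e i * hμ i
  rw [e0, e2, Φ.Vf_symm, Vf_eq]
  simp only [e1, Finset.sum_add_distrib, Finset.sum_neg_distrib]
  have : ∑ j, Φ.a i j * (Φ.φ j * h j) = ∑ j, Φ.a i j * (h j * Φ.φ j) :=
    Finset.sum_congr rfl fun k _ => by ring
  rw [this]; ring

/-- Connectivity by pivoting. -/
theorem connected (f : ι → ℝ) (hf : ∀ i j k, Φ.T i j k → f i = f j) (i j : ι) : f i = f j := by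
  obtain ⟨i1, i2, hi⟩ := Φ.cover i
  obtain ⟨j1, j2, hj⟩ := Φ.cover j
  set z := Φ.p j + Φ.p j1 + Φ.p j2 with hz
  -- facets carrying the value `f i`, with their supporting functional
  let S : Finset (ι × ι × ι) := Finset.univ.filter fun t => Φ.T t.1 t.2.1 t.2.2 ∧ f t.1 = f i
  have hS : S.Nonempty := ⟨(i, i1, i2), by simp [S, hi]⟩
  have hβ : ∀ t : ι × ι × ι, ∃ β : (Fin 3 → ℝ) →ₗ[ℝ] ℝ, Φ.T t.1 t.2.1 t.2.2 →
     (Φ.φ t.1 - β (Φ.p t.1) = 0 ∧ Φ.φ t.2.1 - β (Φ.p t.2.1) = 0 ∧ Φ.φ t.2.2 - β (Φ.p t.2.2) = 0 ∧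
    (∀ l, 0 ≤ Φ.φ l - β (Φ.p l)) ∧ ∀ l, Φ.φ l - β (Φ.p l) = 0 → l = t.1 ∨ l = t.2.1 ∨ l = t.2.2) := by
    intro t
    by_cases h : Φ.T t.1 t.2.1 t.2.2
    · obtain ⟨β, hb⟩ := Φ.exists_psi h
      exact ⟨β, fun _ => hb⟩
    · exact ⟨0, fun h' => absurd h' h⟩
  choose β hβ using hβ
  obtain ⟨t, htS, hmax⟩ := Finset.exists_max_image S (fun t => β t z) hS
  obtain ⟨hT, hft⟩ : Φ.T t.1 t.2.1 t.2.2 ∧ f t.1 = f i := by simpa [S] using htS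
  obtain ⟨b1, b2, b3, b4, b5⟩ := hβ t hT
  have hD := Φ.D_ne' hT
  set D0 := Φ.D t.1 t.2.1 t.2.2 with hD0
  obtain ⟨α1, α2, α3, hzα⟩ : ∃ α1 α2 α3 : ℝ, z = α1 • Φ.p t.1 + α2 • Φ.p t.2.1 + α3 • Φ.p t.2.2 := by
    have := det3_cramer (Φ.p t.1) (Φ.p t.2.1) (Φ.p t.2.2) z
    refine ⟨det3 z (Φ.p t.2.1) (Φ.p t.2.2) / D0, det3 (Φ.p t.1) z (Φ.p t.2.2) / D0,
      det3 (Φ.p t.1) (Φ.p t.2.1) z / D0, ?_⟩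
    rw [div_eq_inv_mul, div_eq_inv_mul, div_eq_inv_mul, mul_smul, mul_smul, mul_smul, ← smul_add, ← smul_add, ← this, smul_smul]
    change z = (D0⁻¹ * D0) • z
    rw [inv_mul_cancel₀ hD, one_smul]
  -- crossing a ridge
  have cross : ∀ (a b c : ι) (α1 α2 α3 : ℝ), Φ.T a b c → f a = f i → f b = f i →
      β t (Φ.p a) = Φ.φ a → β t (Φ.p b) = Φ.φ b → β t (Φ.p c) = Φ.φ c →
      z = α1 • Φ.p a + α2 • Φ.p b + α3 • Φ.p c → 0 ≤ α3 := by
    intro a b c α1 α2 α3 habc ha hb q1 q2 q3 hzz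
    by_contra hneg
    push Not at hneg
    obtain ⟨c', hne, hc'⟩ := Φ.ridge a b c habc
    obtain ⟨d1, d2, d3, d4, d5⟩ := hβ (a, b, c') hc'
    simp only at d1 d2 d3 d5
    have hm := hmax (a, b, c') (by simp [S, hc', ha])
    rw [hzz] at hm
    simp only [map_add, map_smul, smul_eq_mul, q1, q2, q3] at hm
    have hlt : 0 < Φ.φ c - β (a, b, c') (Φ.p c) := lt_of_le_of_ne (d4 _) fun h0 => by
      rcases d5 c h0.symm with h | h | h
      · exact Φ.ne13 habc h.symm
      · exact Φ.ne23 habc h.symm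
      · exact hne h.symm
    have k1 : β (a, b, c') (Φ.p a) = Φ.φ a := by linarith
    have k2 : β (a, b, c') (Φ.p b) = Φ.φ b := by linarith
    rw [k1, k2] at hm
    nlinarith
  have f2 : f t.2.1 = f i := by rw [← hft]; exact (hf _ _ _ hT).symm
  have f3 : f t.2.2 = f i := by rw [← hft]; exact (hf _ _ _ (Φ.T_swap23 hT)).symm
  have p3 := cross _ _ _ α1 α2 α3 hT hft f2 (by linarith) (by linarith) (by linarith) hzα
  have p1 := cross _ _ _ α2 α3 α1 (Φ.T_rot _ _ _ hT) f2 f3 (by linarith) (by linarith) (by linarith)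
    (by rw [hzα]; abel)
  have p2 := cross _ _ _ α3 α1 α2 (Φ.T_rot _ _ _ (Φ.T_rot _ _ _ hT)) f3 hft (by linarith) (by linarith) (by linarith)
    (by rw [hzα]; abel)
  obtain ⟨γ, g1, g2, g3, g4, g5⟩ := Φ.exists_psi hj
  have hz1 := congrArg γ hzα
  have hz2 := congrArg (β t) hzα
  rw [hz] at hz1 hz2
  simp only [map_add, map_smul, smul_eq_mul] at hz1 hz2
  have n1 := mul_nonneg p1 (g4 t.1)
  have n2 := mul_nonneg p2 (g4 t.2.1)
  have n3 := mul_nonneg p3 (g4 t.2.2)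
  have hh : Φ.φ j - β t (Φ.p j) = 0 := by
    have := b4 j
    have := b4 j1
    have := b4 j2
    have k : (Φ.φ j - β t (Φ.p j)) + (Φ.φ j1 - β t (Φ.p j1)) + (Φ.φ j2 - β t (Φ.p j2)) ≤ 0 := by
      have e : (Φ.φ j - β t (Φ.p j)) + (Φ.φ j1 - β t (Φ.p j1)) + (Φ.φ j2 - β t (Φ.p j2))
        = -(α1 * (Φ.φ t.1 - γ (Φ.p t.1))) - (α2 * (Φ.φ t.2.1 - γ (Φ.p t.2.1)))
          - (α3 * (Φ.φ t.2.2 - γ (Φ.p t.2.2))) := by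
        linear_combination hz1 - hz2 + g1 + g2 + g3 + α1 * b1 + α2 * b2 + α3 * b3
      rw [e]; linarith
    linarith
  rcases b5 j hh with h | h | h
  · rw [h, hft]
  · rw [h, f2]
  · rw [h, f3]

end Fan3
end

open Finset
open scoped Classical
noncomputable section
namespace Fan3
variable {ι : Type*} [Fintype ι] (Φ : Fan3 ι)

/-- The symmetric form. -/
def Q (x y : ι → ℝ) : ℝ := ∑ i, x i * Φ.Vf i y Φ.φ

theorem Q_symm (x y : ι → ℝ) : Φ.Q x y = Φ.Q y x := Φ.tri_symm y Φ.φ x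

theorem Q_add (x y z : ι → ℝ) : Φ.Q (fun l => x l + y l) z = Φ.Q x z + Φ.Q y z := by
  unfold Q; simp only [add_mul, Finset.sum_add_distrib]
theorem Q_smul (t : ℝ) (x z : ι → ℝ) : Φ.Q (fun l => t * x l) z = t * Φ.Q x z := by
  unfold Q; simp only [Finset.mul_sum, mul_assoc]

theorem Q_comb (s t : ℝ) (x y : ι → ℝ) : Φ.Q (fun l => s * x l + t * y l) (fun l => s * x l + t * y l) =
    s ^ 2 * Φ.Q x x + 2 * s * t * Φ.Q x y + t ^ 2 * Φ.Q y y := by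
  rw [Q_add, Q_smul, Q_smul, Φ.Q_symm x, Φ.Q_symm y, Q_add, Q_smul, Q_smul, Q_add, Q_smul, Q_smul, Φ.Q_symm y x]
  ring

theorem bochner_eq (x : ι → ℝ) : ∑ i, Φ.φ i * Φ.Vf i x x = Φ.Q x x := by
  unfold Q
  rw [Φ.tri_symm x x Φ.φ]
  exact Finset.sum_congr rfl fun i _ => by rw [Φ.Vf_symm]

theorem bochner (x : ι → ℝ) : Φ.Q x x ≤ ∑ i, Φ.φ i / Φ.Vf i Φ.φ Φ.φ * Φ.Vf i x Φ.φ ^ 2 := by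
  rw [← bochner_eq]
  refine Finset.sum_le_sum fun i _ => ?_
  have h1 := Φ.local_ineq i x
  have h2 := Φ.kappa_pos i
  have h3 := Φ.φ_pos i
  rw [div_mul_eq_mul_div, le_div_iff₀ h2, mul_assoc]
  exact mul_le_mul_of_nonneg_left h1 h3.le

/-- the weighted scalar product -/
def N (x y : ι → ℝ) : ℝ := ∑ i, Φ.Vf i Φ.φ Φ.φ / Φ.φ i * (x i * y i)

/-- the operator `1 - C` -/
def Rop : (ι → ℝ) →ₗ[ℝ] (ι → ℝ) where
  toFun x := fun i => x i - Φ.φ i / Φ.Vf i Φ.φ Φ.φ * Φ.Vf i x Φ.φ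
  map_add' x y := by
    ext i
    have := Φ.Vf_add i x y Φ.φ
    change Φ.Vf i (x + y) Φ.φ = _ at this
    simp only [Pi.add_apply, this]; ring
  map_smul' t x := by
    ext i
    have := Φ.Vf_smul i t x Φ.φ
    change Φ.Vf i (t • x) Φ.φ = _ at this
    simp only [Pi.smul_apply, smul_eq_mul, RingHom.id_apply, this]; ring

theorem Rop_apply (x : ι → ℝ) (i : ι) : Φ.Rop x i = x i - Φ.φ i / Φ.Vf i Φ.φ Φ.φ * Φ.Vf i x Φ.φ := rfl

theorem N_Rop (x y : ι → ℝ) : Φ.N (Φ.Rop x) y = Φ.N x y - Φ.Q y x := by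
  unfold N Q
  rw [← Finset.sum_sub_distrib]
  refine Finset.sum_congr rfl fun i _ => ?_
  have h2 := (Φ.kappa_pos i).ne'
  have h3 := (Φ.φ_pos i).ne'
  rw [Rop_apply]; field_simp

theorem N_symm (x y : ι → ℝ) : Φ.N x y = Φ.N y x := by
  unfold N; exact Finset.sum_congr rfl fun i _ => by ring

theorem N_phi (x : ι → ℝ) : Φ.N Φ.φ x = Φ.Q x Φ.φ := by
  unfold N Q
  refine Finset.sum_congr rfl fun i _ => ?_
  have h3 := (Φ.φ_pos i).ne'
  field_simp

theorem N_pos (x : ι → ℝ) (i : ι) (h : x i ≠ 0) : 0 < Φ.N x x := by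
  unfold N
  have key : ∀ i, 0 < Φ.Vf i Φ.φ Φ.φ / Φ.φ i := fun i => div_pos (Φ.kappa_pos i) (Φ.φ_pos i)
  refine Finset.sum_pos' (fun i _ => mul_nonneg (key i).le (mul_self_nonneg _)) ⟨i, Finset.mem_univ _, mul_pos (key i) (mul_self_pos.mpr h)⟩

theorem N_nonneg (x : ι → ℝ) : 0 ≤ Φ.N x x := by
  unfold N
  have key : ∀ i, 0 < Φ.Vf i Φ.φ Φ.φ / Φ.φ i := fun i => div_pos (Φ.kappa_pos i) (Φ.φ_pos i)
  exact Finset.sum_nonneg (fun i _ => mul_nonneg (key i).le (mul_self_nonneg _))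

theorem Q_expand (x y : ι → ℝ) : Φ.Q x y = ∑ i, ∑ j, Φ.om Φ.φ i j * (x i * y j) + ∑ i, Φ.omd Φ.φ i * (x i * y i) := by
  unfold Q
  rw [← Finset.sum_add_distrib]
  refine Finset.sum_congr rfl fun i _ => ?_
  rw [Φ.Vf_symm]
  unfold Vf
  rw [mul_add, Finset.mul_sum]
  congr 1
  · exact Finset.sum_congr rfl fun i _ => by ring
  · ring

theorem picone (x : ι → ℝ) : Φ.N x x - Φ.Q x x =
    (1/2) * ∑ i, ∑ j, Φ.om Φ.φ i j * (Φ.φ i * Φ.φ j * (x i / Φ.φ i - x j / Φ.φ j) ^ 2) := by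
  have e1 : Φ.N x x = ∑ i, ∑ j, Φ.om Φ.φ i j * (Φ.φ j * x i ^ 2 / Φ.φ i) + ∑ i, Φ.omd Φ.φ i * (x i * x i) := by
    unfold N
    rw [← Finset.sum_add_distrib]
    refine Finset.sum_congr rfl fun i _ => ?_
    have h3 := (Φ.φ_pos i).ne'
    conv_lhs => unfold Vf
    rw [add_div, add_mul, Finset.sum_div, Finset.sum_mul]
    congr 1
    · exact Finset.sum_congr rfl fun i _ => by ring
    · field_simp
  have e2 : ∑ i, ∑ j, Φ.om Φ.φ i j * (Φ.φ j * x i ^ 2 / Φ.φ i) = ∑ i, ∑ j, Φ.om Φ.φ i j * (Φ.φ i * x j ^ 2 / Φ.φ j) := by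
    rw [Finset.sum_comm]
    refine Finset.sum_congr rfl fun i _ => Finset.sum_congr rfl fun j _ => ?_
    rw [Φ.om_symm]
  have e3 : ∑ i, ∑ j, Φ.om Φ.φ i j * (Φ.φ i * Φ.φ j * (x i / Φ.φ i - x j / Φ.φ j) ^ 2) =
     ∑ i, ∑ j, Φ.om Φ.φ i j * (Φ.φ j * x i ^ 2 / Φ.φ i) + ∑ i, ∑ j, Φ.om Φ.φ i j * (Φ.φ i * x j ^ 2 / Φ.φ j)
     - 2 * ∑ i, ∑ j, Φ.om Φ.φ i j * (x i * x j) := by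
    rw [Finset.mul_sum, ← Finset.sum_add_distrib, ← Finset.sum_sub_distrib]
    refine Finset.sum_congr rfl fun i _ => ?_
    rw [Finset.mul_sum, ← Finset.sum_add_distrib, ← Finset.sum_sub_distrib]
    refine Finset.sum_congr rfl fun j _ => ?_
    have h3 := (Φ.φ_pos i).ne'
    have h4 := (Φ.φ_pos j).ne'
    field_simp
    ring
  rw [e3, e1, Q_expand, ← e2]; ring

theorem picone_term (x : ι → ℝ) (i j : ι) :
    0 ≤ Φ.om Φ.φ i j * (Φ.φ i * Φ.φ j * (x i / Φ.φ i - x j / Φ.φ j) ^ 2) :=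
  mul_nonneg (Φ.c_nonneg _ _) (mul_nonneg (mul_nonneg (Φ.φ_pos i).le (Φ.φ_pos j).le) (sq_nonneg _))

theorem R_nonneg (x : ι → ℝ) : 0 ≤ Φ.N (Φ.Rop x) x := by
  rw [N_Rop, picone]
  have := Finset.sum_nonneg fun i (_ : i ∈ Finset.univ) => Finset.sum_nonneg fun j (_ : j ∈ Finset.univ) => Φ.picone_term x i j
  linarith

theorem R_ker (x : ι → ℝ) (h : Φ.N (Φ.Rop x) x = 0) : ∀ i j, x i / Φ.φ i = x j / Φ.φ j := by
  rw [N_Rop, picone] at h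
  have h0 : ∑ i, ∑ j, Φ.om Φ.φ i j * (Φ.φ i * Φ.φ j * (x i / Φ.φ i - x j / Φ.φ j) ^ 2) = 0 := by linarith
  rw [Finset.sum_eq_zero_iff_of_nonneg (fun j _ => Finset.sum_nonneg fun k _ => Φ.picone_term x j k)] at h0
  refine Φ.connected (fun i => x i / Φ.φ i) ?_
  intro i j k hT
  have h1 := h0 i (Finset.mem_univ _)
  rw [Finset.sum_eq_zero_iff_of_nonneg (fun k _ => Φ.picone_term x i k)] at h1
  have h2 := h1 j (Finset.mem_univ _)
  have hc := (Φ.c_pos hT).ne'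
  have h3 := (Φ.φ_pos i).ne'
  have h4 := (Φ.φ_pos j).ne'
  simp only [mul_eq_zero, hc, h3, h4, false_or] at h2
  have := pow_eq_zero_iff (two_ne_zero) |>.mp h2
  linarith

theorem N_add_left (x y z : ι → ℝ) : Φ.N (x + y) z = Φ.N x z + Φ.N y z := by
  unfold N; rw [← Finset.sum_add_distrib]
  exact Finset.sum_congr rfl fun i _ => by simp only [Pi.add_apply]; ring
theorem N_smul_left (t : ℝ) (x z : ι → ℝ) : Φ.N (t • x) z = t * Φ.N x z := by
  unfold N; rw [Finset.mul_sum]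
  exact Finset.sum_congr rfl fun i _ => by simp only [Pi.smul_apply, smul_eq_mul]; ring

theorem R_phi : Φ.Rop Φ.φ = 0 := by
  ext i
  rw [Rop_apply]
  have h2 := (Φ.kappa_pos i).ne'
  field_simp; simp

theorem R_symm (x y : ι → ℝ) : Φ.N (Φ.Rop x) y = Φ.N (Φ.Rop y) x := by
  rw [N_Rop, N_Rop, N_symm, Q_symm]

theorem R_range (x : ι → ℝ) (h : Φ.Q x Φ.φ = 0) : ∃ v, Φ.Rop v = x := by
  by_cases hne : Nonempty ι
  swap
  · exact ⟨0, by ext i; exact absurd ⟨i⟩ hne⟩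
  obtain ⟨i0⟩ := hne
  have hpp : 0 < Φ.N Φ.φ Φ.φ := Φ.N_pos _ i0 (Φ.φ_pos i0).ne'
  let Nl : (ι → ℝ) →ₗ[ℝ] ℝ := { toFun := fun v => Φ.N v Φ.φ, map_add' := fun a b => Φ.N_add_left a b _,
                                 map_smul' := fun t a => Φ.N_smul_left t a _ }
  let R' : (ι → ℝ) →ₗ[ℝ] (ι → ℝ) := Φ.Rop + Nl.smulRight Φ.φ
  have hR' : ∀ v, R' v = Φ.Rop v + Φ.N v Φ.φ • Φ.φ := fun v => rfl
  have hz : ∀ v, Φ.N (Φ.Rop v) Φ.φ = 0 := by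
    intro v
    rw [R_symm, R_phi]; simp [N]
  have hpair : ∀ v, Φ.N (R' v) Φ.φ = Φ.N v Φ.φ * Φ.N Φ.φ Φ.φ := by
    intro v; rw [hR', N_add_left, N_smul_left, hz]; ring
  have hinj : Function.Injective R' := by
    rw [injective_iff_map_eq_zero]
    intro v hv
    have h1 := hpair v
    rw [hv] at h1
    have h2 : Φ.N v Φ.φ = 0 := by
      have : Φ.N (0 : ι → ℝ) Φ.φ = 0 := by simp [N]
      rw [this] at h1
      rcases mul_eq_zero.mp h1.symm with h | h
      · exact h
      · exact absurd h hpp.ne'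
    rw [hR', h2, zero_smul, add_zero] at hv
    have h3 := Φ.R_ker v (by rw [hv]; simp [N])
    have h4 : v = (v i0 / Φ.φ i0) • Φ.φ := by
      ext i
      have := h3 i i0
      have h5 := (Φ.φ_pos i).ne'
      simp only [Pi.smul_apply, smul_eq_mul]
      rw [← this]; field_simp
    rw [h4, N_smul_left] at h2
    rcases mul_eq_zero.mp h2 with h | h
    · rw [h4, h, zero_smul]
    · exact absurd h hpp.ne'
  obtain ⟨v, hv⟩ := LinearMap.injective_iff_surjective.mp hinj x
  refine ⟨v, ?_⟩
  have h1 := hpair v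
  rw [hv, N_symm, N_phi, h] at h1
  have h2 : Φ.N v Φ.φ = 0 := by
    rcases mul_eq_zero.mp h1.symm with h | h
    · exact h
    · exact absurd h hpp.ne'
  rw [hR', h2, zero_smul, add_zero] at hv
  exact hv

theorem lorentz_le (x : ι → ℝ) (h : Φ.Q x Φ.φ = 0) : Φ.Q x x ≤ 0 := by
  obtain ⟨v, hv⟩ := Φ.R_range x h
  -- step 1: N(Rv,v) ≤ N(Rv,Rv)
  have h1 : Φ.N (Φ.Rop v) v ≤ Φ.N (Φ.Rop v) (Φ.Rop v) := by
    have hb := Φ.bochner v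
    have e : Φ.N (Φ.Rop v) (Φ.Rop v) - Φ.N (Φ.Rop v) v =
        ∑ i, Φ.φ i / Φ.Vf i Φ.φ Φ.φ * Φ.Vf i v Φ.φ ^ 2 - Φ.Q v v := by
      unfold N Q
      rw [← Finset.sum_sub_distrib, ← Finset.sum_sub_distrib]
      refine Finset.sum_congr rfl fun i _ => ?_
      have h2 := (Φ.kappa_pos i).ne'
      have h3 := (Φ.φ_pos i).ne'
      rw [Rop_apply]; field_simp; ring
    linarith
  -- step 2: Cauchy–Schwarz
  have cs : Φ.N (Φ.Rop v) x ^ 2 ≤ Φ.N (Φ.Rop v) v * Φ.N (Φ.Rop x) x := by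
    have hq : ∀ t : ℝ, 0 ≤ Φ.N (Φ.Rop x) x * (t * t) + 2 * Φ.N (Φ.Rop v) x * t + Φ.N (Φ.Rop v) v := by
      intro t
      have := Φ.R_nonneg (t • x + v)
      rw [map_add, map_smul, N_add_left, N_smul_left, Φ.N_symm (Φ.Rop x), Φ.N_symm (Φ.Rop v), N_add_left, N_add_left,
        N_smul_left, N_smul_left, Φ.N_symm x (Φ.Rop x), Φ.N_symm v (Φ.Rop x), Φ.N_symm x (Φ.Rop v), Φ.N_symm v (Φ.Rop v),
        Φ.R_symm x v] at this
      linarith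
    have := discrim_le_zero hq
    unfold discrim at this
    nlinarith
  rw [hv] at h1 cs
  have h3 : Φ.N (Φ.Rop x) x = Φ.N x x - Φ.Q x x := Φ.N_Rop x x
  by_contra hpos
  push Not at hpos
  have hN := Φ.N_nonneg x
  have hR := Φ.R_nonneg x
  have h4 : Φ.N x x ^ 2 ≤ Φ.N x x * Φ.N (Φ.Rop x) x := cs.trans (mul_le_mul_of_nonneg_right h1 hR)
  rcases hN.lt_or_eq with h5 | h5
  · have h6 : Φ.N x x ≤ Φ.N (Φ.Rop x) x := by
      by_contra hc
      push Not at hc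
      nlinarith
    linarith
  · linarith

theorem lorentz_eq (x : ι → ℝ) (h : Φ.Q x Φ.φ = 0) (h0 : 0 ≤ Φ.Q x x) :
    Φ.Q x x = 0 ∧ ∀ i, Φ.Vf i x Φ.φ = 0 := by
  have hx0 : Φ.Q x x = 0 := le_antisymm (Φ.lorentz_le x h) h0
  refine ⟨hx0, fun i => ?_⟩
  have hpp : 0 < Φ.Q Φ.φ Φ.φ := by
    rw [← N_phi]; exact Φ.N_pos _ i (Φ.φ_pos i).ne'
  have h2 : ∀ y, Φ.Q y Φ.φ = 0 → Φ.Q x y = 0 := by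
    intro y hy
    have key : ∀ t : ℝ, Φ.Q (fun l => 1 * y l + t * x l) (fun l => 1 * y l + t * x l) ≤ 0 := by
      intro t
      refine Φ.lorentz_le _ ?_
      rw [Q_add, Q_smul, Q_smul, h, hy]; ring
    simp only [Q_comb, hx0] at key
    by_contra hne
    have := key ((-Φ.Q y y + 1) / (2 * Φ.Q y x))
    rw [Φ.Q_symm x y] at hne
    have e : ((-Φ.Q y y + 1) / (2 * Φ.Q y x)) * Φ.Q y x = (-Φ.Q y y + 1) / 2 := by field_simp
    rw [mul_assoc, e] at this
    linarith
  have h3 : ∀ y, Φ.Q y x = 0 := by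
    intro y
    have e : y = fun l => (fun l => 1 * y l + (-(Φ.Q y Φ.φ / Φ.Q Φ.φ Φ.φ)) * Φ.φ l) l + (Φ.Q y Φ.φ / Φ.Q Φ.φ Φ.φ) * Φ.φ l := by
      ext l; ring
    rw [e, Q_add, Q_smul, Φ.Q_symm Φ.φ x, h, Φ.Q_symm _ x, h2, mul_zero, add_zero]
    rw [Q_add, Q_smul, Q_smul]; field_simp; ring
  have := h3 (fun j => if j = i then 1 else 0)
  simpa [Q] using this

/-- Lemma A: motions of the fan have no stress. -/
theorem lemmaA (h : ι → ℝ) (μ : ι → (Fin 3 → ℝ) →ₗ[ℝ] ℝ)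
    (hμ : ∀ i, μ i (Φ.p i) + h i * Φ.φ i = 0)
    (hr : ∀ i j k, Φ.T i j k → μ i (Φ.p j) + h i * Φ.φ j + (μ j (Φ.p i) + h j * Φ.φ i) = 0)
    {i j k k' : ι} (hT : Φ.T i j k) (hT' : Φ.T i j k') (hne : k' ≠ k)
    (hi : h i = 0) (hj : h j = 0) (hk : h k = 0) : h k' = 0 := by
  have hM : ∀ i, Φ.Vf i h Φ.φ = 0 := by
    intro i
    rw [Φ.motion_id h μ hμ (fun i j => μ i (Φ.p j) + h i * Φ.φ j + (μ j (Φ.p i) + h j * Φ.φ i)) (fun _ _ => rfl)]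
    rw [Finset.sum_eq_zero, Finset.sum_eq_zero]
    · ring
    · intro j _
      by_cases hT : ∃ k, Φ.T i j k
      · obtain ⟨k, hk⟩ := hT
        simp only [hr _ _ _ hk, mul_zero]
      · push Not at hT
        rw [Φ.a_zero (i := j) (j := i) (fun k hk => hT k (Φ.T_swap _ _ _ hk)), zero_mul]
    · intro j _
      refine Finset.sum_eq_zero fun k _ => ?_
      by_cases hT : Φ.T i j k
      · simp only [hr _ _ _ (Φ.T_rot _ _ _ hT), mul_zero]
      · rw [Φ.w_zero hT, zero_mul]
  have hle : ∀ i, Φ.Vf i h h ≤ 0 := by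
    intro i
    have := Φ.local_ineq i h
    rw [hM i] at this
    have hk := Φ.kappa_pos i
    by_contra hc
    push Not at hc
    nlinarith [mul_pos hc hk]
  have hsum : ∑ i, -(Φ.φ i * Φ.Vf i h h) = 0 := by
    rw [Finset.sum_neg_distrib, bochner_eq, Q]; simp [hM]
  rw [Finset.sum_eq_zero_iff_of_nonneg (fun i _ => by
    have := Φ.φ_pos i
    have := hle i
    nlinarith)] at hsum
  have hV : Φ.Vf i h h = 0 := by
    have := hsum i (Finset.mem_univ _)
    have h2 := (Φ.φ_pos i).ne'
    simpa [h2] using this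
  have hom := Φ.local_eq (i := i) (m := j) h (hM i) hV
  unfold om at hom
  rw [hi, hj, mul_zero, mul_zero, sub_zero, sub_zero] at hom
  rw [Finset.sum_eq_single k'] at hom
  · rcases mul_eq_zero.mp hom with h | h
    · exact absurd h (Φ.w_pos hT').ne'
    · exact h
  · intro l _ hl
    by_cases hTl : Φ.T i j l
    · rcases Φ.at_most_two hT hT' hne hTl with h | h
      · rw [h, hk, mul_zero]
      · exact absurd h hl
    · rw [Φ.w_zero hTl, zero_mul]
  · intro h; exact absurd (Finset.mem_univ _) h

theorem bal_min {i j k : ι} (hk : Φ.T i j k) : ∑ k, Φ.w i j k * min (Φ.D i j k) 0 = -1 := by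
  obtain ⟨k', hne, hk'⟩ := Φ.ridge i j k hk
  rw [← Finset.sum_subset (Finset.subset_univ {k, k'})]
  · rw [Finset.sum_pair hne.symm]
    have := Φ.opp hk hk' hne
    unfold w
    rw [if_pos hk, if_pos hk']
    rcases lt_or_gt_of_ne (Φ.D_ne' hk) with h1 | h1
    · have h2 : 0 < Φ.D i j k' := by nlinarith
      have := h1.ne
      rw [abs_of_neg h1, abs_of_pos h2, min_eq_left h1.le, min_eq_right h2.le]; field_simp; norm_num
    · have h2 : Φ.D i j k' < 0 := by nlinarith
      have := h2.ne
      rw [abs_of_pos h1, abs_of_neg h2, min_eq_left h2.le, min_eq_right h1.le]; field_simp; norm_num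
  · intro l _ hl
    rw [Φ.w_zero, zero_mul]
    intro hT
    apply hl
    rcases Φ.at_most_two hk hk' hne hT with h | h <;> simp [h]

theorem om_congr {x y : ι → ℝ} {i j : ι} (h1 : x i = y i) (h2 : x j = y j)
    (h3 : ∀ k, Φ.T i j k → x k = y k) : Φ.om x i j = Φ.om y i j := by
  unfold om
  rw [h1, h2]
  congr 2
  refine Finset.sum_congr rfl fun k _ => ?_
  by_cases hT : Φ.T i j k
  · rw [h3 k hT]
  · rw [Φ.w_zero hT]; ring

/-- Lemma B: no nontrivial splitting of a vertex along a plane. -/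
theorem lemmaB (h : ι → ℝ) (μ : ι → (Fin 3 → ℝ) →ₗ[ℝ] ℝ)
    (hμ : ∀ i, μ i (Φ.p i) + h i * Φ.φ i = 0) (r : ι → ι → ℝ)
    (hr : ∀ i j, r i j = μ i (Φ.p j) + h i * Φ.φ j + (μ j (Φ.p i) + h j * Φ.φ i))
    (a b u : ι) (t : ℝ) (hua : ∃ k, Φ.T u a k) (hub : ∃ k, Φ.T u b k) (hab : ∀ k, ¬ Φ.T a b k)
    (hp : Φ.p a + Φ.p b + Φ.p u = 0) (hrab : r a b = 0)
    (hr0 : ∀ i j k, Φ.T i j k → i ≠ u → j ≠ u → r i j = 0)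
    (hru : ∀ j k, Φ.T u j k → r u j = -t * min (Φ.D a u j) 0)
    (hcr : ∀ j k, Φ.T u j k → 0 < Φ.D a u j → Φ.D a u k < 0 → False)
    (hz : ∀ j k, Φ.T u j k → Φ.D a u j = 0 → j = a ∨ j = b) : t = 0 := by
  obtain ⟨ka, hka⟩ := hua
  obtain ⟨kb, hkb⟩ := hub
  have hba : a ≠ b := by
    rintro rfl
    have e : Φ.p u = (-2 : ℝ) • Φ.p a := by
      have : Φ.p u = -(Φ.p a + Φ.p a) := by rw [eq_neg_iff_add_eq_zero, add_comm]; exact hp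
      rw [this]; module
    apply Φ.D_ne' hka
    unfold D; rw [e]; simp [det3]; ring
  have hau : a ≠ u := (Φ.ne12 hka).symm
  have hbu : b ≠ u := (Φ.ne12 hkb).symm
  have hrs : ∀ i j, r i j = r j i := by intro i j; rw [hr, hr]; ring
  set y : ι → ℝ := fun j => Φ.D a u j with hy
  have ylin : ∀ j, y j = det3L (Φ.p a) (Φ.p u) (Φ.p j) := fun j => rfl
  have ya : y a = 0 := det3_self13 _ _
  have yu : y u = 0 := det3_self23 _ _
  have yb : y b = 0 := by
    have := congrArg (det3L (Φ.p a) (Φ.p u)) hp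
    rw [map_add, map_add, map_zero] at this
    rw [← ylin, ← ylin, ← ylin, ya, yu] at this
    linarith
  have yb' : ∀ k, y k = - Φ.D b u k := by
    intro k
    have e : Φ.p a = -(Φ.p b + Φ.p u) := by
      rw [eq_neg_iff_add_eq_zero, ← add_assoc]; exact hp
    simp only [hy, D]; rw [e]; simp [det3]; ring
  have id := Φ.motion_id h μ hμ r hr
  -- the half sum
  have half : ∀ i, i ≠ u → (1/2) * ∑ j, ∑ k, Φ.w i j k * r j k = ∑ k, Φ.w i u k * r u k := by
    intro i hi
    have e : ∀ j k, Φ.w i j k * r j k = (if j = u then Φ.w i u k * r u k else 0) +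
        (if k = u then Φ.w i u j * r u j else 0) := by
      intro j k
      by_cases hT : Φ.T i j k
      · by_cases hj : j = u
        · subst hj
          have : k ≠ j := (Φ.ne23 hT).symm
          simp [this]
        · by_cases hk : k = u
          · subst hk
            simp [hj]; rw [Φ.w_swap23, hrs]
          · simp [hj, hk]; right
            exact hr0 j k i (Φ.T_rot _ _ _ hT) hj hk
      · rw [Φ.w_zero hT, zero_mul]
        by_cases hj : j = u
        · subst hj
          by_cases hk : k = j
          · subst hk; simp [Φ.w_zero hT]
          · simp [hk, Φ.w_zero hT]
        · by_cases hk : k = u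
          · subst hk
            rw [Φ.w_swap23 i k j, Φ.w_zero hT]; simp [hj]
          · simp [hj, hk]
    rw [Finset.sum_congr rfl fun j _ => Finset.sum_congr rfl fun k _ => e j k]
    simp only [Finset.sum_add_distrib]
    simp
    rw [← two_mul]
    rw [← mul_assoc]; norm_num
  have other : ∀ i, i ≠ u → ∑ j, Φ.a j i * r i j = Φ.a u i * r i u := by
    intro i hi
    refine Finset.sum_eq_single u (fun j _ hj => ?_) (fun h => absurd (Finset.mem_univ _) h)
    by_cases hT : ∃ k, Φ.T i j k
    · obtain ⟨k, hk⟩ := hT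
      rw [hr0 i j k hk hi hj, mul_zero]
    · push Not at hT
      rw [Φ.a_zero (i := j) (j := i) (fun k hk => hT k (Φ.T_swap _ _ _ hk)), zero_mul]
  have wr : ∀ i k, Φ.w i u k * r u k = -t * (Φ.w i u k * min (y k) 0) := by
    intro i k
    by_cases hT : Φ.T i u k
    · rw [hru k i (Φ.T_rot _ _ _ hT)]; ring
    · rw [Φ.w_zero hT]; ring
  have rua : r u a = 0 := by rw [hru a ka hka]; change -t * min (y a) 0 = 0; rw [ya]; simp
  have rub : r u b = 0 := by rw [hru b kb hkb]; change -t * min (y b) 0 = 0; rw [yb]; simp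
  have Va : Φ.Vf a h Φ.φ = t := by
    rw [id, half a hau, other a hau, hrs a u, rua]
    simp only [wr, ← Finset.mul_sum]
    have := Φ.bal_min (Φ.T_swap _ _ _ hka)
    change ∑ k, Φ.w a u k * min (y k) 0 = -1 at this
    rw [this]; ring
  have Vb : Φ.Vf b h Φ.φ = t := by
    rw [id, half b hbu, other b hbu, hrs b u, rub]
    simp only [wr, ← Finset.mul_sum]
    have h1 := Φ.bal_min (Φ.T_swap _ _ _ hkb)
    have h2 := Φ.balance b u
    have : ∑ k, Φ.w b u k * min (y k) 0 = -1 := by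
      have e : ∀ k, Φ.w b u k * min (y k) 0 = Φ.w b u k * min (Φ.D b u k) 0 - Φ.w b u k * Φ.D b u k := by
        intro k
        rw [yb', ← mul_sub]
        congr 1
        rcases le_total (Φ.D b u k) 0 with h | h
        · rw [min_eq_left h, min_eq_right (by linarith)]; ring
        · rw [min_eq_right h, min_eq_left (by linarith)]; ring
      simp only [e, Finset.sum_sub_distrib, h1, h2]; ring
    rw [this]; ring
  have Vo : ∀ i, i ≠ a → i ≠ b → i ≠ u → Φ.Vf i h Φ.φ = 0 := by
    intro i hia hib hiu
    rw [id, half i hiu, other i hiu]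
    by_cases hT : ∃ k, Φ.T u i k
    · obtain ⟨k0, hk0⟩ := hT
      have hyi : y i ≠ 0 := fun h0 => by
        rcases hz i k0 hk0 h0 with h | h
        · exact hia h
        · exact hib h
      rw [hrs i u, hru i k0 hk0]
      change _ - Φ.a u i * (-t * min (y i) 0) = 0
      simp only [wr, ← Finset.mul_sum]
      rcases lt_or_gt_of_ne hyi with hneg | hpos
      · have e : ∀ k, Φ.w i u k * min (y k) 0 = Φ.w u i k * det3L (Φ.p a) (Φ.p u) (Φ.p k) := by
          intro k
          rw [Φ.w_swap12 i u, ← ylin]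
          by_cases hTk : Φ.T u i k
          · have : y k ≤ 0 := by
              by_contra hc
              push Not at hc
              exact hcr k i (Φ.T_swap23 hTk) hc hneg
            rw [min_eq_left this]
          · rw [Φ.w_zero hTk]; ring
        simp only [e, Φ.a_lin]
        rw [← ylin, ← ylin, yu, min_eq_left hneg.le]; ring
      · have e : ∀ k, Φ.w i u k * min (y k) 0 = 0 := by
          intro k
          rw [Φ.w_swap12 i u]
          by_cases hTk : Φ.T u i k
          · have : 0 ≤ y k := by
              by_contra hc
              push Not at hc
              exact hcr i k hTk hpos hc
            rw [min_eq_right this, mul_zero]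
          · rw [Φ.w_zero hTk]; ring
        simp only [e]
        rw [min_eq_right hpos.le]; simp
    · push Not at hT
      rw [Φ.a_zero hT, zero_mul, sub_zero]
      refine Finset.sum_eq_zero fun k _ => ?_
      rw [Φ.w_swap12, Φ.w_zero (hT k), zero_mul]
  -- sums against `M h`
  have sumM : ∀ f : ι → ℝ, ∑ i, f i * Φ.Vf i h Φ.φ = f a * t + f b * t + f u * Φ.Vf u h Φ.φ := by
    intro f
    rw [← Finset.sum_subset (Finset.subset_univ {a, b, u})]
    · rw [Finset.sum_insert (by simp [hba, hau]), Finset.sum_pair hbu, Va, Vb]; ring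
    · intro i _ hi
      simp only [Finset.mem_insert, Finset.mem_singleton, not_or] at hi
      rw [Vo i hi.1 hi.2.1 hi.2.2, mul_zero]
  have Vu : Φ.Vf u h Φ.φ = t := by
    have hne := Φ.p_ne u
    obtain ⟨s, hs⟩ := Function.ne_iff.mp hne
    have h1 := sumM (fun i => LinearMap.proj (R := ℝ) (φ := fun _ : Fin 3 => ℝ) s (Φ.p i))
    have h2 := Φ.tri_symm h Φ.φ (fun i => LinearMap.proj (R := ℝ) (φ := fun _ : Fin 3 => ℝ) s (Φ.p i))
    rw [h2] at h1
    simp only [Φ.Vf_lin, mul_zero, Finset.sum_const_zero] at h1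
    simp only [LinearMap.proj_apply] at h1
    have h3 := congrFun hp s
    simp only [Pi.add_apply, Pi.zero_apply] at h3 hs
    have : Φ.p u s * (Φ.Vf u h Φ.φ - t) = 0 := by linear_combination (-1 : ℝ) * h1 - t * h3
    rcases mul_eq_zero.mp this with h | h
    · exact absurd h hs
    · linarith
  rw [Vu] at sumM
  by_contra ht
  -- h_a + h_b + h_u = 0
  have hsum0 : h a + h b + h u = 0 := by
    have m := hp
    have e1 := congrArg (μ a) hp
    have e2 := congrArg (μ b) hp
    have e3 := congrArg (μ u) hp
    simp only [map_add, map_zero] at e1 e2 e3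
    rw [hr] at hrab rua rub
    have : (h a + h b + h u) * (Φ.φ a + Φ.φ b + Φ.φ u) = 0 := by
      linear_combination hrab + rua + rub + hμ a + hμ b + hμ u - e1 - e2 - e3
    have q1 := Φ.φ_pos a
    have q2 := Φ.φ_pos b
    have q3 := Φ.φ_pos u
    rcases mul_eq_zero.mp this with h | h
    · exact h
    · linarith
  have Qh : ∀ f : ι → ℝ, Φ.Q f h = t * (f a + f b + f u) := by
    intro f; unfold Q; rw [sumM]; ring
  have Qhh : Φ.Q h h = 0 := by rw [Qh, hsum0, mul_zero]
  set g : ι → ℝ := fun j => |y j| with hg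
  have Qgh : Φ.Q g h = 0 := by rw [Qh]; simp [hg, ya, yb, yu]
  have Qyy : Φ.Q y y = 0 := by
    unfold Q
    refine Finset.sum_eq_zero fun i _ => ?_
    have := Φ.Vf_lin (det3L (Φ.p a) (Φ.p u)) i Φ.φ
    change Φ.Vf i y Φ.φ = 0 at this
    rw [this, mul_zero]
  have Qgg : Φ.Q g g = ∑ i, ∑ j, Φ.om Φ.φ i j * (|y i * y j| - y i * y j) := by
    have : Φ.Q g g = Φ.Q g g - Φ.Q y y := by rw [Qyy, sub_zero]
    rw [this, Q_expand, Q_expand]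
    have e : ∀ i, Φ.omd Φ.φ i * (g i * g i) = Φ.omd Φ.φ i * (y i * y i) := by
      intro i; simp only [hg, abs_mul_abs_self]
    simp only [e, add_sub_add_right_eq_sub, ← Finset.sum_sub_distrib]
    refine Finset.sum_congr rfl fun i _ => Finset.sum_congr rfl fun j _ => ?_
    simp only [hg]
    rw [abs_mul]; ring
  have gterm : ∀ i j, 0 ≤ Φ.om Φ.φ i j * (|y i * y j| - y i * y j) := fun i j =>
    mul_nonneg (Φ.c_nonneg _ _) (by linarith [le_abs_self (y i * y j)])
  have Qgg0 : 0 ≤ Φ.Q g g := by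
    rw [Qgg]; exact Finset.sum_nonneg fun i _ => Finset.sum_nonneg fun j _ => gterm i j
  set Pp := Φ.Q Φ.φ h with hPp
  set G := Φ.Q Φ.φ g with hG
  have Pne : Pp ≠ 0 := by
    rw [hPp, Qh]
    have q1 := Φ.φ_pos a
    have q2 := Φ.φ_pos b
    have q3 := Φ.φ_pos u
    refine mul_ne_zero ht (by positivity)
  have hx := Φ.lorentz_eq (fun l => Pp * g l + (-G) * h l)
    (by rw [Q_add, Q_smul, Q_smul, Φ.Q_symm g, Φ.Q_symm h]; ring)
    (by rw [Q_comb, Qgh, Qhh]; nlinarith [mul_nonneg (sq_nonneg Pp) Qgg0])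
  obtain ⟨hx1, hx2⟩ := hx
  rw [Q_comb, Qgh, Qhh] at hx1
  have Qgg1 : Φ.Q g g = 0 := by
    have : Pp ^ 2 * Φ.Q g g = 0 := by linarith
    rcases mul_eq_zero.mp this with h | h
    · exact absurd h (pow_ne_zero _ Pne)
    · exact h
  have nocross : ∀ i j k, Φ.T i j k → 0 ≤ y i * y j := by
    intro i j k hT
    rw [Qgg, Finset.sum_eq_zero_iff_of_nonneg (fun j _ => Finset.sum_nonneg fun k _ => gterm j k)] at Qgg1
    have h1 := Qgg1 i (Finset.mem_univ _)
    rw [Finset.sum_eq_zero_iff_of_nonneg (fun k _ => gterm i k)] at h1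
    have h2 := h1 j (Finset.mem_univ _)
    rcases mul_eq_zero.mp h2 with h | h
    · exact absurd h (Φ.c_pos hT).ne'
    · linarith [abs_nonneg (y i * y j)]
  have Mg0 : ∀ i, i ≠ a → i ≠ b → i ≠ u → Φ.Vf i g Φ.φ = 0 := by
    intro i h1 h2 h3
    have := hx2 i
    rw [Vf_add, Vf_smul, Vf_smul, Vo i h1 h2 h3, mul_zero, add_zero] at this
    rcases mul_eq_zero.mp this with h | h
    · exact absurd h Pne
    · exact h
  have yzero : ∀ i, y i = 0 → i = a ∨ i = b ∨ i = u := by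
    intro i hi
    by_contra hh
    push Not at hh
    have h1 := Mg0 i hh.1 hh.2.1 hh.2.2
    rw [Vf_symm] at h1
    unfold Vf at h1
    have gi : g i = 0 := by simp [hg, hi]
    rw [gi, mul_zero, add_zero] at h1
    have nn : ∀ j, 0 ≤ Φ.om Φ.φ i j * g j := fun j => mul_nonneg (Φ.c_nonneg _ _) (abs_nonneg _)
    rw [Finset.sum_eq_zero_iff_of_nonneg (fun k _ => nn k)] at h1
    obtain ⟨j, k, hT⟩ := Φ.cover i
    have z : ∀ j k, Φ.T i j k → y j = 0 := by
      intro j k hT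
      have := h1 j (Finset.mem_univ _)
      rcases mul_eq_zero.mp this with h | h
      · exact absurd h (Φ.c_pos hT).ne'
      · exact abs_eq_zero.mp h
    have zj := z j k hT
    have zk := z k j (Φ.T_swap23 hT)
    have cr := congrArg (det3L (Φ.p a) (Φ.p u)) (det3_cramer (Φ.p i) (Φ.p j) (Φ.p k) (Φ.p ka))
    simp only [map_add, map_smul, ← ylin, hi, zj, zk, smul_eq_mul, mul_zero, add_zero] at cr
    rcases mul_eq_zero.mp cr with h | h
    · exact Φ.D_ne' hT h
    · exact Φ.D_ne' (Φ.T_swap _ _ _ hka) h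
  have omg : ∀ j, j ≠ u → Φ.om g a j = 0 := by
    intro j hju
    by_cases hT : ∃ k, Φ.T a j k
    swap
    · push Not at hT; exact Φ.om_zero _ hT
    obtain ⟨k, hk⟩ := hT
    have hyj : y j ≠ 0 := by
      intro h0
      rcases yzero j h0 with h | h | h
      · exact Φ.ne12 hk h.symm
      · subst h; exact hab k hk
      · exact hju h
    have ly := Φ.om_lin (det3L (Φ.p a) (Φ.p u)) a j
    change Φ.om y a j = 0 at ly
    rcases lt_or_gt_of_ne hyj with hneg | hpos
    · have : Φ.om g a j = Φ.om (fun l => (-1) * y l) a j := by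
        refine Φ.om_congr (by simp [hg, ya]) (by simp [hg, abs_of_neg hneg]) ?_
        intro k hk
        have := nocross j k a (Φ.T_rot _ _ _ hk)
        have : y k ≤ 0 := by
          by_contra hc; push Not at hc; nlinarith
        simp [hg, abs_of_nonpos this]
      rw [this, Φ.om_smul, ly, mul_zero]
    · have : Φ.om g a j = Φ.om y a j := by
        refine Φ.om_congr (by simp [hg, ya]) (by simp [hg, abs_of_pos hpos]) ?_
        intro k hk
        have := nocross j k a (Φ.T_rot _ _ _ hk)
        have : 0 ≤ y k := by
          by_contra hc; push Not at hc; nlinarith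
        simp [hg, abs_of_nonneg this]
      rw [this, ly]
  have fin1 := Φ.Vf_lin' (det3L (Φ.p a) (Φ.p ka)) a g
  unfold Vf at fin1
  simp only [det3L_apply, det3_self13, mul_zero, add_zero] at fin1
  rw [Finset.sum_eq_single u (fun j _ hj => by rw [omg j hj, zero_mul]) (fun h => absurd (Finset.mem_univ _) h)] at fin1
  have om0 : Φ.om g a u = 0 := by
    rcases mul_eq_zero.mp fin1 with h | h
    · exact h
    · exact absurd h (Φ.D_ne' (Φ.T_swap23 (Φ.T_swap _ _ _ hka)))
  have : 0 < Φ.om g a u := by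
    unfold om
    have ga : g a = 0 := by simp [hg, ya]
    have gu : g u = 0 := by simp [hg, yu]
    rw [ga, gu, mul_zero, mul_zero, sub_zero, sub_zero]
    refine Finset.sum_pos' (fun k _ => mul_nonneg (Φ.w_nonneg _ _ _) (abs_nonneg _))
      ⟨ka, Finset.mem_univ _, mul_pos (Φ.w_pos (Φ.T_swap _ _ _ hka)) (abs_pos.mpr (Φ.D_ne' (Φ.T_swap _ _ _ hka)))⟩
  linarith

end Fan3
end

open Finset
open scoped Classical
noncomputable section

/-! ### Simplicial cones: the linearised form of a simplicial polytope -/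

/-- The cone over a simplicial polytope, recorded by its generators. -/
structure Cfg (X : Type*) (E : Type*) [AddCommGroup E] [Module ℝ E] where
  V : Finset X
  q : X → E
  n : ℕ
  finrank_eq : Module.finrank ℝ E = n + 1
  fin : FiniteDimensional ℝ E
  span : ∀ f : E →ₗ[ℝ] ℝ, (∀ v ∈ V, f (q v) = 0) → f = 0
  simp' : ∀ f : E →ₗ[ℝ] ℝ, (∀ v ∈ V, 0 ≤ f (q v)) → f ≠ 0 →
    LinearIndepOn ℝ q {v | v ∈ V ∧ f (q v) = 0}
  vert : ∀ v ∈ V, ∃ f : E →ₗ[ℝ] ℝ, (∀ w ∈ V, 0 ≤ f (q w)) ∧ f ≠ 0 ∧ f (q v) = 0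

namespace Cfg
set_option linter.unusedSectionVars false
variable {X : Type*} {E : Type*} [AddCommGroup E] [Module ℝ E] [DecidableEq X] (C : Cfg X E)

/-- `f` is a supporting functional of the facet `F`. -/
def Nu (F : Finset X) (f : E →ₗ[ℝ] ℝ) : Prop :=
  (∀ v ∈ F, f (C.q v) = 0) ∧ ∀ v ∈ C.V, v ∉ F → 0 < f (C.q v)

/-- facets -/
def IsF (F : Finset X) : Prop := F ⊆ C.V ∧ F.card = C.n ∧ ∃ f, C.Nu F f

/-- faces -/
def Face (s : Finset X) : Prop := s ⊆ C.V ∧ ∃ f : E →ₗ[ℝ] ℝ, (∀ v ∈ C.V, 0 ≤ f (C.q v)) ∧ f ≠ 0 ∧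
  ∀ v ∈ s, f (C.q v) = 0

variable {C}

theorem Nu.nonneg {F : Finset X} {f : E →ₗ[ℝ] ℝ} (h : C.Nu F f) : ∀ v ∈ C.V, 0 ≤ f (C.q v) := by
  intro v hv
  by_cases hF : v ∈ F
  · rw [h.1 v hF]
  · exact (h.2 v hv hF).le


theorem Nu.ne_zero {F : Finset X} {f : E →ₗ[ℝ] ℝ} (hF : C.IsF F) (h : C.Nu F f) : f ≠ 0 := by
  rintro rfl
  have hV : C.V ⊆ F := by
    intro v hv
    by_contra hn
    have := h.2 v hv hn
    simp at this
  have := C.fin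
  have hsp : Submodule.span ℝ ((C.V.image C.q : Finset E) : Set E) = ⊤ := by
    by_contra hne
    obtain ⟨g, hg, hg'⟩ := Submodule.exists_le_ker_of_lt_top _ (lt_top_iff_ne_top.2 hne)
    apply hg
    apply C.span
    intro v hv
    have : C.q v ∈ Submodule.span ℝ ((C.V.image C.q : Finset E) : Set E) :=
      Submodule.subset_span (by simpa using ⟨v, hv, rfl⟩)
    exact hg' this
  have h1 := finrank_span_finset_le_card (R := ℝ) (C.V.image C.q)
  rw [Set.finrank, hsp, finrank_top, C.finrank_eq] at h1
  have h2 := Finset.card_image_le (s := C.V) (f := C.q)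
  have h3 := Finset.card_le_card hV
  have h4 := hF.2.1
  omega

theorem indep_of_zero {f : E →ₗ[ℝ] ℝ} (h0 : ∀ v ∈ C.V, 0 ≤ f (C.q v)) (hf : f ≠ 0)
    {s : Finset X} (hs : s ⊆ C.V) (hz : ∀ v ∈ s, f (C.q v) = 0) :
    LinearIndepOn ℝ C.q (s : Set X) :=
  (C.simp' f h0 hf).mono (fun v hv => ⟨hs hv, hz v hv⟩)

theorem finrank_ker_eq {f : E →ₗ[ℝ] ℝ} (hf : f ≠ 0) :
    Module.finrank ℝ (LinearMap.ker f) = C.n := by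
  have := C.fin
  have := Module.Dual.finrank_ker_add_one_of_ne_zero (f := f) hf
  rw [C.finrank_eq] at this
  omega

theorem finrank_span_of_indep {s : Finset X} (h : LinearIndepOn ℝ C.q (s : Set X)) :
    Module.finrank ℝ (Submodule.span ℝ (C.q '' (s : Set X))) = s.card := by
  have := finrank_span_eq_card (R := ℝ) (b := fun x : s => C.q x) h
  rw [Fintype.card_coe] at this
  rw [← this, Set.image_eq_range]
  rfl

theorem span_le_ker {f : E →ₗ[ℝ] ℝ} {s : Finset X} (hz : ∀ v ∈ s, f (C.q v) = 0) :
    Submodule.span ℝ (C.q '' (s : Set X)) ≤ LinearMap.ker f := by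
  rw [Submodule.span_le]
  rintro _ ⟨v, hv, rfl⟩
  exact hz v hv

theorem card_le_of_zero {f : E →ₗ[ℝ] ℝ} (h0 : ∀ v ∈ C.V, 0 ≤ f (C.q v)) (hf : f ≠ 0)
    {s : Finset X} (hs : s ⊆ C.V) (hz : ∀ v ∈ s, f (C.q v) = 0) : s.card ≤ C.n := by
  have := C.fin
  rw [← finrank_span_of_indep (indep_of_zero h0 hf hs hz), ← C.finrank_ker_eq hf]
  exact Submodule.finrank_mono (span_le_ker hz)

/-- recognising facets -/
theorem isF_of {f : E →ₗ[ℝ] ℝ} (h0 : ∀ v ∈ C.V, 0 ≤ f (C.q v)) (hf : f ≠ 0)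
    {s : Finset X} (hs : s ⊆ C.V) (hz : ∀ v ∈ s, f (C.q v) = 0) (hc : s.card = C.n) :
    C.IsF s ∧ C.Nu s f := by
  have : C.Nu s f := by
    refine ⟨hz, fun v hv hvs => lt_of_le_of_ne (h0 v hv) ?_⟩
    intro h
    have := card_le_of_zero h0 hf (s := insert v s) (by
      intro w hw; rcases Finset.mem_insert.1 hw with rfl | hw
      · exact hv
      · exact hs hw) (by
      intro w hw; rcases Finset.mem_insert.1 hw with rfl | hw
      · exact h.symm
      · exact hz w hw)
    rw [Finset.card_insert_of_notMem hvs] at this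
    omega
  exact ⟨⟨hs, hc, f, this⟩, this⟩

theorem IsF.indep {F : Finset X} (hF : C.IsF F) : LinearIndepOn ℝ C.q (F : Set X) := by
  obtain ⟨f, hf⟩ := hF.2.2
  exact indep_of_zero hf.nonneg (hf.ne_zero hF) hF.1 hf.1

theorem mem_span_of_indep {s : Finset X} (h : LinearIndepOn ℝ C.q (s : Set X)) (hc : s.card = C.n)
    {f : E →ₗ[ℝ] ℝ} (hf : f ≠ 0) (hz : ∀ v ∈ s, f (C.q v) = 0) {x : E} (hx : f x = 0) :
    ∃ α : X → ℝ, x = ∑ v ∈ s, α v • C.q v := by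
  have := C.fin
  have heq : Submodule.span ℝ (C.q '' (s : Set X)) = LinearMap.ker f :=
    Submodule.eq_of_le_of_finrank_eq (span_le_ker hz)
      (by rw [finrank_span_of_indep h, C.finrank_ker_eq hf, hc])
  have hx' : x ∈ Submodule.span ℝ (C.q '' (s : Set X)) := by rw [heq]; exact hx
  rw [Submodule.mem_span_image_finset_iff_exists_fun] at hx'
  obtain ⟨c, hc⟩ := hx'
  refine ⟨fun v => if h : v ∈ s then c ⟨v, h⟩ else 0, ?_⟩
  rw [← hc, ← Finset.sum_coe_sort s]
  refine Finset.sum_congr rfl (fun v _ => ?_)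
  simp

theorem IsF.span {F : Finset X} (hF : C.IsF F) {f : E →ₗ[ℝ] ℝ} (hf : C.Nu F f) {o : E}
    (ho : f o ≠ 0) (x : E) :
    ∃ (α : X → ℝ), x = ∑ v ∈ F, α v • C.q v + (f x / f o) • o := by
  obtain ⟨α, hα⟩ := mem_span_of_indep hF.indep hF.2.1 (hf.ne_zero hF) hf.1
    (x := x - (f x / f o) • o) (by simp [ho])
  exact ⟨α, by rw [← hα]; abel⟩

theorem IsF.zero {F : Finset X} (hF : C.IsF F) {f : E →ₗ[ℝ] ℝ} (hf : C.Nu F f) {o : E}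
    (ho : f o ≠ 0) {e : E →ₗ[ℝ] ℝ} (he : ∀ v ∈ F, e (C.q v) = 0) (heo : e o = 0) : e = 0 := by
  ext x
  obtain ⟨α, hα⟩ := hF.span hf ho x
  rw [hα, map_add, map_sum, Finset.sum_eq_zero]
  · simp [heo]
  · intro v hv; simp [he v hv]

theorem exists_interp {s : Finset X} (h : LinearIndepOn ℝ C.q (s : Set X)) (c : X → ℝ) :
    ∃ e : E →ₗ[ℝ] ℝ, ∀ v ∈ s, e (C.q v) = c v := by
  have h' : LinearIndependent ℝ (fun x : s => C.q x) := h
  let b := Module.Basis.span h'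
  obtain ⟨e, he⟩ := LinearMap.exists_extend (b.constr ℝ (fun v : s => c v))
  refine ⟨e, fun v hv => ?_⟩
  have h1 : ((b ⟨v, hv⟩ : Submodule.span ℝ (Set.range (fun x : s => C.q x))) : E) = C.q v :=
    congrArg Subtype.val (Module.Basis.span_apply h' ⟨v, hv⟩)
  have h2 := LinearMap.congr_fun he (b ⟨v, hv⟩)
  rw [Module.Basis.constr_basis] at h2
  rw [← h1]
  exact h2

theorem IsF.interp {F : Finset X} (hF : C.IsF F) {f : E →ₗ[ℝ] ℝ} (hf : C.Nu F f) {o : E}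
    (ho : f o ≠ 0) (c : X → ℝ) (t : ℝ) :
    ∃ e : E →ₗ[ℝ] ℝ, (∀ v ∈ F, e (C.q v) = c v) ∧ e o = t := by
  obtain ⟨e, he⟩ := exists_interp hF.indep c
  refine ⟨e + ((t - e o) / f o) • f, fun v hv => ?_, ?_⟩
  · simp [he v hv, hf.1 v hv]
  · simp [ho]

/-- The sum of all generators. -/
def oV (C : Cfg X E) : E := ∑ v ∈ C.V, C.q v

theorem oV_pos {F : Finset X} (hF : C.IsF F) {f : E →ₗ[ℝ] ℝ} (hf : C.Nu F f) : 0 < f C.oV := by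
  unfold oV
  rw [map_sum]
  apply Finset.sum_pos' hf.nonneg
  by_contra hn
  push Not at hn
  apply hf.ne_zero hF
  apply C.span
  intro v hv
  exact le_antisymm (hn v hv) (hf.nonneg v hv)

/-- Rotating a supporting functional. -/
theorem rotate {f e : E →ₗ[ℝ] ℝ} (h0 : ∀ v ∈ C.V, 0 ≤ f (C.q v))
    (he : ∀ v ∈ C.V, f (C.q v) = 0 → 0 ≤ e (C.q v)) (hneg : ∃ v ∈ C.V, e (C.q v) < 0) :
    ∃ s : ℝ, 0 < s ∧ (∀ v ∈ C.V, 0 ≤ (f + s • e) (C.q v)) ∧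
      ∃ v ∈ C.V, e (C.q v) < 0 ∧ (f + s • e) (C.q v) = 0 := by
  have hne : (C.V.filter (fun v => e (C.q v) < 0)).Nonempty := by
    obtain ⟨v, hv, h⟩ := hneg
    exact ⟨v, by simp [hv, h]⟩
  obtain ⟨v, hv, hmin⟩ := Finset.exists_min_image _ (fun v => f (C.q v) / (- e (C.q v))) hne
  simp only [Finset.mem_filter] at hv hmin
  have hv2 : 0 < - e (C.q v) := by linarith [hv.2]
  have hfv : 0 < f (C.q v) := by
    refine lt_of_le_of_ne (h0 v hv.1) (fun h => ?_)
    have := he v hv.1 h.symm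
    linarith
  refine ⟨f (C.q v) / (- e (C.q v)), by positivity, ?_, v, hv.1, hv.2, ?_⟩
  · intro w hw
    simp only [LinearMap.add_apply, LinearMap.smul_apply, smul_eq_mul]
    by_cases hw2 : e (C.q w) < 0
    · have h1 := hmin w ⟨hw, hw2⟩
      rw [le_div_iff₀ (by linarith)] at h1
      linarith
    · have h1 := h0 w hw
      have h2 : 0 ≤ f (C.q v) / (- e (C.q v)) := by positivity
      have h3 : 0 ≤ e (C.q w) := by linarith
      have := mul_nonneg h2 h3
      linarith
  · simp only [LinearMap.add_apply, LinearMap.smul_apply, smul_eq_mul]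
    have : e (C.q v) ≠ 0 := hv.2.ne
    field_simp
    ring

/-- ridge exchange -/
theorem IsF.exchange {F : Finset X} (hF : C.IsF F) {i : X} (hi : i ∈ F) :
    ∃ j, j ∉ F ∧ C.IsF (insert j (F.erase i)) := by
  obtain ⟨f, hf⟩ := hF.2.2
  have hfo := oV_pos hF hf
  obtain ⟨e, he, heo⟩ := hF.interp hf hfo.ne' (fun v => if v = i then 1 else 0) 0
  have hi1 : e (C.q i) = 1 := by rw [he i hi]; simp
  have hneg : ∃ v ∈ C.V, e (C.q v) < 0 := by
    by_contra hn
    push Not at hn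
    unfold oV at heo
    rw [map_sum, Finset.sum_eq_zero_iff_of_nonneg hn] at heo
    have := heo i (hF.1 hi)
    linarith
  have hz : ∀ v ∈ C.V, f (C.q v) = 0 → v ∈ F := by
    intro v hv h
    by_contra hn
    have := hf.2 v hv hn
    linarith
  obtain ⟨s, hs, h1, j, hj, hj1, hj2⟩ := rotate hf.nonneg (e := e) (by
    intro v hv h
    rw [he v (hz v hv h)]; split_ifs <;> norm_num) hneg
  have hjF : j ∉ F := by
    intro h
    rw [he j h] at hj1
    split_ifs at hj1 <;> linarith
  refine ⟨j, hjF, (isF_of h1 ?_ ?_ ?_ ?_).1⟩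
  · intro h
    have := LinearMap.congr_fun h (C.q i)
    simp [hf.1 i hi, hi1] at this
    linarith
  · intro w hw
    rcases Finset.mem_insert.1 hw with rfl | hw
    · exact hj
    · exact hF.1 (Finset.mem_of_mem_erase hw)
  · intro w hw
    rcases Finset.mem_insert.1 hw with rfl | hw
    · exact hj2
    · have h3 := Finset.mem_of_mem_erase hw
      have h4 := Finset.ne_of_mem_erase hw
      simp [hf.1 w h3, he w h3, h4]
  · rw [Finset.card_insert_of_notMem (fun h => hjF (Finset.mem_of_mem_erase h)),
      Finset.card_erase_of_mem hi, hF.2.1]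
    have := Finset.card_pos.2 ⟨i, hi⟩
    have := hF.2.1
    omega

/-- every face lies in a facet -/
theorem Face.exists_facet {s : Finset X} (hs : C.Face s) : ∃ F, C.IsF F ∧ s ⊆ F := by
  have key : ∀ k : ℕ, ∀ s : Finset X, C.Face s → C.n - s.card ≤ k → ∃ F, C.IsF F ∧ s ⊆ F := by
    intro k
    induction k with
    | zero =>
      intro s hs hk
      obtain ⟨h1, f, h2, h3, h4⟩ := hs
      have := card_le_of_zero h2 h3 h1 h4
      exact ⟨s, (isF_of h2 h3 h1 h4 (by omega)).1, Finset.Subset.refl _⟩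
    | succ k ih =>
      intro s hs hk
      obtain ⟨h1, f, h2, h3, h4⟩ := hs
      have hle := card_le_of_zero h2 h3 h1 h4
      by_cases hc : s.card = C.n
      · exact ⟨s, (isF_of h2 h3 h1 h4 hc).1, Finset.Subset.refl _⟩
      -- it suffices to find a bigger face
      suffices hb : ∃ j, j ∉ s ∧ C.Face (insert j s) by
        obtain ⟨j, hj, hjs⟩ := hb
        obtain ⟨F, hF, hsF⟩ := ih (insert j s) hjs (by
          rw [Finset.card_insert_of_notMem hj]; omega)
        exact ⟨F, hF, (Finset.subset_insert _ _).trans hsF⟩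
      by_cases hex : ∃ j ∈ C.V, j ∉ s ∧ f (C.q j) = 0
      · obtain ⟨j, hj, hjs, hj0⟩ := hex
        refine ⟨j, hjs, ?_, f, h2, h3, ?_⟩
        · intro w hw; rcases Finset.mem_insert.1 hw with rfl | hw
          · exact hj
          · exact h1 hw
        · intro w hw; rcases Finset.mem_insert.1 hw with rfl | hw
          · exact hj0
          · exact h4 w hw
      push Not at hex
      have hfd := C.fin
      obtain ⟨e, he0, hes, hne⟩ : ∃ e : E →ₗ[ℝ] ℝ, (∀ v ∈ s, e (C.q v) = 0) ∧
          (∀ t : ℝ, f + t • e ≠ 0) ∧ e ≠ 0 := by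
        -- a vector of the kernel of f outside the span of s
        have hlt : Submodule.span ℝ (C.q '' (s : Set X)) < LinearMap.ker f := by
          refine lt_of_le_of_ne (span_le_ker h4) (fun h => ?_)
          have := finrank_span_of_indep (indep_of_zero h2 h3 h1 h4)
          rw [h, C.finrank_ker_eq h3] at this
          omega
        obtain ⟨x, hx, hxs⟩ := SetLike.exists_of_lt hlt
        obtain ⟨e, he, he'⟩ := Submodule.exists_le_ker_of_notMem hxs
        refine ⟨e, fun v hv => he' (Submodule.subset_span ⟨v, hv, rfl⟩), fun t ht => ?_, ?_⟩
        · have h5 := LinearMap.congr_fun ht x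
          have h6 : f x = 0 := hx
          simp [h6, he] at h5
          rw [h5] at ht
          simp at ht
          exact h3 ht
        · rintro rfl; simp at he
      obtain ⟨e, he0, hes, hneg⟩ : ∃ e : E →ₗ[ℝ] ℝ, (∀ v ∈ s, e (C.q v) = 0) ∧
          (∀ t : ℝ, f + t • e ≠ 0) ∧ ∃ v ∈ C.V, e (C.q v) < 0 := by
        by_cases hn : ∃ v ∈ C.V, e (C.q v) < 0
        · exact ⟨e, he0, hes, hn⟩
        · push Not at hn
          refine ⟨-e, fun v hv => by simp [he0 v hv], fun t => by
            have h7 : f + t • (-e) = f + (-t) • e := by ext x; simp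
            rw [h7]; exact hes (-t), ?_⟩
          by_contra hn2
          push Not at hn2
          apply hne
          apply C.span
          intro v hv
          have := hn v hv
          have := hn2 v hv
          simp at this
          linarith
      obtain ⟨t, ht, h5, j, hj, hj1, hj2⟩ := rotate h2 (e := e) (by
        intro v hv h
        have : v ∈ s := by
          by_contra hvs
          exact hex v hv hvs h
        rw [he0 v this]) hneg
      refine ⟨j, fun h => ?_, ?_, f + t • e, h5, hes t, ?_⟩
      · rw [he0 j h] at hj1; linarith
      · intro w hw; rcases Finset.mem_insert.1 hw with rfl | hw
        · exact hj
        · exact h1 hw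
      · intro w hw; rcases Finset.mem_insert.1 hw with rfl | hw
        · exact hj2
        · simp [h4 w hw, he0 w hw]
  exact key _ s hs le_rfl

theorem IsF.face {F s : Finset X} (hF : C.IsF F) (hs : s ⊆ F) : C.Face s := by
  obtain ⟨f, hf⟩ := hF.2.2
  exact ⟨hs.trans hF.1, f, hf.nonneg, hf.ne_zero hF, fun v hv => hf.1 v (hs hv)⟩

theorem vertex_facet {v : X} (hv : v ∈ C.V) : ∃ F, C.IsF F ∧ v ∈ F := by
  obtain ⟨f, h1, h2, h3⟩ := C.vert v hv
  obtain ⟨F, hF, hs⟩ := Face.exists_facet (C := C) (s := {v}) ⟨by simpa using hv, f, h1, h2, by simpa using h3⟩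
  exact ⟨F, hF, by simpa using hs⟩

/-- the opposite vertex across a ridge is on the other side -/
theorem IsF.opp {F : Finset X} (hF : C.IsF F) {i j : X} (hj : j ∉ F)
    (hF' : C.IsF (insert j (F.erase i))) {f f' : E →ₗ[ℝ] ℝ} (hf : C.Nu F f)
    (hf' : C.Nu (insert j (F.erase i)) f') {o : E} (ho : 0 < f o) (ho' : 0 < f' o)
    {e : E →ₗ[ℝ] ℝ} (hi : i ∈ F) (he : ∀ v ∈ F, e (C.q v) = if v = i then 1 else 0)
    (heo : e o = 0) : e (C.q j) < 0 := by
  obtain ⟨α, hα⟩ := hF.span hf ho.ne' (C.q j)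
  have hjV : j ∈ C.V := hF'.1 (Finset.mem_insert_self _ _)
  have hδ : 0 < f (C.q j) / f o := div_pos (hf.2 j hjV hj) ho
  have h1 : e (C.q j) = α i := by
    rw [hα, map_add, map_sum, Finset.sum_eq_single i]
    · simp [he i hi, heo]
    · intro w hw hwi; simp [he w hw, hwi]
    · intro h; exact absurd hi h
  have hij : i ≠ j := fun h => hj (h ▸ hi)
  have h2 : 0 < f' (C.q i) := hf'.2 i (hF.1 hi) (by simp [hij])
  have h3 : f' (C.q j) = 0 := hf'.1 j (Finset.mem_insert_self _ _)
  rw [hα, map_add, map_sum, Finset.sum_eq_single i] at h3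
  · simp only [map_smul, smul_eq_mul] at h3
    rw [h1]
    have := mul_pos hδ ho'
    by_contra hn
    push Not at hn
    have := mul_nonneg hn h2.le
    linarith
  · intro w hw hwi
    rw [map_smul, hf'.1 w (by simp [hw, hwi])]; simp
  · intro h; exact absurd hi h

end Cfg
end

open Finset
open scoped Classical
noncomputable section

theorem det3_ne_of_dual {a b c : Fin 3 → ℝ} (β1 β2 β3 : (Fin 3 → ℝ) →ₗ[ℝ] ℝ)
    (h11 : β1 a = 1) (h12 : β1 b = 0) (h13 : β1 c = 0) (h22 : β2 b = 1)
    (h32 : β3 b = 0) (h33 : β3 c = 1) : det3 a b c ≠ 0 := by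
  intro h
  have hb : b ≠ 0 := by rintro rfl; simp at h22
  have h0 : ∀ z, det3 z b c = 0 := by
    intro z
    have := congrArg β1 (det3_cramer a b c z)
    simp [h, h11, h12, h13] at this
    exact this.symm
  obtain ⟨t, ht⟩ := det3_collinear b c hb h0
  rw [ht] at h33
  simp [h32] at h33

theorem three_distinct {X : Type*} [DecidableEq X] {s : Finset X} {i j k : X}
    (h : (insert i (insert j (insert k s))).card = s.card + 3) :
    i ≠ j ∧ i ≠ k ∧ j ≠ k ∧ i ∉ s ∧ j ∉ s ∧ k ∉ s := by
  have h1 : k ∉ s := by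
    intro hk
    rw [Finset.insert_eq_of_mem hk] at h
    have := Finset.card_insert_le i (insert j s)
    have := Finset.card_insert_le j s
    omega
  have h2 : j ∉ insert k s := by
    intro hk
    rw [Finset.insert_eq_of_mem hk] at h
    have := Finset.card_insert_le i (insert k s)
    have := Finset.card_insert_le k s
    omega
  have h3 : i ∉ insert j (insert k s) := by
    intro hk
    rw [Finset.insert_eq_of_mem hk] at h
    have := Finset.card_insert_le j (insert k s)
    have := Finset.card_insert_le k s
    omega
  simp only [Finset.mem_insert, not_or] at h2 h3
  exact ⟨h3.1, h3.2.1, h2.1, h3.2.2, h2.2, h1⟩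

namespace Cfg
set_option linter.unusedSectionVars false
variable {X : Type*} {E : Type*} [AddCommGroup E] [Module ℝ E] [DecidableEq X] {C : Cfg X E}

theorem IsF.exists_skew {F : Finset X} (hF : C.IsF F) {f : E →ₗ[ℝ] ℝ} (hf : C.Nu F f) {o : E}
    (ho : f o ≠ 0) (M : X → E →ₗ[ℝ] ℝ)
    (hM : ∀ v ∈ F, ∀ w ∈ F, M v (C.q w) + M w (C.q v) = 0) :
    ∃ S : E →ₗ[ℝ] E →ₗ[ℝ] ℝ, (∀ x y, S x y + S y x = 0) ∧ ∀ v ∈ F, S (C.q v) = M v := by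
  have hex : ∀ i : X, ∃ e : E →ₗ[ℝ] ℝ, (∀ v ∈ F, e (C.q v) = if v = i then 1 else 0) ∧ e o = 0 :=
    fun i => hF.interp hf ho (fun v => if v = i then 1 else 0) 0
  choose e he heo using hex
  obtain ⟨eo, heoF, heoo⟩ := hF.interp hf ho (fun _ => 0) 1
  let S : E →ₗ[ℝ] E →ₗ[ℝ] ℝ :=
    ∑ v ∈ F, (e v).smulRight (M v) - eo.smulRight (∑ v ∈ F, M v o • e v)
  have hS : ∀ x, S x = ∑ v ∈ F, e v x • M v - eo x • (∑ v ∈ F, M v o • e v) := by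
    intro x; simp [S, LinearMap.sum_apply]
  have h1 : ∀ v ∈ F, S (C.q v) = M v := by
    intro v hv
    rw [hS, heoF v hv, Finset.sum_eq_single v]
    · simp [he v v hv]
    · intro w hw hwv
      rw [he w v hv, if_neg (Ne.symm hwv)]; simp
    · intro h; exact absurd hv h
  have h2 : ∀ v ∈ F, S o (C.q v) = - M v o := by
    intro v hv
    rw [hS, heoo]
    simp only [heo, zero_smul, Finset.sum_const_zero, one_smul, zero_sub, LinearMap.neg_apply,
      LinearMap.sum_apply, LinearMap.smul_apply, smul_eq_mul]
    rw [Finset.sum_eq_single v]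
    · simp [he v v hv]
    · intro w hw hwv
      rw [he w v hv, if_neg (Ne.symm hwv)]; simp
    · intro h; exact absurd hv h
  have h3 : S o o = 0 := by
    rw [hS, heoo]
    simp [heo, LinearMap.sum_apply]
  refine ⟨S, ?_, h1⟩
  have h4 : ∀ v ∈ F, S (C.q v) + S.flip (C.q v) = 0 := by
    intro v hv
    apply hF.zero hf ho
    · intro w hw
      simp only [LinearMap.add_apply, LinearMap.flip_apply, h1 v hv, h1 w hw]
      exact hM v hv w hw
    · simp [h1 v hv, h2 v hv]
  have h5 : S o + S.flip o = 0 := by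
    apply hF.zero hf ho
    · intro w hw
      simp [h1 w hw, h2 w hw]
    · simp [h3]
  intro x y
  have h6 : S.flip y + S y = 0 := by
    apply hF.zero hf ho
    · intro v hv
      exact LinearMap.congr_fun (h4 v hv) y
    · exact LinearMap.congr_fun h5 y
  exact LinearMap.congr_fun h6 x

theorem IsF.nu1 {F : Finset X} (hF : C.IsF F) {o : E} (ho : ∀ f, C.Nu F f → 0 < f o) :
    ∃ f, C.Nu F f ∧ f o = 1 := by
  obtain ⟨f, hf⟩ := hF.2.2
  have := ho f hf
  refine ⟨(1 / f o) • f, ⟨fun v hv => by simp [hf.1 v hv], fun v hv hvF => ?_⟩, ?_⟩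
  · have := hf.2 v hv hvF
    simp only [LinearMap.smul_apply, smul_eq_mul]
    positivity
  · simp only [LinearMap.smul_apply, smul_eq_mul]
    field_simp

/-- the facets are connected through ridges -/
theorem facet_induction (p : Finset X → Prop) {F1 : Finset X} (hF1 : C.IsF F1) (hp : p F1)
    (step : ∀ F i j, C.IsF F → i ∈ F → j ∉ F → C.IsF (insert j (F.erase i)) → p F →
      p (insert j (F.erase i))) : ∀ F0, C.IsF F0 → p F0 := by
  intro F0 hF0
  have hex : ∀ F, ∃ f : E →ₗ[ℝ] ℝ, C.IsF F → C.Nu F f ∧ f C.oV = 1 := by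
    intro F
    by_cases h : C.IsF F
    · obtain ⟨f, hf⟩ := h.nu1 (fun f hf => oV_pos h hf)
      exact ⟨f, fun _ => hf⟩
    · exact ⟨0, fun h' => absurd h' h⟩
  choose ν hν using hex
  obtain ⟨F, hF, hmin⟩ := Finset.exists_min_image (C.V.powerset.filter (fun F => C.IsF F ∧ p F))
    (fun F => ν F (∑ v ∈ F0, C.q v)) ⟨F1, by simp [hF1.1, hF1, hp]⟩
  simp only [Finset.mem_filter, Finset.mem_powerset] at hF hmin
  obtain ⟨-, hF, hpF⟩ := hF
  by_cases hFF : F = F0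
  · exact hFF ▸ hpF
  exfalso
  set z := ∑ v ∈ F0, C.q v with hz
  obtain ⟨α, hα⟩ := hF.span (hν F hF).1 (o := C.oV) (by rw [(hν F hF).2]; norm_num) z
  rw [(hν F hF).2, div_one] at hα
  have hδ : 0 < ν F z := by
    rw [hz, map_sum]
    apply Finset.sum_pos' (fun v hv => (hν F hF).1.nonneg v (hF0.1 hv))
    by_contra hn
    push Not at hn
    apply hFF
    symm
    apply Finset.eq_of_subset_of_card_le
    · intro v hv
      by_contra hvF
      have := (hν F hF).1.2 v (hF0.1 hv) hvF
      linarith [hn v hv]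
    · rw [hF.2.1, hF0.2.1]
  have h0 : ν F0 z = 0 := by
    rw [hz, map_sum]
    exact Finset.sum_eq_zero (fun v hv => (hν F0 hF0).1.1 v hv)
  have h1 := congrArg (ν F0) hα
  rw [h0, map_add, map_sum, map_smul, (hν F0 hF0).2] at h1
  obtain ⟨i, hi, hαi⟩ : ∃ i ∈ F, α i < 0 := by
    by_contra hn
    push Not at hn
    have : 0 ≤ ∑ v ∈ F, ν F0 (α v • C.q v) := by
      apply Finset.sum_nonneg
      intro v hv
      rw [map_smul, smul_eq_mul]
      exact mul_nonneg (hn v hv) ((hν F0 hF0).1.nonneg v (hF.1 hv))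
    simp only [smul_eq_mul, mul_one] at h1
    linarith
  obtain ⟨j, hj, hF'⟩ := hF.exchange hi
  have hij : i ≠ j := fun h => hj (h ▸ hi)
  have h2 := hmin _ ⟨hF'.1, hF', step F i j hF hi hj hF' hpF⟩
  have h3 := congrArg (ν (insert j (F.erase i))) hα
  rw [map_add, map_sum _ (fun v => α v • C.q v) F, map_smul, (hν _ hF').2, Finset.sum_eq_single (s := F) i] at h3
  · have h4 := (hν _ hF').1.2 i (hF.1 hi) (by simp [hij])
    rw [map_smul] at h3
    simp only [smul_eq_mul, mul_one] at h3
    have := mul_neg_of_neg_of_pos hαi h4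
    linarith
  · intro w hw hwi
    rw [map_smul, (hν _ hF').1.1 w (by simp [hw, hwi])]; simp
  · intro h; exact absurd hi h

/-- link vertices -/
def lkF (C : Cfg X E) (σ : Finset X) : Finset X :=
  C.V.filter (fun v => v ∉ σ ∧ ∃ F, C.IsF F ∧ σ ⊆ F ∧ v ∈ F)

/-- `o` is an interior direction for the star of `σ` -/
def Pos (C : Cfg X E) (σ : Finset X) (o : E) : Prop :=
  ∀ F, C.IsF F → σ ⊆ F → ∀ f, C.Nu F f → 0 < f o

theorem pos_oV (σ : Finset X) : C.Pos σ C.oV := fun _ hF _ _ hf => oV_pos hF hf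

theorem mem_lkF {F σ : Finset X} (hF : C.IsF F) (hσ : σ ⊆ F) {v : X} (hv : v ∈ F) (hvσ : v ∉ σ) :
    v ∈ C.lkF σ := by
  simp only [lkF, Finset.mem_filter]
  exact ⟨hF.1 hv, hvσ, F, hF, hσ, hv⟩

theorem exists_three {F σ : Finset X} (hσ : σ ⊆ F) (hc : F.card = σ.card + 3) {i : X} (hi : i ∈ F)
    (hiσ : i ∉ σ) : ∃ j k, F = insert i (insert j (insert k σ)) := by
  have h1 : ((F \ σ).erase i).card = 2 := by
    rw [Finset.card_erase_of_mem (by simp [hi, hiσ]), Finset.card_sdiff_of_subset hσ]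
    omega
  obtain ⟨j, k, -, hjk⟩ := Finset.card_eq_two.1 h1
  refine ⟨j, k, ?_⟩
  ext x
  have hx := Finset.ext_iff.1 hjk x
  simp only [Finset.mem_erase, Finset.mem_sdiff, Finset.mem_insert, Finset.mem_singleton] at hx ⊢
  by_cases h2 : x = i
  · subst h2; simp [hi]
  by_cases h3 : x ∈ σ
  · simp [h3, hσ h3]
  simp only [h2, h3, false_or, or_false, ne_eq, not_false_eq_true, and_true, true_and] at hx ⊢
  exact hx

theorem exists_fan {σ : Finset X} (hc : σ.card + 3 = C.n) {o : E} (hpos : C.Pos σ o)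
    {i0 j0 k0 : X} (hF0 : C.IsF (insert i0 (insert j0 (insert k0 σ)))) :
    ∃ (Φ : Fan3 (C.lkF σ)) (π : E →ₗ[ℝ] (Fin 3 → ℝ)) (ν0 : E →ₗ[ℝ] ℝ),
      (∀ i, Φ.p i = π (C.q i)) ∧ (∀ i, Φ.φ i = ν0 (C.q i)) ∧
      (∀ i j k, Φ.T i j k ↔ C.IsF (insert (i : X) (insert (j : X) (insert (k : X) σ)))) ∧
      ν0 o = 1 ∧ (∀ s ∈ σ, ν0 (C.q s) = 0) ∧
      (∀ f : E →ₗ[ℝ] ℝ, (∀ s ∈ σ, f (C.q s) = 0) → f o = 0 →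
        ∃ β : (Fin 3 → ℝ) →ₗ[ℝ] ℝ, ∀ x, β (π x) = f x) ∧
      π o = 0 ∧
      (∀ g : E →ₗ[ℝ] ℝ, (∀ s ∈ σ, g (C.q s) = 0) → g o = 0 → g (C.q i0) = 0 → g (C.q j0) = 0 →
        g (C.q k0) = 1 → ∀ x, det3 (π (C.q i0)) (π (C.q j0)) (π x) = g x) := by
  set F0 := insert i0 (insert j0 (insert k0 σ)) with hF0def
  have hd0 := three_distinct (hF0.2.1.trans hc.symm)
  have hσF0 : σ ⊆ F0 := fun s hs => by simp [hF0def, hs]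
  obtain ⟨f0, hf0, hf0o⟩ := hF0.nu1 (hpos _ hF0 hσF0)
  have hf0o' : f0 o ≠ 0 := by rw [hf0o]; norm_num
  have hex : ∀ i : X, ∃ e : E →ₗ[ℝ] ℝ, (∀ v ∈ F0, e (C.q v) = if v = i then 1 else 0) ∧ e o = 0 :=
    fun i => hF0.interp hf0 hf0o' (fun v => if v = i then 1 else 0) 0
  choose e he heo using hex
  let π : E →ₗ[ℝ] (Fin 3 → ℝ) := LinearMap.pi ![e i0, e j0, e k0]
  have hπ : ∀ x, π x = ![e i0 x, e j0 x, e k0 x] := by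
    intro x; ext a; fin_cases a <;> simp [π]
  have hi0 : i0 ∈ F0 := by simp [hF0def]
  have hj0 : j0 ∈ F0 := by simp [hF0def]
  have hk0 : k0 ∈ F0 := by simp [hF0def]
  have hfac : ∀ f : E →ₗ[ℝ] ℝ, (∀ s ∈ σ, f (C.q s) = 0) → f o = 0 →
        ∃ β : (Fin 3 → ℝ) →ₗ[ℝ] ℝ, ∀ x, β (π x) = f x := by
    intro f hfσ hfo
    have hz : f - (f (C.q i0) • e i0 + f (C.q j0) • e j0 + f (C.q k0) • e k0) = 0 := by
      apply hF0.zero hf0 hf0o'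
      · intro v hv
        simp only [LinearMap.sub_apply, LinearMap.add_apply, LinearMap.smul_apply, smul_eq_mul]
        rw [he i0 v hv, he j0 v hv, he k0 v hv]
        obtain ⟨d1, d2, d3, d4, d5, d6⟩ := hd0
        rcases Finset.mem_insert.1 hv with rfl | hv
        · simp [d1, d2]
        rcases Finset.mem_insert.1 hv with rfl | hv
        · simp [Ne.symm d1, d3]
        rcases Finset.mem_insert.1 hv with rfl | hv
        · simp [Ne.symm d2, Ne.symm d3]
        · have e1 : v ≠ i0 := fun h => d4 (h ▸ hv)
          have e2 : v ≠ j0 := fun h => d5 (h ▸ hv)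
          have e3 : v ≠ k0 := fun h => d6 (h ▸ hv)
          simp [e1, e2, e3, hfσ v hv]
      · simp [heo, hfo]
    refine ⟨f (C.q i0) • LinearMap.proj 0 + f (C.q j0) • LinearMap.proj 1 +
      f (C.q k0) • LinearMap.proj 2, fun x => ?_⟩
    have := LinearMap.congr_fun hz x
    simp only [LinearMap.sub_apply, LinearMap.add_apply, LinearMap.smul_apply, smul_eq_mul,
      LinearMap.zero_apply] at this
    rw [hπ]
    simp
    linarith
  -- normalised functionals of the star
  have hexν : ∀ F, ∃ f : E →ₗ[ℝ] ℝ, C.IsF F → σ ⊆ F → C.Nu F f ∧ f o = 1 := by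
    intro F
    by_cases h : C.IsF F ∧ σ ⊆ F
    · obtain ⟨f, hf⟩ := h.1.nu1 (hpos _ h.1 h.2)
      exact ⟨f, fun _ _ => hf⟩
    · exact ⟨0, fun h1 h2 => absurd ⟨h1, h2⟩ h⟩
  choose ν hν using hexν
  let A := C.V.powerset.filter (fun F => C.IsF F ∧ σ ⊆ F)
  have hA : ∀ F, F ∈ A ↔ C.IsF F ∧ σ ⊆ F := by
    intro F
    simp only [A, Finset.mem_filter, Finset.mem_powerset]
    exact ⟨fun h => h.2, fun h => ⟨h.1.1, h⟩⟩
  have hAc : 0 < (A.card : ℝ) := by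
    have : 0 < A.card := Finset.card_pos.2 ⟨F0, (hA _).2 ⟨hF0, hσF0⟩⟩
    exact_mod_cast this
  let ν0 : E →ₗ[ℝ] ℝ := (1 / (A.card : ℝ)) • ∑ F ∈ A, ν F
  have hν0 : ∀ x, ν0 x = (1 / (A.card : ℝ)) * ∑ F ∈ A, ν F x := by
    intro x; simp [ν0, LinearMap.sum_apply]
  have hν0o : ν0 o = 1 := by
    rw [hν0, Finset.sum_congr rfl (g := fun _ => (1 : ℝ))]
    · simp; field_simp
    · intro F hF
      have := (hA F).1 hF
      exact (hν F this.1 this.2).2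
  have hν0σ : ∀ s ∈ σ, ν0 (C.q s) = 0 := by
    intro s hs
    rw [hν0, Finset.sum_eq_zero, mul_zero]
    intro F hF
    have := (hA F).1 hF
    exact (hν F this.1 this.2).1.1 s (this.2 hs)
  have hν0pos : ∀ v ∈ C.lkF σ, 0 < ν0 (C.q v) := by
    intro v hv
    simp only [lkF, Finset.mem_filter] at hv
    obtain ⟨hvV, hvσ, F, hF, hσF, hvF⟩ := hv
    rw [hν0]
    apply mul_pos (by positivity)
    apply Finset.sum_pos'
    · intro G hG
      have := (hA G).1 hG
      exact (hν G this.1 this.2).1.nonneg v hvV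
    · obtain ⟨j, hj, hF'⟩ := hF.exchange hvF
      have hvj : v ≠ j := fun h => hj (h ▸ hvF)
      have hσ' : σ ⊆ insert j (F.erase v) := by
        intro s hs
        have : s ≠ v := fun h => hvσ (h ▸ hs)
        simp [this, hσF hs]
      exact ⟨_, (hA _).2 ⟨hF', hσ'⟩, (hν _ hF' hσ').1.2 v hvV (by simp [hvj])⟩
  have hsub : ∀ i j k : X, σ ⊆ insert i (insert j (insert k σ)) :=
    fun i j k s hs => by simp [hs]
  let Φ : Fan3 (C.lkF σ) :=
    { p := fun i => π (C.q i)
      T := fun i j k => C.IsF (insert (i : X) (insert (j : X) (insert (k : X) σ)))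
      φ := fun i => ν0 (C.q i)
      T_swap := by
        intro i j k h
        rw [Finset.insert_comm]; exact h
      T_rot := by
        intro i j k h
        rw [Finset.insert_comm (k : X), Finset.insert_comm (j : X)]; exact h
      D_ne := by
        intro i j k h
        obtain ⟨d1, d2, d3, d4, d5, d6⟩ := three_distinct (h.2.1.trans hc.symm)
        set F := insert (i : X) (insert (j : X) (insert (k : X) σ)) with hFdef
        obtain ⟨f, hf, hfo⟩ := h.nu1 (hpos _ h (hsub _ _ _))
        have key : ∀ l ∈ F, l ∉ σ → ∃ β : (Fin 3 → ℝ) →ₗ[ℝ] ℝ,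
            ∀ v ∈ F, β (π (C.q v)) = if v = l then 1 else 0 := by
          intro l hl hlσ
          obtain ⟨g, hg, hgo⟩ := h.interp hf (o := o) (by rw [hfo]; norm_num)
            (fun v => if v = l then 1 else 0) 0
          obtain ⟨β, hβ⟩ := hfac g (by
            intro s hs
            have hsl : s ≠ l := fun h => hlσ (h ▸ hs)
            rw [hg s (hsub _ _ _ hs)]; simp [hsl]) hgo
          exact ⟨β, fun v hv => by rw [hβ, hg v hv]⟩
        have hi : (i : X) ∈ F := by simp [hFdef]
        have hj : (j : X) ∈ F := by simp [hFdef]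
        have hk : (k : X) ∈ F := by simp [hFdef]
        obtain ⟨β1, h1⟩ := key i hi d4
        obtain ⟨β2, h2⟩ := key j hj d5
        obtain ⟨β3, h3⟩ := key k hk d6
        apply det3_ne_of_dual β1 β2 β3
        · rw [h1 _ hi, if_pos rfl]
        · rw [h1 _ hj, if_neg (Ne.symm d1)]
        · rw [h1 _ hk, if_neg (Ne.symm d2)]
        · rw [h2 _ hj, if_pos rfl]
        · rw [h3 _ hj, if_neg d3]
        · rw [h3 _ hk, if_pos rfl]
      φ_pos := fun i => hν0pos i i.2
      supp := by
        intro i j k h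
        obtain ⟨hN, hNo⟩ := hν _ h (hsub _ _ _)
        set F := insert (i : X) (insert (j : X) (insert (k : X) σ)) with hFdef
        obtain ⟨β, hβ⟩ := hfac (ν0 - ν F) (by
          intro s hs
          simp [hν0σ s hs, hN.1 s (hsub _ _ _ hs)]) (by simp [hν0o, hNo])
        refine ⟨β, ?_, ?_, ?_, ?_⟩
        · rw [hβ]; simp [hN.1 i (by simp [hFdef])]
        · rw [hβ]; simp [hN.1 j (by simp [hFdef])]
        · rw [hβ]; simp [hN.1 k (by simp [hFdef])]
        · intro l h1 h2 h3
          rw [hβ]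
          have hl := l.2
          simp only [lkF, Finset.mem_filter] at hl
          have := hN.2 l hl.1 (by
            simp only [hFdef, Finset.mem_insert, not_or]
            exact ⟨fun h => h1 (Subtype.ext h), fun h => h2 (Subtype.ext h),
              fun h => h3 (Subtype.ext h), hl.2.1⟩)
          simp only [LinearMap.sub_apply]
          linarith
      ridge := by
        intro i j k h
        obtain ⟨d1, d2, d3, d4, d5, d6⟩ := three_distinct (h.2.1.trans hc.symm)
        obtain ⟨l, hl, hF'⟩ := h.exchange (i := (k : X)) (by simp)
        have heq : insert l ((insert (i : X) (insert (j : X) (insert (k : X) σ))).erase k) =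
            insert (i : X) (insert (j : X) (insert l σ)) := by
          rw [Finset.erase_insert_of_ne d2, Finset.erase_insert_of_ne d3,
            Finset.erase_insert d6, Finset.insert_comm l, Finset.insert_comm l]
        rw [heq] at hF'
        have hlk : l ∈ C.lkF σ := mem_lkF hF' (hsub _ _ _) (by simp)
          (fun h => hl (by simp [h]))
        refine ⟨⟨l, hlk⟩, ?_, hF'⟩
        rintro rfl
        exact hl (by simp)
      cover := by
        intro i
        have hi := i.2
        simp only [lkF, Finset.mem_filter] at hi
        obtain ⟨hvV, hvσ, F, hF, hσF, hvF⟩ := hi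
        obtain ⟨j, k, hjk⟩ := exists_three hσF (hF.2.1.trans hc.symm) hvF hvσ
        have hF2 := hF
        rw [hjk] at hF2
        obtain ⟨d1, d2, d3, d4, d5, d6⟩ := three_distinct (hF2.2.1.trans hc.symm)
        exact ⟨⟨j, mem_lkF hF2 (hsub _ _ _) (by simp) d5⟩,
          ⟨k, mem_lkF hF2 (hsub _ _ _) (by simp) d6⟩, hF2⟩ }
  refine ⟨Φ, π, ν0, fun _ => rfl, fun _ => rfl, fun _ _ _ => Iff.rfl, hν0o, hν0σ, hfac, ?_, ?_⟩
  · rw [hπ, heo, heo, heo]; ext a; fin_cases a <;> rfl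
  · intro g hgσ hgo hgi hgj hgk x
    obtain ⟨d1, d2, d3, d4, d5, d6⟩ := hd0
    have hg : g - e k0 = 0 := by
      apply hF0.zero hf0 hf0o'
      · intro v hv
        simp only [LinearMap.sub_apply]
        rw [he k0 v hv]
        rcases Finset.mem_insert.1 hv with rfl | hv
        · simp [d2, hgi]
        rcases Finset.mem_insert.1 hv with rfl | hv
        · simp [d3, hgj]
        rcases Finset.mem_insert.1 hv with rfl | hv
        · simp [hgk]
        · have e3 : v ≠ k0 := fun h => d6 (h ▸ hv)
          simp [e3, hgσ v hv]
      · simp [heo, hgo]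
    have hgx := LinearMap.congr_fun hg x
    simp only [LinearMap.sub_apply, LinearMap.zero_apply] at hgx
    rw [hπ, hπ, hπ, he i0 i0 hi0, he i0 j0 hj0, he j0 i0 hi0, he j0 j0 hj0, he k0 i0 hi0,
      he k0 j0 hj0]
    simp only [det3, d1, d2, d3, Ne.symm d1, if_true, if_false]
    simp
    linarith

end Cfg
end

open Finset
open scoped Classical
noncomputable section

namespace Cfg
set_option linter.unusedSectionVars false
variable {X : Type*} {E : Type*} [AddCommGroup E] [Module ℝ E] [DecidableEq X] {C : Cfg X E}

/-- Infinitesimal rigidity of simplicial polytopes. -/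
theorem rigid (hn : 3 ≤ C.n) (M : X → E →ₗ[ℝ] ℝ)
    (hM : ∀ F, C.IsF F → ∀ v ∈ F, ∀ w ∈ F, M v (C.q w) + M w (C.q v) = 0) :
    ∃ S : E →ₗ[ℝ] E →ₗ[ℝ] ℝ, (∀ x y, S x y + S y x = 0) ∧ ∀ v ∈ C.V, S (C.q v) = M v := by
  by_cases hV : C.V = ∅
  · exact ⟨0, by simp, by simp [hV]⟩
  obtain ⟨v0, hv0⟩ := Finset.nonempty_iff_ne_empty.2 hV
  obtain ⟨F1, hF1, -⟩ := vertex_facet hv0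
  obtain ⟨f1, hf1⟩ := hF1.2.2
  obtain ⟨S, hS, hSF1⟩ := hF1.exists_skew hf1 (oV_pos hF1 hf1).ne' M (hM F1 hF1)
  refine ⟨S, hS, ?_⟩
  suffices h : ∀ F, C.IsF F → ∀ v ∈ F, S (C.q v) = M v by
    intro v hv
    obtain ⟨F, hF, hvF⟩ := vertex_facet hv
    exact h F hF v hvF
  refine facet_induction _ hF1 hSF1 ?_
  intro F k k' hF hk hk' hF' hgood v hv
  rcases Finset.mem_insert.1 hv with rfl | hv
  swap
  · exact hgood v (Finset.mem_of_mem_erase hv)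
  obtain ⟨σ, hσ, hσc⟩ := Finset.exists_subset_card_eq (s := F.erase k) (n := C.n - 3) (by
    rw [Finset.card_erase_of_mem hk, hF.2.1]; omega)
  have hc : σ.card + 3 = C.n := by omega
  have hkσ : k ∉ σ := fun h => by simpa using hσ h
  have hσF : σ ⊆ F := hσ.trans (Finset.erase_subset _ _)
  obtain ⟨i, j, hij⟩ := exists_three hσF (hF.2.1.trans hc.symm) hk hkσ
  have hF2 := hF
  rw [hij] at hF2
  obtain ⟨d1, d2, d3, d4, d5, d6⟩ := three_distinct (hF2.2.1.trans hc.symm)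
  have hF3 := hF'
  rw [hij, Finset.erase_insert (by simp [d1, d2, d4])] at hF3
  obtain ⟨c1, c2, c3, c4, c5, c6⟩ := three_distinct (hF3.2.1.trans hc.symm)
  obtain ⟨Φ, π, ν0, hp, hφ, hT, hνo, hνσ, hfac, hπo, -⟩ := exists_fan hc (pos_oV (C := C) σ) hF2
  have hsub : ∀ i j k : X, σ ⊆ insert i (insert j (insert k σ)) :=
    fun i j k s hs => by simp [hs]
  let N : X → E →ₗ[ℝ] ℝ := fun v => M v - S (C.q v)
  have hN : ∀ G, C.IsF G → ∀ v ∈ G, ∀ w ∈ G, N v (C.q w) + N w (C.q v) = 0 := by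
    intro G hG v hv w hw
    have h1 := hM G hG v hv w hw
    have h2 := hS (C.q v) (C.q w)
    simp only [N, LinearMap.sub_apply]
    linarith
  have hNF : ∀ v ∈ F, N v = 0 := by
    intro v hv; simp [N, hgood v hv]
  have hμex : ∀ l : C.lkF σ, ∃ μ : (Fin 3 → ℝ) →ₗ[ℝ] ℝ,
      ∀ x, μ (π x) = N l x - N l C.oV * ν0 x := by
    intro l
    have hl := l.2
    simp only [lkF, Finset.mem_filter] at hl
    obtain ⟨-, -, G, hG, hσG, hlG⟩ := hl
    obtain ⟨β, hβ⟩ := hfac (N l - N l C.oV • ν0) (by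
      intro s hs
      have h1 := hN G hG l hlG s (hσG hs)
      rw [hNF s (hσF hs)] at h1
      simp at h1
      simp [h1, hνσ s hs]) (by simp [hνo])
    exact ⟨β, fun x => by rw [hβ]; simp⟩
  choose μ hμ using hμex
  have key : N v C.oV = 0 := by
    refine Φ.lemmaA (fun l => N l C.oV) μ ?_ ?_
      (i := ⟨i, mem_lkF hF2 (hsub _ _ _) (by simp) d5⟩)
      (j := ⟨j, mem_lkF hF2 (hsub _ _ _) (by simp) d6⟩)
      (k := ⟨k, mem_lkF hF2 (hsub _ _ _) (by simp) d4⟩)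
      (k' := ⟨v, mem_lkF hF3 (hsub _ _ _) (by simp) c4⟩) ?_ ?_ ?_ ?_ ?_ ?_
    · intro l
      rw [hp, hφ, hμ]
      have hl := l.2
      simp only [lkF, Finset.mem_filter] at hl
      obtain ⟨-, -, G, hG, hσG, hlG⟩ := hl
      have := hN G hG l hlG l hlG
      linarith
    · intro l l' l'' h
      rw [hT] at h
      have := hN _ h l (by simp) l' (by simp)
      rw [hp, hφ, hμ, hp, hφ, hμ]
      linarith
    · apply Φ.T_rot
      rw [hT]; exact hF2
    · apply Φ.T_rot
      rw [hT]; exact hF3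
    · intro h
      have h' : v = k := congrArg Subtype.val h
      exact hk' (h' ▸ hk)
    · have : N i = 0 := hNF i (by rw [hij]; simp)
      simp [this]
    · have : N j = 0 := hNF j (by rw [hij]; simp)
      simp [this]
    · have : N k = 0 := hNF k hk
      simp [this]
  obtain ⟨f', hf'⟩ := hF'.2.2
  have hz : N v = 0 := by
    apply hF'.zero hf' (oV_pos hF' hf').ne' _ key
    intro w hw
    have h1 := hN _ hF' v (Finset.mem_insert_self _ _) w hw
    rcases Finset.mem_insert.1 hw with rfl | hw
    · linarith
    · rw [hNF w (Finset.mem_of_mem_erase hw)] at h1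
      simpa using h1
  simp only [N] at hz
  exact (sub_eq_zero.1 hz).symm

/-- a missing facet `τ` of the link of `u` which is not a face, with a functional `η` of its
hyperplane -/
structure Miss (C : Cfg X E) (τ : Finset X) (u : X) (η : E →ₗ[ℝ] ℝ) : Prop where
  hu : u ∉ τ
  hV : insert u τ ⊆ C.V
  card : τ.card + 1 = C.n
  notface : ¬ C.Face (insert u τ)
  nott : ¬ C.Face τ
  fac : ∀ s ∈ τ, C.Face (insert u (τ.erase s))
  eta_ne : η ≠ 0
  eta_zero : ∀ v ∈ insert u τ, η (C.q v) = 0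

namespace Miss
variable {τ : Finset X} {u : X} {η : E →ₗ[ℝ] ℝ}

theorem nus (m : C.Miss τ u η) {s : X} (hs : s ∈ τ) : ∃ f : E →ₗ[ℝ] ℝ,
    (∀ v ∈ C.V, 0 ≤ f (C.q v)) ∧ 0 < f (C.q s) ∧ ∀ v ∈ insert u τ, v ≠ s → f (C.q v) = 0 := by
  obtain ⟨F, hF, hsub⟩ := (m.fac s hs).exists_facet
  obtain ⟨f, hf⟩ := hF.2.2
  refine ⟨f, hf.nonneg, hf.2 s (m.hV (by simp [hs])) (fun h => ?_), fun v hv hvs => ?_⟩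
  · apply m.notface
    apply hF.face
    intro w hw
    by_cases hws : w = s
    · exact hws ▸ h
    · apply hsub
      simp only [Finset.mem_insert, Finset.mem_erase] at hw ⊢
      tauto
  · apply hf.1
    apply hsub
    simp only [Finset.mem_insert, Finset.mem_erase] at hv ⊢
    tauto

theorem indep (m : C.Miss τ u η) : LinearIndepOn ℝ C.q ((insert u τ : Finset X) : Set X) := by
  rw [linearIndepOn_finset_iff]
  intro α hα
  have h1 : ∀ s ∈ τ, α s = 0 := by
    intro s hs
    obtain ⟨f, h0, h1, h2⟩ := m.nus hs
    have := congrArg f hα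
    rw [map_sum, Finset.sum_eq_single s] at this
    · simp at this
      rcases this with h | h
      · exact h
      · linarith
    · intro v hv hvs
      rw [map_smul, h2 v hv hvs, smul_zero]
    · intro h; exact absurd (by simp [hs]) h
  intro v hv
  rcases Finset.mem_insert.1 hv with rfl | hv
  · rw [Finset.sum_insert m.hu, Finset.sum_eq_zero (fun s hs => by rw [h1 s hs, zero_smul]), add_zero] at hα
    obtain ⟨F, hF, hvF⟩ := vertex_facet (m.hV (Finset.mem_insert_self v τ))
    have hne : C.q v ≠ 0 := hF.indep.ne_zero hvF
    exact (smul_eq_zero.1 hα).resolve_right hne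
  · exact h1 v hv

theorem hlemma (m : C.Miss τ u η) {F : Finset X} (hF : C.IsF F) (huF : u ∈ F) (γ : X → ℝ)
    (hγ : ∀ v ∈ F, 0 ≤ γ v) (hη : η (∑ v ∈ F, γ v • C.q v) = 0) :
    ∀ v ∈ F, v ∉ insert u τ → γ v = 0 := by
  obtain ⟨α, hα⟩ := mem_span_of_indep m.indep (by rw [Finset.card_insert_of_notMem m.hu, m.card])
    m.eta_ne m.eta_zero hη
  have h1 : ∀ s ∈ τ, 0 ≤ α s := by
    intro s hs
    obtain ⟨f, h0, h1, h2⟩ := m.nus hs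
    have h3 := congrArg f hα
    rw [map_sum, map_sum, Finset.sum_eq_single (s := insert u τ) s] at h3
    · have : 0 ≤ ∑ v ∈ F, f (γ v • C.q v) := by
        apply Finset.sum_nonneg
        intro v hv
        rw [map_smul, smul_eq_mul]
        exact mul_nonneg (hγ v hv) (h0 v (hF.1 hv))
      rw [h3, map_smul, smul_eq_mul] at this
      exact nonneg_of_mul_nonneg_left this h1
    · intro v hv hvs
      rw [map_smul, h2 v hv hvs, smul_zero]
    · intro h; exact absurd (by simp [hs]) h
  obtain ⟨f, hf⟩ := hF.2.2
  have h2 : ∀ s ∈ τ, s ∉ F → α s = 0 := by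
    have h3 := congrArg f hα
    rw [map_sum, map_sum, Finset.sum_eq_zero (s := F) (fun v hv => by
      rw [map_smul, hf.1 v hv, smul_zero]), Finset.sum_insert m.hu, map_smul, hf.1 u huF, smul_zero,
      zero_add] at h3
    have h4 := (Finset.sum_eq_zero_iff_of_nonneg (s := τ) (f := fun s => f (α s • C.q s)) (by
      intro s hs
      rw [map_smul, smul_eq_mul]
      exact mul_nonneg (h1 s hs) (hf.nonneg s (m.hV (by simp [hs]))))).1 h3.symm
    intro s hs hsF
    have h5 := h4 s hs
    rw [map_smul, smul_eq_mul] at h5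
    have := hf.2 s (m.hV (by simp [hs])) hsF
    rcases mul_eq_zero.1 h5 with h | h
    · exact h
    · linarith
  have h3 : ∑ v ∈ insert u τ, α v • C.q v = ∑ v ∈ F, (if v ∈ insert u τ then α v else 0) • C.q v := by
    rw [← Finset.sum_subset (s₁ := F ∩ insert u τ) (s₂ := F) Finset.inter_subset_left,
      ← Finset.sum_subset (s₁ := F ∩ insert u τ) (s₂ := insert u τ) Finset.inter_subset_right]
    · refine Finset.sum_congr rfl (fun v hv => ?_)
      rw [if_pos (Finset.mem_inter.1 hv).2]
    · intro v hv hvF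
      have hvF' : v ∉ F := fun h => hvF (Finset.mem_inter.2 ⟨h, hv⟩)
      rcases Finset.mem_insert.1 hv with rfl | hv
      · exact absurd huF hvF'
      · rw [h2 v hv hvF', zero_smul]
    · intro v hv hvF
      rw [if_neg (fun h => hvF (Finset.mem_inter.2 ⟨hv, h⟩)), zero_smul]
  rw [h3, ← sub_eq_zero, ← Finset.sum_sub_distrib] at hα
  simp only [← sub_smul] at hα
  have h4 := (linearIndepOn_finset_iff.1 hF.indep) _ hα
  intro v hv hvT
  have := h4 v hv
  simpa [hvT] using this

theorem h1 (m : C.Miss τ u η) {F : Finset X} (hF : C.IsF F) (huF : u ∈ F) {v : X} (hv : v ∈ F)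
    (hη : η (C.q v) = 0) : v ∈ insert u τ := by
  by_contra hn
  have := m.hlemma hF huF (fun w => if w = v then 1 else 0) (fun w _ => by split_ifs <;> norm_num)
    (by rw [map_sum, Finset.sum_eq_zero]
        intro w hw
        rw [map_smul]
        split_ifs with h
        · rw [h, hη, smul_zero]
        · rw [zero_smul]) v hv hn
  simp at this

theorem h2 (m : C.Miss τ u η) {F : Finset X} (hF : C.IsF F) (huF : u ∈ F) {v w : X} (hv : v ∈ F)
    (hw : w ∈ F) (hηv : 0 < η (C.q v)) (hηw : η (C.q w) < 0) : False := by
  have hvw : v ≠ w := by rintro rfl; linarith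
  have := m.hlemma hF huF (fun x => if x = v then - η (C.q w) else if x = w then η (C.q v) else 0)
    (fun x _ => by split_ifs <;> linarith)
    (by rw [map_sum]
        rw [← Finset.sum_subset (s₁ := {v, w}) (s₂ := F)]
        · rw [Finset.sum_pair hvw]
          simp [hvw.symm]
          ring
        · intro x hx
          rcases Finset.mem_insert.1 hx with rfl | hx
          · exact hv
          · rw [Finset.mem_singleton.1 hx]; exact hw
        · intro x _ hx
          simp only [Finset.mem_insert, Finset.mem_singleton, not_or] at hx
          simp [hx.1, hx.2]) v hv (fun h => by
            have := m.eta_zero v h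
            linarith)
  simp at this
  linarith

end Miss
end Cfg
end

open Finset
open scoped Classical
noncomputable section

namespace Cfg
set_option linter.unusedSectionVars false
variable {X : Type*} {E : Type*} [AddCommGroup E] [Module ℝ E] [DecidableEq X] {C : Cfg X E}

/-- The two copies of the split vertex move in the same way. -/
theorem stage1 {σ : Finset X} {a b u : X} {η : E →ₗ[ℝ] ℝ}
    (m : C.Miss (insert a (insert b σ)) u η) (hσ : σ.card + 3 = C.n)
    (M : X → E →ₗ[ℝ] ℝ) (M2 : E →ₗ[ℝ] ℝ)
    (hMM : ∀ F, C.IsF F → σ ⊆ F → ∀ v ∈ F, ∀ w ∈ F, v ≠ u → w ≠ u →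
      M v (C.q w) + M w (C.q v) = 0)
    (hMu : ∀ F, C.IsF F → σ ⊆ F → u ∈ F → ∀ j ∈ F, 0 ≤ η (C.q j) →
      M u (C.q j) + M j (C.q u) = 0)
    (hM2 : ∀ F, C.IsF F → σ ⊆ F → u ∈ F → ∀ j ∈ F, j ≠ u → η (C.q j) ≤ 0 →
      M2 (C.q j) + M j (C.q u) = 0)
    (hM2u : M2 (C.q u) = 0)
    (hMab : M a (C.q b) + M b (C.q a) = 0) : M2 = M u := by
  have hcardT : (insert u (insert a (insert b σ))).card = σ.card + 3 := by
    rw [Finset.card_insert_of_notMem m.hu, m.card, hσ]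
  obtain ⟨dua, dub, dab, duσ, daσ, dbσ⟩ := three_distinct hcardT
  have haV : a ∈ C.V := m.hV (by simp)
  have hbV : b ∈ C.V := m.hV (by simp)
  have huV : u ∈ C.V := m.hV (by simp)
  set o : E := C.q a + C.q b + C.q u with ho
  have hηa : η (C.q a) = 0 := m.eta_zero a (by simp)
  have hηb : η (C.q b) = 0 := m.eta_zero b (by simp)
  have hηu : η (C.q u) = 0 := m.eta_zero u (by simp)
  have hησ : ∀ s ∈ σ, η (C.q s) = 0 := fun s hs => m.eta_zero s (by simp [hs])
  have hηo : η o = 0 := by simp [ho, hηa, hηb, hηu]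
  have hpos : C.Pos σ o := by
    intro F hF hσF f hf
    have h1 := hf.nonneg a haV
    have h2 := hf.nonneg b hbV
    have h3 := hf.nonneg u huV
    rw [ho, map_add, map_add]
    by_contra hn
    have hz : ∀ v ∈ C.V, f (C.q v) ≤ 0 → v ∈ F := by
      intro v hv hle
      by_contra hvF
      linarith [hf.2 v hv hvF]
    apply m.notface
    apply hF.face
    intro v hv
    simp only [Finset.mem_insert] at hv
    rcases hv with rfl | rfl | rfl | hv
    · exact hz _ huV (by linarith)
    · exact hz _ haV (by linarith)
    · exact hz _ hbV (by linarith)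
    · exact hσF hv
  have hsub : ∀ i j k : X, σ ⊆ insert i (insert j (insert k σ)) :=
    fun i j k s hs => by simp [hs]
  -- facets through `u` and one of `a, b`
  have hfacet : ∀ x y : X, x ≠ u → x ∉ σ → C.Face (insert u (insert x σ)) →
      ∃ c, C.IsF (insert x (insert u (insert c σ))) := by
    intro x y hxu hxσ hface
    obtain ⟨G, hG, hsubG⟩ := hface.exists_facet
    have h1 : (G \ insert u (insert x σ)).card = 1 := by
      rw [Finset.card_sdiff_of_subset hsubG, hG.2.1, Finset.card_insert_of_notMem (by
        simp [Ne.symm hxu, duσ]), Finset.card_insert_of_notMem hxσ]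
      omega
    obtain ⟨c, hc⟩ := Finset.card_eq_one.1 h1
    refine ⟨c, ?_⟩
    have : G = insert x (insert u (insert c σ)) := by
      rw [← Finset.sdiff_union_of_subset hsubG, hc]
      ext z
      simp only [Finset.mem_union, Finset.mem_insert, Finset.mem_singleton]
      tauto
    rw [← this]; exact hG
  have hfa : C.Face (insert u (insert a σ)) := by
    have := m.fac b (by simp)
    rwa [Finset.erase_insert_of_ne dab, Finset.erase_insert dbσ] at this
  have hfb : C.Face (insert u (insert b σ)) := by
    have := m.fac a (by simp)
    rwa [Finset.erase_insert (by simp [dab, daσ])] at this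
  obtain ⟨cb, hFb⟩ := hfacet b b (Ne.symm dub) dbσ hfb
  have hne0 : ∀ c, C.IsF (insert a (insert u (insert c σ))) → η (C.q c) ≠ 0 := by
    intro c hF h0
    obtain ⟨e1, e2, e3, e4, e5, e6⟩ := three_distinct (hF.2.1.trans hσ.symm)
    have := m.h1 hF (by simp) (by simp) h0
    simp only [Finset.mem_insert] at this
    rcases this with h | h | h | h
    · exact e3 h.symm
    · exact e2 h.symm
    · apply m.notface
      apply hF.face
      rw [h]
      intro z hz
      simp only [Finset.mem_insert] at hz ⊢
      tauto
    · exact e6 h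
  obtain ⟨c, hF0, hηc⟩ : ∃ c, C.IsF (insert a (insert u (insert c σ))) ∧ 0 < η (C.q c) := by
    obtain ⟨c, hF⟩ := hfacet a a (Ne.symm dua) daσ hfa
    have hne := hne0 c hF
    rcases lt_or_gt_of_ne hne with h | h
    swap
    · exact ⟨c, hF, h⟩
    obtain ⟨e1, e2, e3, e4, e5, e6⟩ := three_distinct (hF.2.1.trans hσ.symm)
    obtain ⟨c', hc', hF'⟩ := hF.exchange (i := c) (by simp)
    have heq : insert c' ((insert a (insert u (insert c σ))).erase c) =
        insert a (insert u (insert c' σ)) := by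
      rw [Finset.erase_insert_of_ne e2, Finset.erase_insert_of_ne e3,
        Finset.erase_insert e6, Finset.insert_comm c', Finset.insert_comm c']
    obtain ⟨f, hf⟩ := hF.2.2
    obtain ⟨f', hf'⟩ := hF'.2.2
    have hop := hF.opp hc' hF' hf hf' (hpos _ hF (hsub _ _ _) f hf)
      (hpos _ hF' (by rw [heq]; exact hsub _ _ _) f' hf') (e := (1 / η (C.q c)) • η) (by simp)
      (by
        intro v hv
        simp only [LinearMap.smul_apply, smul_eq_mul]
        simp only [Finset.mem_insert] at hv
        rcases hv with rfl | rfl | rfl | hv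
        · simp [e2, hηa]
        · simp [e3, hηu]
        · simp only [if_true]; field_simp
        · have : v ≠ c := fun h => e6 (h ▸ hv)
          simp [this, hησ v hv]) (by simp [hηo])
    refine ⟨c', heq ▸ hF', ?_⟩
    simp only [LinearMap.smul_apply, smul_eq_mul] at hop
    have h3 : 1 / η (C.q c) < 0 := one_div_neg.2 h
    exact pos_of_mul_neg_right hop h3.le
  obtain ⟨e1, e2, e3, e4, e5, e6⟩ := three_distinct (hF0.2.1.trans hσ.symm)
  set F0 := insert a (insert u (insert c σ)) with hF0def
  have hσ0 : σ ⊆ F0 := hsub _ _ _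
  have ha0 : a ∈ F0 := by simp [hF0def]
  have hu0 : u ∈ F0 := by simp [hF0def]
  have hc0 : c ∈ F0 := by simp [hF0def]
  have hη0 : ∀ v ∈ F0, 0 ≤ η (C.q v) := by
    intro v hv
    simp only [hF0def, Finset.mem_insert] at hv
    rcases hv with rfl | rfl | rfl | hv
    · rw [hηa]
    · rw [hηu]
    · exact hηc.le
    · rw [hησ v hv]
  let η' : E →ₗ[ℝ] ℝ := (1 / η (C.q c)) • η
  have hη' : ∀ x, η' x = (1 / η (C.q c)) * η x := fun x => by simp [η']
  have hη'c : η' (C.q c) = 1 := by rw [hη']; field_simp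
  have hinv : 0 < 1 / η (C.q c) := by positivity
  obtain ⟨f0, hf0⟩ := hF0.2.2
  have hf0o := hpos _ hF0 hσ0 f0 hf0
  obtain ⟨S, hS, hSF⟩ := hF0.exists_skew hf0 hf0o.ne' M (by
    intro v hv w hw
    by_cases hvu : v = u
    · rw [hvu]; exact hMu _ hF0 hσ0 hu0 w hw (hη0 w hw)
    by_cases hwu : w = u
    · rw [hwu, add_comm]; exact hMu _ hF0 hσ0 hu0 v hv (hη0 v hv)
    exact hMM _ hF0 hσ0 v hv w hw hvu hwu)
  let N : X → E →ₗ[ℝ] ℝ := fun v => M v - S (C.q v)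
  have hNd : ∀ v x, N v x = M v x - S (C.q v) x := fun v x => by simp [N]
  have hN0 : ∀ v ∈ F0, N v = 0 := fun v hv => by simp [N, hSF v hv]
  let N2 : E →ₗ[ℝ] ℝ := M2 - S (C.q u)
  have hN2d : ∀ x, N2 x = M2 x - S (C.q u) x := fun x => by simp [N2]
  have hSuu : S (C.q u) (C.q u) = 0 := by linarith [hS (C.q u) (C.q u)]
  -- `N2` vanishes on the hyperplane
  have hN2T : ∀ F, C.IsF F → σ ⊆ F → u ∈ F → ∀ j ∈ F, η (C.q j) = 0 → N2 (C.q j) = 0 := by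
    intro F hF hσF huF j hj h0
    by_cases hju : j = u
    · rw [hju, hN2d, hM2u, hSuu, sub_zero]
    have h1 := hMu F hF hσF huF j hj h0.ge
    have h2 := hM2 F hF hσF huF j hj hju h0.le
    rw [hN2d, hSF u hu0]
    linarith
  have hN2a : N2 (C.q a) = 0 := hN2T _ hF0 hσ0 hu0 a ha0 hηa
  have hN2u : N2 (C.q u) = 0 := hN2T _ hF0 hσ0 hu0 u hu0 hηu
  have hN2σ : ∀ s ∈ σ, N2 (C.q s) = 0 := fun s hs => hN2T _ hF0 hσ0 hu0 s (hσ0 hs) (hησ s hs)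
  have hN2b : N2 (C.q b) = 0 := hN2T _ hFb (hsub _ _ _) (by simp) b (by simp) hηb
  have hN2o : N2 o = 0 := by simp [ho, hN2a, hN2b, hN2u]
  set t := N2 (C.q c) with ht
  have hN2eq : N2 = t • η' := by
    rw [← sub_eq_zero]
    apply hF0.zero hf0 hf0o.ne'
    · intro v hv
      simp only [LinearMap.sub_apply, LinearMap.smul_apply, smul_eq_mul]
      simp only [hF0def, Finset.mem_insert] at hv
      rcases hv with rfl | rfl | rfl | hv
      · rw [hN2a, hη', hηa]; simp
      · rw [hN2u, hη', hηu]; simp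
      · rw [hη'c, ← ht]; simp
      · rw [hN2σ v hv, hη', hησ v hv]; simp
    · simp only [LinearMap.sub_apply, LinearMap.smul_apply, smul_eq_mul]
      rw [hN2o, hη', hηo]; simp
  suffices htz : t = 0 by
    rw [htz, zero_smul] at hN2eq
    have : M2 = S (C.q u) := sub_eq_zero.1 hN2eq
    rw [this, hSF u hu0]
  obtain ⟨Φ, π, ν0, hp, hφ, hT, hνo, hνσ, hfac, hπo, hdet⟩ := exists_fan hσ hpos hF0
  have hdet' := hdet η' (fun s hs => by rw [hη', hησ s hs, mul_zero]) (by rw [hη', hηo, mul_zero])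
    (by rw [hη', hηa, mul_zero]) (by rw [hη', hηu, mul_zero]) hη'c
  -- relations for `N`
  have hNr : ∀ F, C.IsF F → σ ⊆ F → ∀ v ∈ F, ∀ w ∈ F, v ≠ u → w ≠ u →
      N v (C.q w) + N w (C.q v) = 0 := by
    intro F hF hσF v hv w hw hvu hwu
    have h1 := hMM F hF hσF v hv w hw hvu hwu
    have h2 := hS (C.q v) (C.q w)
    rw [hNd, hNd]; linarith
  have hNu : ∀ F, C.IsF F → σ ⊆ F → u ∈ F → ∀ j ∈ F,
      N u (C.q j) + N j (C.q u) = -t * min (η' (C.q j)) 0 := by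
    intro F hF hσF huF j hj
    rw [hN0 u hu0, LinearMap.zero_apply, zero_add]
    have h2 := hS (C.q u) (C.q j)
    rcases le_or_gt 0 (η (C.q j)) with h | h
    · have h1 := hMu F hF hσF huF j hj h
      rw [min_eq_right (by rw [hη']; positivity), mul_zero, hNd]
      rw [hSF u hu0] at h2
      linarith
    · have hju : j ≠ u := by rintro rfl; linarith
      have h1 := hM2 F hF hσF huF j hj hju h.le
      have h3 : η' (C.q j) < 0 := by rw [hη']; exact mul_neg_of_pos_of_neg hinv h
      rw [min_eq_left h3.le, hNd]
      have h4 := LinearMap.congr_fun hN2eq (C.q j)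
      rw [hN2d, LinearMap.smul_apply, smul_eq_mul] at h4
      linarith
  have hNσ : ∀ l : C.lkF σ, ∀ s ∈ σ, N l (C.q s) = 0 := by
    intro l s hs
    have hl := l.2
    simp only [lkF, Finset.mem_filter] at hl
    obtain ⟨-, -, G, hG, hσG, hlG⟩ := hl
    have hsu : s ≠ u := fun h => duσ (h ▸ hs)
    by_cases hlu : (l : X) = u
    · rw [hlu, hN0 u hu0]; rfl
    · have h1 := hNr G hG hσG l hlG s (hσG hs) hlu hsu
      rw [hN0 s (hσ0 hs), LinearMap.zero_apply, add_zero] at h1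
      exact h1
  have hNself : ∀ l : C.lkF σ, N l (C.q l) = 0 := by
    intro l
    have hl := l.2
    simp only [lkF, Finset.mem_filter] at hl
    obtain ⟨-, -, G, hG, hσG, hlG⟩ := hl
    by_cases hlu : (l : X) = u
    · rw [hlu, hN0 u hu0]; rfl
    · have h1 := hNr G hG hσG l hlG l hlG hlu hlu
      linarith
  have hμex : ∀ l : C.lkF σ, ∃ μ : (Fin 3 → ℝ) →ₗ[ℝ] ℝ,
      ∀ x, μ (π x) = N l x - N l o * ν0 x := by
    intro l
    obtain ⟨β, hβ⟩ := hfac (N l - N l o • ν0) (by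
      intro s hs
      simp [hNσ l s hs, hνσ s hs]) (by simp [hνo])
    exact ⟨β, fun x => by rw [hβ]; simp⟩
  choose μ hμ using hμex
  have hDd : ∀ j : C.lkF σ, Φ.D ⟨a, mem_lkF hF0 hσ0 ha0 e4⟩ ⟨u, mem_lkF hF0 hσ0 hu0 e5⟩ j
      = η' (C.q j) := by
    intro j
    unfold Fan3.D
    rw [hp, hp, hp]
    exact hdet' _
  refine Φ.lemmaB (fun l => N l o) μ ?_ (fun i j => N i (C.q j) + N j (C.q i)) ?_
    ⟨a, mem_lkF hF0 hσ0 ha0 e4⟩ ⟨b, mem_lkF hFb (hsub _ _ _) (by simp) dbσ⟩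
    ⟨u, mem_lkF hF0 hσ0 hu0 e5⟩ t ?_ ?_ ?_ ?_ ?_ ?_ ?_ ?_ ?_
  · intro i
    rw [hp, hφ, hμ, hNself]; ring
  · intro i j
    rw [hp, hφ, hμ, hp, hφ, hμ]; ring
  · refine ⟨⟨c, mem_lkF hF0 hσ0 hc0 e6⟩, ?_⟩
    rw [hT]
    rw [Finset.insert_comm]; exact hF0
  · obtain ⟨b1, b2, b3, b4, b5, b6⟩ := three_distinct (hFb.2.1.trans hσ.symm)
    refine ⟨⟨cb, mem_lkF hFb (hsub _ _ _) (by simp) b6⟩, ?_⟩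
    rw [hT]
    rw [Finset.insert_comm]; exact hFb
  · intro k hk
    rw [hT] at hk
    apply m.nott
    apply hk.face
    intro z hz
    simp only [Finset.mem_insert] at hz ⊢
    tauto
  · rw [hp, hp, hp, ← map_add, ← map_add]
    exact hπo
  · have := hS (C.q a) (C.q b)
    simp only [hNd]
    linarith
  · intro i j k h hi hj
    rw [hT] at h
    exact hNr _ h (hsub _ _ _) i (by simp) j (by simp) (fun h => hi (Subtype.ext h))
      (fun h => hj (Subtype.ext h))
  · intro j k h
    rw [hT] at h
    rw [hDd]
    exact hNu _ h (hsub _ _ _) (by simp) j (by simp)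
  · intro j k h h1 h2
    rw [hT] at h
    rw [hDd, hη'] at h1 h2
    refine m.h2 h (by simp) (v := j) (w := k) (by simp) (by simp) (pos_of_mul_pos_right h1 hinv.le) ?_
    by_contra hn
    push Not at hn
    have := mul_nonneg hinv.le hn
    linarith
  · intro j k h h0
    rw [hT] at h
    rw [hDd, hη'] at h0
    have h0' : η (C.q j) = 0 := (mul_eq_zero.1 h0).resolve_left hinv.ne'
    have := m.h1 h (by simp) (v := j) (by simp) h0'
    obtain ⟨b1, b2, b3, b4, b5, b6⟩ := three_distinct (h.2.1.trans hσ.symm)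
    simp only [Finset.mem_insert] at this
    rcases this with h | h | h | h
    · exact absurd h.symm b1
    · left; exact Subtype.ext h
    · right; exact Subtype.ext h
    · exact absurd h b5

end Cfg
end

open Finset
open scoped Classical
noncomputable section

namespace SPolytope
variable {d : ℕ}

/-- evaluation of a functional on the homogenised space -/
theorem hom_split (f : (Fin d → ℝ) × ℝ →ₗ[ℝ] ℝ) (x : Fin d → ℝ) (r : ℝ) :
    f (x, r) = f (x, 0) + r * f (0, 1) := by
  have : ((x, r) : (Fin d → ℝ) × ℝ) = (x, 0) + r • (0, 1) := by simp
  rw [this, map_add, map_smul, smul_eq_mul]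

theorem hom_span (P : SPolytope d) (f : (Fin d → ℝ) × ℝ →ₗ[ℝ] ℝ)
    (hf : ∀ v ∈ P.V, f (v, 1) = 0) : f = 0 := by
  have key : ∀ x : Fin d → ℝ, f (x, 1) = 0 := by
    intro x
    have hx : x ∈ affineSpan ℝ (P.V : Set (Fin d → ℝ)) := by rw [P.span_top]; trivial
    refine affineSpan_induction (p := fun x => f (x, 1) = 0) hx
      (fun y hy => hf y (by simpa using hy)) ?_
    · intro c a b e ha hb he
      have : ((c • (a -ᵥ b) +ᵥ e, 1) : (Fin d → ℝ) × ℝ) = c • ((a, 1) - (b, 1)) + (e, 1) := by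
        simp
      rw [this, map_add, map_smul, map_sub, ha, hb, he]; simp
  have h0 : f (0, 1) = 0 := key 0
  refine LinearMap.ext fun z => ?_
  obtain ⟨x, r⟩ := z
  have h1 := key x
  rw [hom_split] at h1 ⊢
  simp only [h0, mul_zero, add_zero] at h1 ⊢
  simpa using h1

/-- the functional `(x, r) ↦ c r - f x` -/
def homF (f : (Fin d → ℝ) →ₗ[ℝ] ℝ) (c : ℝ) : (Fin d → ℝ) × ℝ →ₗ[ℝ] ℝ :=
  c • LinearMap.snd ℝ _ _ - f.comp (LinearMap.fst ℝ _ _)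

theorem homF_apply (f : (Fin d → ℝ) →ₗ[ℝ] ℝ) (c : ℝ) (x : Fin d → ℝ) (r : ℝ) :
    homF f c (x, r) = c * r - f x := by simp [homF]

/-- points of the body -/
theorem body_le (P : SPolytope d) (f : (Fin d → ℝ) →ₗ[ℝ] ℝ) (c : ℝ) (h : ∀ v ∈ P.V, f v ≤ c) :
    ∀ y ∈ polyBody P.V, f y ≤ c := by
  intro y hy
  have : polyBody P.V ⊆ {y | f y ≤ c} :=
    convexHull_min (fun v hv => h v (by simpa using hv)) (convex_halfSpace_le f.isLinear c)
  exact this hy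

theorem proper_of (P : SPolytope d) (f : (Fin d → ℝ) × ℝ →ₗ[ℝ] ℝ)
    (hf : ∀ v ∈ P.V, 0 ≤ f (v, 1)) (h0 : f ≠ 0) :
    ∃ F : Set (Fin d → ℝ), IsProperFace P.V F ∧ ∀ v ∈ P.V, v ∈ F ↔ f (v, 1) = 0 := by
  set g : (Fin d → ℝ) →ₗ[ℝ] ℝ := -(f.comp (LinearMap.inl ℝ _ _)) with hg
  have hgv : ∀ v, g v = - f (v, 0) := by intro v; simp [hg]
  have hsub : ∀ v ∈ P.V, v ∈ polyBody P.V := fun v hv => subset_convexHull _ _ (by simpa using hv)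
  have hmem : ∀ v ∈ P.V, v ∈ {y ∈ polyBody P.V | g y = f (0, 1)} ↔ f (v, 1) = 0 := by
    intro v hv
    simp only [Set.mem_ofPred_eq, hsub v hv, true_and, hgv]
    rw [hom_split f v 1]
    constructor <;> intro h <;> linarith
  refine ⟨{y ∈ polyBody P.V | g y = f (0, 1)}, ⟨⟨g, f (0, 1), ?_, rfl⟩, ?_⟩, hmem⟩
  · apply body_le
    intro v hv
    have := hf v hv
    rw [hom_split f v 1] at this
    rw [hgv]; linarith
  · intro he
    apply h0
    apply hom_span P
    intro v hv
    rw [← hmem v hv, he]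
    exact hsub v hv

theorem hom_simp (P : SPolytope d) (f : (Fin d → ℝ) × ℝ →ₗ[ℝ] ℝ)
    (hf : ∀ v ∈ P.V, 0 ≤ f (v, 1)) (h0 : f ≠ 0) :
    LinearIndepOn ℝ (fun v : Fin d → ℝ => ((v, 1) : (Fin d → ℝ) × ℝ))
      {v | v ∈ P.V ∧ f (v, 1) = 0} := by
  obtain ⟨F, hF, hmem⟩ := proper_of P f hf h0
  have hA := (P.simplicial F hF).1
  have hset : ({v | v ∈ P.V ∧ f (v, 1) = 0} : Set (Fin d → ℝ)) = (P.V : Set (Fin d → ℝ)) ∩ F := by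
    ext v
    simp only [Set.mem_ofPred_eq, Set.mem_inter_iff, Finset.mem_coe]
    constructor
    · rintro ⟨h1, h2⟩; exact ⟨h1, (hmem v h1).2 h2⟩
    · rintro ⟨h1, h2⟩; exact ⟨h1, (hmem v h1).1 h2⟩
  rw [hset]
  rw [affineIndependent_iff] at hA
  unfold LinearIndepOn
  rw [linearIndependent_iff']
  intro s g hs i hi
  have h1 : ∑ e ∈ s, g e = 0 := by
    have := congrArg Prod.snd hs
    simpa [Prod.snd_sum] using this
  have h2 : ∑ e ∈ s, g e • (e : Fin d → ℝ) = 0 := by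
    have := congrArg Prod.fst hs
    simpa [Prod.fst_sum] using this
  exact hA s g h1 h2 i hi

theorem hom_vert (P : SPolytope d) (hd : 0 < d) (v : Fin d → ℝ) (hv : v ∈ P.V) :
    ∃ f : (Fin d → ℝ) × ℝ →ₗ[ℝ] ℝ, (∀ w ∈ P.V, 0 ≤ f (w, 1)) ∧ f ≠ 0 ∧ f (v, 1) = 0 := by
  by_cases hne : (P.V.erase v).Nonempty
  · have hcl : IsClosed (convexHull ℝ ((P.V.erase v : Finset (Fin d → ℝ)) : Set (Fin d → ℝ))) :=
      ((Finset.finite_toSet _).isCompact_convexHull ℝ).isClosed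
    obtain ⟨f, c, h1, h2⟩ := geometric_hahn_banach_point_closed (convex_convexHull ℝ _) hcl
      (P.extreme v hv)
    have hw : ∀ w ∈ P.V.erase v, f v < f w := fun w hw =>
      h1.trans (h2 w (subset_convexHull _ _ (Finset.mem_coe.2 hw)))
    refine ⟨homF (-(f : (Fin d → ℝ) →ₗ[ℝ] ℝ)) (-(f v)), ?_, ?_, ?_⟩
    · intro w hw'
      rw [homF_apply]
      simp only [LinearMap.neg_apply, ContinuousLinearMap.coe_coe]
      by_cases h : w = v
      · subst h; linarith
      · have := hw w (mem_erase.2 ⟨h, hw'⟩); linarith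
    · intro h0
      obtain ⟨w, hw'⟩ := hne
      have := hw w hw'
      have h3 := homF_apply (-(f : (Fin d → ℝ) →ₗ[ℝ] ℝ)) (-(f v)) w 1
      rw [h0] at h3
      simp only [LinearMap.neg_apply, ContinuousLinearMap.coe_coe, LinearMap.zero_apply] at h3
      linarith
    · rw [homF_apply]
      simp
  · have hV : ∀ w ∈ P.V, w = v := by
      intro w hw
      by_contra h
      exact hne ⟨w, mem_erase.2 ⟨h, hw⟩⟩
    refine ⟨homF (LinearMap.proj (⟨0, hd⟩ : Fin d)) (v ⟨0, hd⟩), ?_, ?_, ?_⟩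
    · intro w hw
      rw [hV w hw, homF_apply]; simp
    · intro h0
      have h3 := homF_apply (LinearMap.proj (⟨0, hd⟩ : Fin d)) (v ⟨0, hd⟩) (fun _ => (1 : ℝ)) 0
      rw [h0] at h3
      simp at h3
    · rw [homF_apply]; simp

/-- the cone over the polytope -/
def cfg (P : SPolytope d) (hd : 0 < d) : Cfg (Fin d → ℝ) ((Fin d → ℝ) × ℝ) where
  V := P.V
  q := fun v => (v, 1)
  n := d
  finrank_eq := by simp
  fin := inferInstance
  span := P.hom_span
  simp' := P.hom_simp
  vert := P.hom_vert hd

theorem bface_iff (P : SPolytope d) (hd : 0 < d) (s : Finset (Fin d → ℝ)) :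
    BFace P s ↔ (P.cfg hd).Face s := by
  constructor
  · rintro ⟨hs, F, ⟨⟨f, c, h1, h2⟩, h3⟩, h4⟩
    have hsub : ∀ v ∈ P.V, v ∈ polyBody P.V :=
      fun v hv => subset_convexHull _ _ (by simpa using hv)
    refine ⟨hs, homF f c, ?_, ?_, ?_⟩
    · intro v hv
      have := h1 v (hsub v hv)
      change 0 ≤ homF f c (v, 1)
      rw [homF_apply]; linarith
    · intro h0
      apply h3
      rw [h2]
      ext y
      simp only [Set.mem_ofPred_eq, and_iff_left_iff_imp]
      intro _
      have := homF_apply f c y 1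
      rw [h0] at this
      simp at this
      linarith
    · intro v hv
      have hv' := h4 (Finset.mem_coe.2 hv)
      rw [h2] at hv'
      change homF f c (v, 1) = 0
      rw [homF_apply, hv'.2]; simp
  · rintro ⟨hs, f, h1, h2, h3⟩
    obtain ⟨F, hF, hm⟩ := proper_of P f h1 h2
    refine ⟨hs, F, hF, ?_⟩
    intro v hv
    exact (hm v (hs hv)).2 (h3 v hv)

end SPolytope
end

open Finset
open scoped Classical
noncomputable section

namespace SPolytope
variable {d : ℕ}

/-- the central reflection on the homogenised space -/
def negL (d : ℕ) : (Fin d → ℝ) × ℝ →ₗ[ℝ] (Fin d → ℝ) × ℝ :=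
  LinearMap.prodMap (-LinearMap.id) LinearMap.id

theorem negL_apply (x : Fin d → ℝ) (r : ℝ) : negL d (x, r) = (-x, r) := by simp [negL]

theorem negL_comp_ne {f : (Fin d → ℝ) × ℝ →ₗ[ℝ] ℝ} (h : f ≠ 0) : f.comp (negL d) ≠ 0 := by
  intro h0
  apply h
  refine LinearMap.ext fun z => ?_
  obtain ⟨x, r⟩ := z
  have := LinearMap.congr_fun h0 (-x, r)
  simpa [negL_apply] using this

theorem face_neg (P : SPolytope d) (hd : 0 < d) (hcs : IsCS P) {s : Finset (Fin d → ℝ)}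
    (hs : (P.cfg hd).Face s) : (P.cfg hd).Face (s.image fun v => -v) := by
  obtain ⟨h1, f, h2, h3, h4⟩ := hs
  refine ⟨?_, f.comp (negL d), ?_, negL_comp_ne h3, ?_⟩
  · intro x hx
    obtain ⟨v, hv, rfl⟩ := mem_image.1 hx
    exact hcs v (h1 hv)
  · intro v hv
    have := h2 (-v) (hcs v hv)
    change 0 ≤ f (negL d (v, 1))
    rw [negL_apply]; exact this
  · intro x hx
    obtain ⟨v, hv, rfl⟩ := mem_image.1 hx
    change f (negL d (-v, 1)) = 0
    rw [negL_apply, neg_neg]; exact h4 v hv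

theorem isF_neg (P : SPolytope d) (hd : 0 < d) (hcs : IsCS P) {F : Finset (Fin d → ℝ)}
    (hF : (P.cfg hd).IsF F) : (P.cfg hd).IsF (F.image fun v => -v) := by
  obtain ⟨h1, h2, f, h3, h4⟩ := hF
  refine ⟨?_, ?_, f.comp (negL d), ?_, ?_⟩
  · intro x hx
    obtain ⟨v, hv, rfl⟩ := mem_image.1 hx
    exact hcs v (h1 hv)
  · rw [card_image_of_injective _ neg_injective]; exact h2
  · intro x hx
    obtain ⟨v, hv, rfl⟩ := mem_image.1 hx
    change f (negL d (-v, 1)) = 0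
    rw [negL_apply, neg_neg]; exact h3 v hv
  · intro v hv hvF
    change 0 < f (negL d (v, 1))
    rw [negL_apply]
    refine h4 (-v) (hcs v hv) ?_
    intro h
    exact hvF (mem_image.2 ⟨-v, h, neg_neg v⟩)

theorem no_antipodal (P : SPolytope d) (hd : 0 < d) (hcs : IsCS P) {s : Finset (Fin d → ℝ)}
    (hs : (P.cfg hd).Face s) {v : Fin d → ℝ} (hv : v ∈ s) : -v ∉ s := by
  intro hv'
  obtain ⟨h1, f, h2, h3, h4⟩ := hs
  apply h3
  have e1 : f (v, 1) = 0 := h4 v hv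
  have e2 : f (-v, 1) = 0 := h4 (-v) hv'
  have hn : ∀ x : Fin d → ℝ, f (-x, 0) = - f (x, 0) := by
    intro x
    rw [← map_neg]; simp
  have e3 : f (0, 1) = 0 := by
    rw [hom_split] at e1 e2
    rw [hn] at e2
    linarith
  apply P.hom_span
  intro w hw
  have a1 : 0 ≤ f (w, 1) := h2 w hw
  have a2 : 0 ≤ f (-w, 1) := h2 (-w) (hcs w hw)
  rw [hom_split] at a1 a2 ⊢
  rw [hn] at a2
  linarith

theorem face_mono (P : SPolytope d) (hd : 0 < d) {s t : Finset (Fin d → ℝ)}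
    (h : (P.cfg hd).Face t) (hst : s ⊆ t) : (P.cfg hd).Face s :=
  ⟨hst.trans h.1, h.2.imp fun _ hf => ⟨hf.1, hf.2.1, fun v hv => hf.2.2 v (hst hv)⟩⟩

theorem face_single (P : SPolytope d) (hd : 0 < d) {v : Fin d → ℝ} (hv : v ∈ P.V) :
    (P.cfg hd).Face {v} := by
  obtain ⟨f, h1, h2, h3⟩ := P.hom_vert hd v hv
  exact ⟨singleton_subset_iff.2 hv, f, h1, h2, fun w hw => by rw [mem_singleton.1 hw]; exact h3⟩

theorem neg_ne (P : SPolytope d) (hd : 0 < d) (hcs : IsCS P) {v : Fin d → ℝ} (hv : v ∈ P.V) :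
    -v ≠ v := by
  intro h
  have := no_antipodal P hd hcs (face_single P hd hv) (mem_singleton_self v)
  simp [h] at this

theorem exists_eta (t : Finset (Fin d → ℝ)) (ht : t.card ≤ d) :
    ∃ η : (Fin d → ℝ) × ℝ →ₗ[ℝ] ℝ, η ≠ 0 ∧ ∀ v ∈ t, η (v, 1) = 0 := by
  have hlt : Submodule.span ℝ ((t.image (fun v => ((v, 1) : (Fin d → ℝ) × ℝ)) :
      Finset _) : Set ((Fin d → ℝ) × ℝ)) < ⊤ := by
    rw [lt_top_iff_ne_top]
    intro h
    have h1 := finrank_span_finset_le_card (R := ℝ)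
      (t.image (fun v => ((v, 1) : (Fin d → ℝ) × ℝ)))
    have h2 : Set.finrank ℝ ((t.image (fun v => ((v, 1) : (Fin d → ℝ) × ℝ)) :
      Finset _) : Set ((Fin d → ℝ) × ℝ)) = d + 1 := by
      unfold Set.finrank
      rw [h]; simp
    have h3 : (t.image (fun v => ((v, 1) : (Fin d → ℝ) × ℝ))).card ≤ t.card := card_image_le
    omega
  obtain ⟨g, hg, hg'⟩ := Submodule.exists_le_ker_of_lt_top _ hlt
  refine ⟨g, hg, fun v hv => ?_⟩
  exact hg' (Submodule.subset_span (by simpa using hv))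

theorem exists_miss (P : SPolytope d) (hd : 4 ≤ d) (hd0 : 0 < d) (hp : IsPrimePoly P)
    (u : Fin d → ℝ) (τ : Finset (Fin d → ℝ)) (hc : τ.card = d - 1)
    (h1 : ¬ LinkFace P {u} τ) (h2 : ∀ ρ ⊂ τ, LinkFace P {u} ρ) :
    ∃ η, (P.cfg hd0).Miss τ u η := by
  have hsing : ∀ s ∈ τ, LinkFace P {u} {s} := by
    intro s hs
    apply h2
    refine Finset.ssubset_iff_subset_ne.2 ⟨by simpa using hs, ?_⟩
    intro h
    have := congrArg card h
    rw [card_singleton] at this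
    omega
  have huτ : u ∉ τ := by
    intro h
    have := (hsing u h).1
    simp at this
  have hcI : (insert u τ).card = d := by rw [card_insert_of_notMem huτ]; omega
  have hne : τ.Nonempty := card_pos.1 (by omega)
  have hV : insert u τ ⊆ P.V := by
    intro x hx
    rcases mem_insert.1 hx with rfl | hx
    · obtain ⟨s, hs⟩ := hne
      exact (hsing s hs).2.1 (by simp)
    · exact (hsing x hx).2.1 (by simp)
  have hnot : ¬ BFace P (insert u τ) := by
    intro h
    apply h1
    refine ⟨by simpa using huτ, ?_⟩
    rw [union_comm]
    exact h
  have hfac : ∀ s ∈ τ, BFace P (insert u (τ.erase s)) := by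
    intro s hs
    have := (h2 (τ.erase s) (erase_ssubset hs)).2
    rw [union_comm] at this
    exact this
  have hnt : ¬ BFace P τ := by
    intro hτ
    apply hp
    refine ⟨insert u τ, ⟨hV, hnot, ?_⟩, hcI⟩
    intro ρ hρ
    obtain ⟨hsub, x, hx, hxρ⟩ := (Finset.ssubset_iff_of_subset hρ.1).1 hρ |> fun ⟨x, hx, hxρ⟩ =>
      (⟨hρ.1, x, hx, hxρ⟩ : ρ ⊆ insert u τ ∧ ∃ x, x ∈ insert u τ ∧ x ∉ ρ)
    rw [bface_iff P hd0]
    rcases mem_insert.1 hx with rfl | hx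
    · refine face_mono P hd0 ((bface_iff P hd0 _).1 hτ) ?_
      intro y hy
      rcases mem_insert.1 (hsub hy) with rfl | h
      · exact absurd hy hxρ
      · exact h
    · refine face_mono P hd0 ((bface_iff P hd0 _).1 (hfac x hx)) ?_
      intro y hy
      rcases mem_insert.1 (hsub hy) with rfl | h
      · exact mem_insert_self _ _
      · refine mem_insert_of_mem (mem_erase.2 ⟨?_, h⟩)
        rintro rfl; exact hxρ hy
  obtain ⟨η, he, hz⟩ := exists_eta (insert u τ) hcI.le
  refine ⟨η, huτ, hV, ?_, ?_, ?_, ?_, he, hz⟩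
  · change τ.card + 1 = d; omega
  · rw [← bface_iff P hd0]; exact hnot
  · rw [← bface_iff P hd0]; exact hnt
  · intro s hs; rw [← bface_iff P hd0]; exact hfac s hs

end SPolytope
end

open Finset
open scoped Classical
noncomputable section

/-- `dotR` as a linear map in the second variable -/
def dotL {d : ℕ} (x : Fin d → ℝ) : (Fin d → ℝ) →ₗ[ℝ] ℝ where
  toFun := dotR x
  map_add' a b := by simp [dotR, mul_add, sum_add_distrib]
  map_smul' r a := by simp [dotR, mul_sum, mul_left_comm]

theorem dotL_apply {d : ℕ} (x y : Fin d → ℝ) : dotL x y = dotR x y := rfl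

theorem dotR_neg_left {d : ℕ} (x y : Fin d → ℝ) : dotR (-x) y = - dotR x y := by
  simp [dotR]

theorem dotR_neg_right {d : ℕ} (x y : Fin d → ℝ) : dotR x (-y) = - dotR x y := by
  simp [dotR]

namespace SPolytope
variable {d : ℕ}

/-- antipodal pair -/
def pairV (v : Fin d → ℝ) : Finset (Fin d → ℝ) := {v, -v}

theorem pairV_neg (v : Fin d → ℝ) : pairV (-v) = pairV v := by
  simp [pairV, pair_comm]

/-- antipodal pair of edges -/
def pairE (e : Finset (Fin d → ℝ)) : Finset (Finset (Fin d → ℝ)) := {e, e.image fun v => -v}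

theorem image_neg_neg (e : Finset (Fin d → ℝ)) :
    (e.image fun v => -v).image (fun v => -v) = e := by
  rw [image_image]; simp

theorem pairE_neg (e : Finset (Fin d → ℝ)) : pairE (e.image fun v => -v) = pairE e := by
  unfold pairE; rw [image_neg_neg, pair_comm]

theorem mem_edge (P : SPolytope d) (hd0 : 0 < d) {e : Finset (Fin d → ℝ)} :
    e ∈ edgeFinset P ↔ e.card = 2 ∧ (P.cfg hd0).Face e := by
  unfold edgeFinset
  rw [mem_filter, mem_powerset, bface_iff P hd0]
  exact ⟨fun h => h.2, fun h => ⟨h.2.1, h⟩⟩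

theorem card_pairV (P : SPolytope d) : P.V.card ≤ 2 * (P.V.image pairV).card := by
  apply card_le_mul_card_image
  intro b hb
  obtain ⟨v, hv, rfl⟩ := mem_image.1 hb
  refine (card_le_card (t := {v, -v}) ?_).trans card_le_two
  intro w hw
  have := (mem_filter.1 hw).2
  have hw' : w ∈ pairV w := by simp [pairV]
  rw [this] at hw'
  exact hw'

theorem card_pairE (P : SPolytope d) (hd0 : 0 < d) (hcs : IsCS P) :
    2 * ((edgeFinset P).image pairE).card ≤ (edgeFinset P).card := by
  apply mul_card_image_le_card
  intro b hb
  obtain ⟨e, he, rfl⟩ := mem_image.1 hb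
  have he' := (mem_edge P hd0).1 he
  have hne : e ≠ e.image fun v => -v := by
    intro h
    obtain ⟨v, hv⟩ : e.Nonempty := card_pos.1 (by omega)
    refine no_antipodal P hd0 hcs he'.2 hv ?_
    rw [h]
    exact mem_image_of_mem _ hv
  rw [← card_pair hne]
  apply card_le_card
  intro x hx
  rw [mem_filter]
  simp only [mem_insert, mem_singleton] at hx
  rcases hx with rfl | rfl
  · exact ⟨he, rfl⟩
  · refine ⟨(mem_edge P hd0).2 ⟨?_, face_neg P hd0 hcs he'.2⟩, pairE_neg e⟩
    rw [card_image_of_injective _ neg_injective]; exact he'.1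

/-- unknowns -/
abbrev Unk (P : SPolytope d) := ({x // x ∈ P.V.image pairV} → Fin d → ℝ) × (Fin d → ℝ)

/-- velocity of a vertex -/
def mL (P : SPolytope d) (v : Fin d → ℝ) : Unk P →ₗ[ℝ] (Fin d → ℝ) :=
  if h : pairV v ∈ P.V.image pairV then
    (LinearMap.proj (⟨pairV v, h⟩ : {x // x ∈ P.V.image pairV})).comp (LinearMap.fst ℝ _ _)
  else 0

theorem mL_neg (P : SPolytope d) (v : Fin d → ℝ) : P.mL (-v) = P.mL v := by
  unfold mL
  simp only [pairV_neg]

/-- use of the second copy -/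
def sec (u : Fin d → ℝ) (η : (Fin d → ℝ) → ℝ) (v w : Fin d → ℝ) : Prop :=
  (v = u ∧ η w < 0) ∨ (-v = u ∧ η (-w) < 0)

theorem sec_neg (u : Fin d → ℝ) (η : (Fin d → ℝ) → ℝ) (v w : Fin d → ℝ) :
    sec u η (-v) (-w) ↔ sec u η v w := by
  unfold sec; rw [neg_neg, neg_neg, or_comm]

/-- velocity seen from an edge -/
def valL (P : SPolytope d) (u : Fin d → ℝ) (η : (Fin d → ℝ) → ℝ) (v w : Fin d → ℝ) :
    Unk P →ₗ[ℝ] (Fin d → ℝ) :=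
  if sec u η v w then LinearMap.snd ℝ _ _ else P.mL v

theorem valL_neg (P : SPolytope d) (u : Fin d → ℝ) (η : (Fin d → ℝ) → ℝ) (v w : Fin d → ℝ) :
    P.valL u η (-v) (-w) = P.valL u η v w := by
  unfold valL
  simp only [sec_neg, mL_neg]

/-- the equation of an edge -/
def eqL (P : SPolytope d) (u : Fin d → ℝ) (η : (Fin d → ℝ) → ℝ) (v w : Fin d → ℝ) :
    Unk P →ₗ[ℝ] ℝ := (dotL (v - w)).comp (P.valL u η v w - P.valL u η w v)

theorem eqL_apply (P : SPolytope d) (u : Fin d → ℝ) (η : (Fin d → ℝ) → ℝ) (v w : Fin d → ℝ)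
    (z : Unk P) :
    P.eqL u η v w z = dotR (v - w) (P.valL u η v w z - P.valL u η w v z) := rfl

theorem eqL_swap (P : SPolytope d) (u : Fin d → ℝ) (η : (Fin d → ℝ) → ℝ) (v w : Fin d → ℝ)
    (z : Unk P) : P.eqL u η w v z = P.eqL u η v w z := by
  rw [eqL_apply, eqL_apply, ← neg_sub v w, ← neg_sub (P.valL u η v w z), dotR_neg_left,
    dotR_neg_right, neg_neg]

theorem eqL_neg (P : SPolytope d) (u : Fin d → ℝ) (η : (Fin d → ℝ) → ℝ) (v w : Fin d → ℝ)
    (z : Unk P) : P.eqL u η (-v) (-w) z = - P.eqL u η v w z := by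
  rw [eqL_apply, eqL_apply, valL_neg, valL_neg, ← dotR_neg_left]
  congr 1
  abel

theorem pair_cases {a b c e : Fin d → ℝ} (h : ({a, b} : Finset (Fin d → ℝ)) = {c, e})
    (hab : a ≠ b) : (a = c ∧ b = e) ∨ (a = e ∧ b = c) := by
  have ha : a ∈ ({c, e} : Finset (Fin d → ℝ)) := by rw [← h]; simp
  have hb : b ∈ ({c, e} : Finset (Fin d → ℝ)) := by rw [← h]; simp
  simp only [mem_insert, mem_singleton] at ha hb
  rcases ha with rfl | rfl <;> rcases hb with rfl | rfl
  · exact absurd rfl hab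
  · left; exact ⟨rfl, rfl⟩
  · right; exact ⟨rfl, rfl⟩
  · exact absurd rfl hab

theorem count (P : SPolytope d) (hd0 : 0 < d) (hcs : IsCS P)
    (hf : (f1 P : ℤ) = d * (f0 P : ℤ) - 2 * d)
    (u : Fin d → ℝ) (hu : u ∈ P.V) (τ : Finset (Fin d → ℝ)) (hτ : τ.card + 1 = d)
    (η : (Fin d → ℝ) → ℝ)
    (hη : ∀ w, w ≠ u → (P.cfg hd0).Face {u, w} → η w = 0 → w ∈ τ) :
    ∃ (m : (Fin d → ℝ) → Fin d → ℝ) (m2 : Fin d → ℝ),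
      (∀ v, m (-v) = m v) ∧ m u = 0 ∧ ¬ ((∀ v ∈ P.V, m v = 0) ∧ m2 = 0) ∧
      (∀ v w, v ≠ w → (P.cfg hd0).Face {v, w} → v ≠ u → v ≠ -u → w ≠ u → w ≠ -u →
        dotR (v - w) (m v - m w) = 0) ∧
      (∀ w, u ≠ w → (P.cfg hd0).Face {u, w} → 0 ≤ η w → dotR (u - w) (m u - m w) = 0) ∧
      (∀ w, u ≠ w → (P.cfg hd0).Face {u, w} → η w ≤ 0 → dotR (u - w) (m2 - m w) = 0) := by
  have hrep : ∀ x : {x // x ∈ (edgeFinset P).image pairE},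
      ∃ p : (Fin d → ℝ) × (Fin d → ℝ), p.1 ≠ p.2 ∧ pairE {p.1, p.2} = x.1 := by
    rintro ⟨x, hx⟩
    obtain ⟨e, he, rfl⟩ := mem_image.1 hx
    obtain ⟨a, b, hab, rfl⟩ := card_eq_two.1 ((mem_edge P hd0).1 he).1
    exact ⟨(a, b), hab, rfl⟩
  choose rep hrep1 hrep2 using hrep
  let L : Unk P →ₗ[ℝ] ({x // x ∈ (edgeFinset P).image pairE} → ℝ) × ({s // s ∈ τ} → ℝ) ×
      (Fin d → ℝ) :=
    (LinearMap.pi fun x => P.eqL u η (rep x).1 (rep x).2).prod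
      ((LinearMap.pi fun s : {s // s ∈ τ} =>
        (dotL (u - s.1)).comp (LinearMap.snd ℝ _ _ - P.mL s.1)).prod (P.mL u))
  have hlt : Module.finrank ℝ (({x // x ∈ (edgeFinset P).image pairE} → ℝ) × ({s // s ∈ τ} → ℝ) ×
      (Fin d → ℝ)) < Module.finrank ℝ (Unk P) := by
    have e1 : Module.finrank ℝ (({x // x ∈ (edgeFinset P).image pairE} → ℝ) ×
        ({s // s ∈ τ} → ℝ) × (Fin d → ℝ)) = ((edgeFinset P).image pairE).card + (τ.card + d) := by
      rw [Module.finrank_prod, Module.finrank_prod]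
      simp
    have e2 : Module.finrank ℝ (Unk P) = (P.V.image pairV).card * d + d := by
      rw [Module.finrank_prod, Module.finrank_pi_fintype]
      simp
    rw [e1, e2]
    have c1 := card_pairV P
    have c2 := card_pairE P hd0 hcs
    unfold f1 f0 at hf
    have c3 : d * P.V.card ≤ d * (2 * (P.V.image pairV).card) := Nat.mul_le_mul_left _ c1
    have c4 : (edgeFinset P).card + 2 * d = d * P.V.card := by
      zify; linarith
    have c5 : d * (2 * (P.V.image pairV).card) = 2 * ((P.V.image pairV).card * d) := by ring
    omega
  have hker := LinearMap.ker_ne_bot_of_finrank_lt (f := L) hlt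
  obtain ⟨z, hz, hz0⟩ := Submodule.exists_mem_ne_zero_of_ne_bot hker
  have hLz : L z = 0 := hz
  have k1 : ∀ x, P.eqL u η (rep x).1 (rep x).2 z = 0 := fun x =>
    congrFun (congrArg Prod.fst hLz) x
  have k2 : ∀ s ∈ τ, dotR (u - s) (z.2 - P.mL s z) = 0 := fun s hs =>
    congrFun (congrArg (fun y => y.2.1) hLz) ⟨s, hs⟩
  have k3 : P.mL u z = 0 := congrArg (fun y => y.2.2) hLz
  have kE : ∀ v w, v ≠ w → (P.cfg hd0).Face {v, w} → P.eqL u η v w z = 0 := by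
    intro v w hvw hF
    have hx : pairE {v, w} ∈ (edgeFinset P).image pairE :=
      mem_image_of_mem _ ((mem_edge P hd0).2 ⟨card_pair hvw, hF⟩)
    have r0 := k1 ⟨_, hx⟩
    have r1 := hrep1 ⟨_, hx⟩
    have r2 := hrep2 ⟨_, hx⟩
    simp only at r2
    generalize rep ⟨_, hx⟩ = p at r0 r1 r2
    obtain ⟨a, b⟩ := p
    simp only at r0 r1 r2
    have hm : ({a, b} : Finset (Fin d → ℝ)) ∈ pairE {v, w} := by
      rw [← r2]; simp [pairE]
    simp only [pairE, mem_insert, mem_singleton] at hm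
    rcases hm with hm | hm
    · rcases pair_cases hm r1 with ⟨rfl, rfl⟩ | ⟨rfl, rfl⟩
      · exact r0
      · rw [eqL_swap]; exact r0
    · rw [image_insert, image_singleton] at hm
      rcases pair_cases hm r1 with ⟨rfl, rfl⟩ | ⟨rfl, rfl⟩
      · rw [eqL_neg] at r0; linarith
      · rw [eqL_neg, eqL_swap] at r0; linarith
  have hval : ∀ v w, v ≠ u → v ≠ -u → P.valL u η v w = P.mL v := by
    intro v w h1 h2
    unfold valL
    rw [if_neg]
    rintro (⟨h, -⟩ | ⟨h, -⟩)
    · exact h1 h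
    · exact h2 (by rw [← h, neg_neg])
  have hnn := neg_ne P hd0 hcs hu
  have hnbr : ∀ w, (P.cfg hd0).Face {u, w} → w ≠ -u := by
    rintro w hw rfl
    exact no_antipodal P hd0 hcs hw (v := u) (by simp) (by simp)
  refine ⟨fun v => P.mL v z, z.2, ?_, k3, ?_, ?_, ?_, ?_⟩
  · intro v; simp only [mL_neg]
  · rintro ⟨h1, h2⟩
    apply hz0
    refine Prod.ext ?_ h2
    funext x
    obtain ⟨x, hx⟩ := x
    obtain ⟨v, hv, rfl⟩ := mem_image.1 hx
    have : P.mL v z = 0 := h1 v hv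
    unfold mL at this
    rw [dif_pos hx] at this
    exact this
  · intro v w hvw hF h1 h2 h3 h4
    have := kE v w hvw hF
    rw [eqL_apply, hval v w h1 h2, hval w v h3 h4] at this
    exact this
  · intro w huw hF hw
    have := kE u w huw hF
    have e : P.valL u η u w = P.mL u := by
      unfold valL
      rw [if_neg]
      rintro (⟨-, h⟩ | ⟨h, -⟩)
      · linarith
      · exact hnn h
    rw [eqL_apply, e, hval w u huw.symm (hnbr w hF)] at this
    exact this
  · intro w huw hF hw
    rcases hw.lt_or_eq with hw | hw
    · have := kE u w huw hF
      have e : P.valL u η u w = LinearMap.snd ℝ _ _ := by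
        unfold valL
        rw [if_pos]
        exact Or.inl ⟨rfl, hw⟩
      rw [eqL_apply, e, hval w u huw.symm (hnbr w hF)] at this
      exact this
    · exact k2 w (hη w huw.symm hF hw)

end SPolytope
end

open Finset
open scoped Classical

namespace SPolytope
variable {d : ℕ}

/-- functional attached to a velocity `a` at the point `v` -/
def vM (a v : Fin d → ℝ) : (Fin d → ℝ) × ℝ →ₗ[ℝ] ℝ := homF (-(dotL a)) (-(dotR a v))

theorem vM_apply (a v x : Fin d → ℝ) (r : ℝ) : vM a v (x, r) = dotR a x - dotR a v * r := by
  unfold vM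
  rw [homF_apply, LinearMap.neg_apply, dotL_apply]; ring

theorem vM_self (a v : Fin d → ℝ) : vM a v (v, 1) = 0 := by
  rw [vM_apply]; ring

theorem vM_add (a v b w : Fin d → ℝ) :
    vM a v (w, 1) + vM b w (v, 1) = - dotR (v - w) (a - b) := by
  rw [vM_apply, vM_apply]
  simp only [dotR, ← sum_neg_distrib, sum_mul, ← sum_sub_distrib, ← sum_add_distrib, mul_one]
  refine sum_congr rfl fun i _ => ?_
  simp only [Pi.sub_apply]; ring

theorem eq_zero_of_dotR {a : Fin d → ℝ} (h : ∀ x, dotR a x = 0) : a = 0 := by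
  have h1 := h a
  unfold dotR at h1
  funext i
  have := (sum_eq_zero_iff_of_nonneg (fun i _ => mul_self_nonneg (a i))).1 h1 i (mem_univ i)
  simpa using this

theorem dotR_flip (v w a b : Fin d → ℝ) (h : dotR (v - w) (a - b) = 0) :
    dotR (w - v) (b - a) = 0 := by
  rw [← neg_sub v w, ← neg_sub a b, dotR_neg_left, dotR_neg_right, h]; simp

theorem dotR_anti (v w a b : Fin d → ℝ) (h : dotR (v - (-w)) (a - b) = 0) :
    dotR (-v - w) (a - b) = 0 := by
  have : -v - w = -(v - (-w)) := by abel
  rw [this, dotR_neg_left, h]; simp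

theorem face_pair_neg (P : SPolytope d) (hd : 0 < d) (hcs : IsCS P) {v w : Fin d → ℝ}
    (h : (P.cfg hd).Face {-v, w}) : (P.cfg hd).Face {v, -w} := by
  have := face_neg P hd hcs h
  rwa [image_insert, image_singleton, neg_neg] at this

/-- global step: a symmetric motion of the whole graph is trivial -/
theorem stage2 (P : SPolytope d) (hd : 4 ≤ d) (hd0 : 0 < d) (m : (Fin d → ℝ) → Fin d → ℝ)
    (hm : ∀ v, m (-v) = m v) (u : Fin d → ℝ) (hu : u ∈ P.V) (hcs : IsCS P) (hmu : m u = 0)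
    (hE : ∀ v w, v ≠ w → (P.cfg hd0).Face {v, w} → dotR (v - w) (m v - m w) = 0) :
    ∀ v ∈ P.V, m v = 0 := by
  obtain ⟨S, -, hS⟩ := (P.cfg hd0).rigid (show 3 ≤ d by omega) (fun v => vM (m v) v) (by
    intro F hF v hv w hw
    change vM (m v) v (w, 1) + vM (m w) w (v, 1) = 0
    rw [vM_add]
    by_cases hvw : v = w
    · subst hvw; simp [dotR]
    · rw [hE v w hvw (hF.face (by
        intro x hx
        simp only [mem_insert, mem_singleton] at hx
        rcases hx with rfl | rfl <;> assumption)), neg_zero])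
  have key : ∀ v ∈ P.V, ∀ x, S (0, 2) (x, 0) = 2 * dotR (m v) x := by
    intro v hv x
    have h1 : S (v, 1) = vM (m v) v := hS v hv
    have h2 : S (-v, 1) = vM (m (-v)) (-v) := hS (-v) (hcs v hv)
    have h3 : ((0, 2) : (Fin d → ℝ) × ℝ) = (v, 1) + (-v, 1) := by
      ext <;> simp; norm_num
    rw [h3, map_add, LinearMap.add_apply, h1, h2, vM_apply, vM_apply, hm]
    ring
  intro v hv
  apply eq_zero_of_dotR
  intro x
  have h1 := key v hv x
  have h2 := key u hu x
  rw [hmu] at h2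
  have h3 : dotR (0 : Fin d → ℝ) x = 0 := by simp [dotR]
  rw [h3] at h2
  linarith

theorem main (P : SPolytope d) (hd : 4 ≤ d) (hd0 : 0 < d) (hcs : IsCS P)
    (hf : (f1 P : ℤ) = d * (f0 P : ℤ) - 2 * d)
    (u : Fin d → ℝ) (hu : u ∈ P.V) (τ : Finset (Fin d → ℝ))
    (η : (Fin d → ℝ) × ℝ →ₗ[ℝ] ℝ) (ms : (P.cfg hd0).Miss τ u η) : False := by
  have hτ : τ.card + 1 = d := ms.card
  have hfacet : ∀ w, (P.cfg hd0).Face {u, w} → ∃ F, (P.cfg hd0).IsF F ∧ u ∈ F ∧ w ∈ F := by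
    intro w hw
    obtain ⟨F, hF, hs⟩ := hw.exists_facet
    exact ⟨F, hF, hs (by simp), hs (by simp)⟩
  obtain ⟨m, m2, hneg, hmu, hnz, E1, E2, E3⟩ := count P hd0 hcs hf u hu τ hτ (fun w => η (w, 1)) (by
    intro w hwu hw h0
    obtain ⟨F, hF, huF, hwF⟩ := hfacet w hw
    exact mem_of_mem_insert_of_ne (ms.h1 hF huF hwF h0) hwu)
  have hnn := neg_ne P hd0 hcs hu
  -- the decomposition of the missing face
  obtain ⟨a, ha⟩ : τ.Nonempty := card_pos.1 (by omega)
  have ca : (τ.erase a).card = τ.card - 1 := card_erase_of_mem ha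
  obtain ⟨b, hb⟩ : (τ.erase a).Nonempty := card_pos.1 (by omega)
  have cb : ((τ.erase a).erase b).card = (τ.erase a).card - 1 := card_erase_of_mem hb
  obtain ⟨s0, hs0⟩ : ((τ.erase a).erase b).Nonempty := card_pos.1 (by omega)
  set σ := (τ.erase a).erase b with hσ
  have hτeq : insert a (insert b σ) = τ := by
    rw [hσ, insert_erase hb, insert_erase ha]
  have hbτ : b ∈ τ := mem_of_mem_erase hb
  have hs0τ : s0 ∈ τ := mem_of_mem_erase (mem_of_mem_erase hs0)
  have hba : b ≠ a := ne_of_mem_erase hb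
  have hs0b : s0 ≠ b := ne_of_mem_erase hs0
  have hs0a : s0 ≠ a := ne_of_mem_erase (mem_of_mem_erase hs0)
  have third : ∀ x y, ∃ t ∈ τ, t ≠ x ∧ t ≠ y := by
    intro x y
    have h1 : (τ.erase x).card ≥ τ.card - 1 := pred_card_le_card_erase
    have h2 : ((τ.erase x).erase y).card ≥ (τ.erase x).card - 1 := pred_card_le_card_erase
    obtain ⟨t, ht⟩ : ((τ.erase x).erase y).Nonempty := card_pos.1 (by omega)
    exact ⟨t, mem_of_mem_erase (mem_of_mem_erase ht), ne_of_mem_erase (mem_of_mem_erase ht),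
      ne_of_mem_erase ht⟩
  have hant : ∀ x ∈ insert u τ, ∀ y ∈ insert u τ, y ≠ -x := by
    rintro x hx y hy rfl
    obtain ⟨t, ht, htx, hty⟩ := third x (-x)
    refine no_antipodal P hd0 hcs (ms.fac t ht) (v := x) ?_ ?_
    · rcases mem_insert.1 hx with h | h
      · rw [h]; exact mem_insert_self _ _
      · exact mem_insert_of_mem (mem_erase.2 ⟨htx.symm, h⟩)
    · rcases mem_insert.1 hy with h | h
      · rw [h]; exact mem_insert_self _ _
      · exact mem_insert_of_mem (mem_erase.2 ⟨hty.symm, h⟩)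
  have huI : u ∈ insert u τ := mem_insert_self _ _
  have hab : dotR (a - b) (m a - m b) = 0 := by
    apply E1 a b hba.symm
    · refine face_mono P hd0 (ms.fac s0 hs0τ) ?_
      intro x hx
      simp only [mem_insert, mem_singleton] at hx
      rcases hx with rfl | rfl
      · exact mem_insert_of_mem (mem_erase.2 ⟨hs0a.symm, ha⟩)
      · exact mem_insert_of_mem (mem_erase.2 ⟨hs0b.symm, hbτ⟩)
    · rintro rfl; exact ms.hu ha
    · exact hant u huI a (mem_insert_of_mem ha)
    · rintro rfl; exact ms.hu hbτ
    · exact hant u huI b (mem_insert_of_mem hbτ)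
  have hpair : ∀ {F v w}, (P.cfg hd0).IsF F → v ∈ F → w ∈ F → (P.cfg hd0).Face {v, w} := by
    intro F v w hF hv hw
    refine hF.face ?_
    intro x hx
    simp only [mem_insert, mem_singleton] at hx
    rcases hx with rfl | rfl <;> assumption
  -- local step
  have hm2 : m2 = 0 := by
    set M : (Fin d → ℝ) → (Fin d → ℝ) × ℝ →ₗ[ℝ] ℝ := fun v =>
      if v = -u ∧ η (-s0, 1) < 0 then vM m2 (-u) else vM (m v) v with hM
    have hMne : ∀ v, v ≠ -u → M v = vM (m v) v := by
      intro v hv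
      simp only [hM]
      rw [if_neg (fun h => hv h.1)]
    have hMself : ∀ v, M v (v, 1) = 0 := by
      intro v
      simp only [hM]
      split_ifs with h
      · rw [h.1, vM_self]
      · rw [vM_self]
    have hMneg : ∀ F, (P.cfg hd0).IsF F → σ ⊆ F → ∀ w ∈ F, -u ∈ F → w ≠ -u →
        M (-u) (w, 1) + M w (-u, 1) = 0 := by
      intro F hF hσF w hw huF hwu
      have hF' := isF_neg P hd0 hcs hF
      have hu' : u ∈ F.image fun v => -v := mem_image.2 ⟨-u, huF, neg_neg u⟩
      have hw' : -w ∈ F.image fun v => -v := mem_image_of_mem _ hw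
      have hs' : -s0 ∈ F.image fun v => -v := mem_image_of_mem _ (hσF hs0)
      have hs0ne : η (-s0, 1) ≠ 0 := by
        intro h
        have := ms.h1 hF' hu' hs' h
        exact hant s0 (mem_insert_of_mem hs0τ) (-s0) this rfl
      have huw : u ≠ -w := by
        rintro h
        exact hwu (by rw [h, neg_neg])
      have hfw := hpair hF' hu' hw'
      rw [hMne w hwu]
      simp only [hM]
      by_cases hs : η (-s0, 1) < 0
      · rw [if_pos ⟨trivial, hs⟩, vM_add]
        have h0 : η (-w, 1) ≤ 0 := by
          by_contra hc
          exact ms.h2 hF' hu' hw' hs' (not_le.1 hc) hs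
        have := E3 (-w) huw hfw h0
        rw [hneg] at this
        rw [dotR_anti _ _ _ _ this, neg_zero]
      · rw [if_neg (fun h => hs h.2), vM_add]
        have hs2 : 0 < η (-s0, 1) := lt_of_le_of_ne (not_lt.1 hs) hs0ne.symm
        have h0 : 0 ≤ η (-w, 1) := by
          by_contra hc
          exact ms.h2 hF' hu' hs' hw' hs2 (not_le.1 hc)
        have := E2 (-w) huw hfw h0
        rw [hneg] at this
        rw [hneg, dotR_anti _ _ _ _ this, neg_zero]
    have ms' : (P.cfg hd0).Miss (insert a (insert b σ)) u η := by rw [hτeq]; exact ms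
    have hst := Cfg.stage1 ms' (show σ.card + 3 = d by omega) M (vM m2 u) (by
        intro F hF hσF v hv w hw hvu hwu
        change M v (w, 1) + M w (v, 1) = 0
        by_cases hvw : v = w
        · subst hvw; rw [hMself]; simp
        by_cases h1 : v = -u
        · subst h1
          exact hMneg F hF hσF w hw hv (Ne.symm hvw)
        by_cases h2 : w = -u
        · subst h2
          rw [add_comm]
          exact hMneg F hF hσF v hv hw h1
        rw [hMne v h1, hMne w h2, vM_add, E1 v w hvw (hpair hF hv hw) hvu h1 hwu h2, neg_zero]) (by
        intro F hF hσF huF j hj hη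
        change M u (j, 1) + M j (u, 1) = 0
        by_cases hju : u = j
        · subst hju; rw [hMself]; simp
        have hj' : j ≠ -u := by
          rintro rfl
          exact no_antipodal P hd0 hcs (hF.face (Subset.refl F)) huF hj
        rw [hMne u hnn.symm, hMne j hj', vM_add, E2 j hju (hpair hF huF hj) hη, neg_zero]) (by
        intro F hF hσF huF j hj hju hη
        change vM m2 u (j, 1) + M j (u, 1) = 0
        have hj' : j ≠ -u := by
          rintro rfl
          exact no_antipodal P hd0 hcs (hF.face (Subset.refl F)) huF hj
        rw [hMne j hj', vM_add, E3 j hju.symm (hpair hF huF hj) hη, neg_zero])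
      (vM_self m2 u) (by
        change M a (b, 1) + M b (a, 1) = 0
        rw [hMne a (hant u huI a (mem_insert_of_mem ha)),
          hMne b (hant u huI b (mem_insert_of_mem hbτ)), vM_add, hab, neg_zero])
    rw [hMne u hnn.symm, hmu] at hst
    apply eq_zero_of_dotR
    intro x
    have := LinearMap.congr_fun hst (x, 0)
    rw [vM_apply, vM_apply] at this
    simpa [dotR] using this
  -- global step
  have Eu : ∀ w, u ≠ w → (P.cfg hd0).Face {u, w} → dotR (u - w) (m u - m w) = 0 := by
    intro w huw hw
    rcases le_total 0 (η (w, 1)) with h | h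
    · exact E2 w huw hw h
    · have := E3 w huw hw h
      rw [hm2] at this
      rw [hmu]; exact this
  have Eu' : ∀ w, w ≠ -u → (P.cfg hd0).Face {-u, w} → dotR (-u - w) (m (-u) - m w) = 0 := by
    intro w huw hw
    have huw' : u ≠ -w := by
      intro h
      exact huw (by rw [h, neg_neg])
    have := Eu (-w) huw' (face_pair_neg P hd0 hcs hw)
    rw [hneg] at this
    rw [hneg]
    exact dotR_anti _ _ _ _ this
  refine hnz ⟨stage2 P hd hd0 m hneg u hu hcs hmu ?_, hm2⟩
  intro v w hvw hF
  have hF' : (P.cfg hd0).Face {w, v} := by rw [pair_comm]; exact hF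
  by_cases h1 : v = u
  · subst h1; exact Eu w hvw hF
  by_cases h2 : w = u
  · subst h2; exact dotR_flip _ _ _ _ (Eu v (Ne.symm hvw) hF')
  by_cases h3 : v = -u
  · subst h3; exact Eu' w (Ne.symm hvw) hF
  by_cases h4 : w = -u
  · subst h4; exact dotR_flip _ _ _ _ (Eu' v hvw hF')
  exact E1 v w hvw hF h1 h3 h2 h4

end SPolytope

/-- Let `d ≥ 4` and let `P` be a prime cs simplicial `d`-polytope with
`g₂(P) = C(d,2) - d`. Then for every vertex `u` of `P`, the link `lk(u)` is prime:
it has no missing face of cardinality `d - 1`. -/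
theorem stmt15 {d : ℕ} (hd : 4 ≤ d) (P : SPolytope d) (hp : IsPrimePoly P) (hcs : IsCS P)
    (hg2 : g2 P = (d.choose 2 : ℤ) - (d : ℤ)) (u : Fin d → ℝ) (hu : u ∈ P.V) :
    ¬ ∃ τ : Finset (Fin d → ℝ), τ.card = d - 1 ∧
      ¬ LinkFace P {u} τ ∧ (∀ ρ ⊂ τ, LinkFace P {u} ρ) := by
  rintro ⟨τ, hc, h1, h2⟩
  have hd0 : 0 < d := by omega
  obtain ⟨η, ms⟩ := SPolytope.exists_miss P hd hd0 hp u τ hc h1 h2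
  refine SPolytope.main P hd hd0 hcs ?_ u hu τ η ms
  unfold g2 at hg2
  have h3 : (d + 1).choose 2 = d + d.choose 2 := by
    rw [Nat.choose_succ_succ' d 1, Nat.choose_one_right]
  rw [h3] at hg2
  push_cast at hg2
  linarith
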